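/- Let f ∈ C([0,∞)), suppose that the mapping t ↦ g(t)·t^{1−N} is strictly decreasing on (0,∞), and let u be a weak solution of problem (P) in B_R which is also a local minimizer of J in X. Then u is radially symmetric and radially non-increasing, i.e. u(x) = U(|x|) with U ∈ C^1([0,R]) non-increasing; moreover there is R' ∈ [0,R) such that U'(r) < 0 for r ∈ (R',R) and U(r) is constant for r ∈ [0,R']. -/

import Mathlib

open Set Metric MeasureTheory Bornology
open scoped RealInnerProductSpace Classical

noncomputable section

/-- The vector field `y ↦ (g(|y|)/|y|)·y`, with the convention that it vanishes at `y = 0`. -/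
def gvec {N : ℕ} (g : ℝ → ℝ) (y : EuclideanSpace ℝ (Fin N)) : EuclideanSpace ℝ (Fin N) :=
  if y = 0 then 0 else (g ‖y‖ / ‖y‖) • y

/-- `φ` is a smooth test function compactly supported in `Ω`. -/
def IsTestFun {N : ℕ} (Ω : Set (EuclideanSpace ℝ (Fin N)))
    (φ : EuclideanSpace ℝ (Fin N) → ℝ) : Prop :=
  ContDiff ℝ (⊤ : ℕ∞) φ ∧ HasCompactSupport φ ∧ tsupport φ ⊆ Ω

/-- Conditions (2.1)-(2.2): `g ∈ C[0,∞) ∩ C¹(0,∞)`, `g(0) = 0`, `g'(t) > 0` for `t > 0`. -/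
def GCond (g : ℝ → ℝ) : Prop :=
  ContinuousOn g (Ici 0) ∧ ContDiffOn ℝ 1 g (Ioi 0) ∧ g 0 = 0 ∧
    ∀ t : ℝ, 0 < t → 0 < deriv g t

/-- Conditions (2.3)-(2.4): `f ∈ C([0,R] × [0,∞))`, `r ↦ f(r,t)` non-increasing. -/
def FCond (R : ℝ) (f : ℝ → ℝ → ℝ) : Prop :=
  ContinuousOn (fun q : ℝ × ℝ => f q.1 q.2) (Icc 0 R ×ˢ Ici 0) ∧
    ∀ t : ℝ, 0 ≤ t → ∀ r₁ ∈ Icc (0:ℝ) R, ∀ r₂ ∈ Icc (0:ℝ) R, r₁ ≤ r₂ → f r₂ t ≤ f r₁ t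

/-- `u` solves `-div((g(|∇u|)/|∇u|)∇u) = f(|x|,u)` distributionally in the ball `B_R`. -/
def IsDistribSolBall {N : ℕ} (R : ℝ) (g : ℝ → ℝ) (f : ℝ → ℝ → ℝ)
    (u : EuclideanSpace ℝ (Fin N) → ℝ) : Prop :=
  ∀ φ : EuclideanSpace ℝ (Fin N) → ℝ, IsTestFun (ball 0 R) φ →
    (∫ x in ball (0:EuclideanSpace ℝ (Fin N)) R, ⟪gvec g (gradient u x), gradient φ x⟫) =
      ∫ x in ball (0:EuclideanSpace ℝ (Fin N)) R, f ‖x‖ (u x) * φ x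

/-- `u` is a weak solution of problem (P): `u ∈ C¹(clos B_R)`, `u ≥ 0`, `u ≢ 0`,
`u = 0` on `∂B_R`, and the equation holds distributionally. -/
def IsWeakSolP {N : ℕ} (R : ℝ) (g : ℝ → ℝ) (f : ℝ → ℝ → ℝ)
    (u : EuclideanSpace ℝ (Fin N) → ℝ) : Prop :=
  ContDiffOn ℝ 1 u (closedBall 0 R) ∧
  (∀ x ∈ closedBall (0:EuclideanSpace ℝ (Fin N)) R, 0 ≤ u x) ∧
  (∃ x ∈ closedBall (0:EuclideanSpace ℝ (Fin N)) R, u x ≠ 0) ∧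
  (∀ x ∈ sphere (0:EuclideanSpace ℝ (Fin N)) R, u x = 0) ∧
  IsDistribSolBall R g f u

/-- `U` is `C¹` on `[a,b]` with (continuous) derivative `U'`. -/
def C1On (U U' : ℝ → ℝ) (a b : ℝ) : Prop :=
  ContinuousOn U' (Icc a b) ∧ ∀ r ∈ Icc a b, HasDerivWithinAt U (U' r) (Icc a b) r

/-- Definition 2.1: `u` is locally symmetric in `B_R`. -/
def LocallySymmetric {N : ℕ} (R : ℝ) (u : EuclideanSpace ℝ (Fin N) → ℝ) : Prop :=
  ∃ (K : Set ℕ) (z : ℕ → EuclideanSpace ℝ (Fin N)) (ri ro : ℕ → ℝ) (U U' : ℕ → ℝ → ℝ),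
    (∀ k ∈ K, z k ∈ ball (0:EuclideanSpace ℝ (Fin N)) R ∧ 0 ≤ ri k ∧ ri k < ro k) ∧
    K.PairwiseDisjoint (fun k => ball (z k) (ro k) \ closedBall (z k) (ri k)) ∧
    ball (0:EuclideanSpace ℝ (Fin N)) R =
      (⋃ k ∈ K, ball (z k) (ro k) \ closedBall (z k) (ri k)) ∪
        {x ∈ ball (0:EuclideanSpace ℝ (Fin N)) R | gradient u x = 0} ∧
    ∀ k ∈ K,
      C1On (U k) (U' k) (ri k) (ro k) ∧
      (∀ x ∈ ball (z k) (ro k) \ closedBall (z k) (ri k), u x = U k ‖x - z k‖) ∧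
      (∀ r ∈ Ioo (ri k) (ro k), U' k r < 0) ∧
      (∀ x ∈ ball (z k) (ri k), U k (ri k) ≤ u x)

/-- `H(t) = t·g(t) - ∫₀ᵗ g(s) ds`. -/
def Hfun (g : ℝ → ℝ) (t : ℝ) : ℝ := t * g t - ∫ s in (0:ℝ)..t, g s

/-- The inverse of `H` on `[0,∞)`. -/
def Hinv (g : ℝ → ℝ) : ℝ → ℝ := Function.invFunOn (Hfun g) (Ici 0)

/-- The class `A_g` of Definition 3.1. -/
def MemAg (g φ : ℝ → ℝ) : Prop :=
  ContinuousOn φ (Ici 0) ∧ (∀ t : ℝ, 0 ≤ t → 0 ≤ φ t) ∧ φ 0 = 0 ∧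
  ((∃ d > (0:ℝ), ∀ t ∈ Icc (0:ℝ) d, φ t = 0) ∨
    ∃ δ > (0:ℝ), (∀ t ∈ Ioo (0:ℝ) δ, 0 < φ t) ∧
      ∫⁻ t in Ioc (0:ℝ) δ, ENNReal.ofReal (1 / Hinv g (∫ s in (0:ℝ)..t, φ s)) = ⊤)

/-- `u` satisfies `div((g(|∇u|)/|∇u|)∇u) ≤ φ(u)` distributionally in `Ω`. -/
def DistribSupIneq {N : ℕ} (Ω : Set (EuclideanSpace ℝ (Fin N))) (g φ : ℝ → ℝ)
    (u : EuclideanSpace ℝ (Fin N) → ℝ) : Prop :=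
  ∀ ψ : EuclideanSpace ℝ (Fin N) → ℝ, IsTestFun Ω ψ → (∀ x, 0 ≤ ψ x) →
    -(∫ x in Ω, ⟪gvec g (gradient u x), gradient ψ x⟫) ≤ ∫ x in Ω, φ (u x) * ψ x

/-- Condition (a) of Lemma 3.7. -/
def CondA (R : ℝ) (g : ℝ → ℝ) (f : ℝ → ℝ → ℝ) : Prop :=
  ∀ ρ ∈ Ico (0:ℝ) R, ∀ τ : ℝ, 0 < τ → f ρ τ = 0 →
    ∃ δ ∈ Ioo (0:ℝ) τ, ∃ φ : ℝ → ℝ, MemAg g φ ∧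
      ∀ t ∈ Icc (τ - δ) τ, ∀ r ∈ Icc (ρ - δ) (ρ + δ) ∩ Icc (0:ℝ) R, f r t ≤ φ (τ - t)

/-- Condition (b) of Lemma 3.8. -/
def CondB (R : ℝ) (g : ℝ → ℝ) (f : ℝ → ℝ → ℝ) : Prop :=
  ∀ ρ ∈ Ico (0:ℝ) R, f ρ 0 = 0 →
    ∃ δ > (0:ℝ), ∃ φ : ℝ → ℝ, MemAg g φ ∧
      ∀ r ∈ Ico (0:ℝ) R, ∀ t ∈ Icc (0:ℝ) δ, -f r t ≤ φ t

/-- Condition (c) of Theorem 3.9. -/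
def CondC (R : ℝ) (g : ℝ → ℝ) (f : ℝ → ℝ → ℝ) : Prop :=
  ∀ ρ ∈ Ico (0:ℝ) R, ∀ τ : ℝ, 0 ≤ τ → f ρ τ = 0 →
    ∃ δ > (0:ℝ), ∃ φ : ℝ → ℝ, MemAg g φ ∧
      ∀ t ∈ Icc τ (τ + δ), ∀ r ∈ Icc (ρ - δ) (ρ + δ) ∩ Icc (0:ℝ) R, -f r t ≤ φ (t - τ)

/-- `u` solves `-div((g(|∇u|)/|∇u|)∇u) = f(u)` distributionally in `Ω` (autonomous case). -/
def IsDistribSolAut {N : ℕ} (Ω : Set (EuclideanSpace ℝ (Fin N))) (g f : ℝ → ℝ)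
    (u : EuclideanSpace ℝ (Fin N) → ℝ) : Prop :=
  ∀ φ : EuclideanSpace ℝ (Fin N) → ℝ, IsTestFun Ω φ →
    (∫ x in Ω, ⟪gvec g (gradient u x), gradient φ x⟫) = ∫ x in Ω, f (u x) * φ x

/-- `u` is a weak solution of problem (P) with autonomous right-hand side `f = f(u)`. -/
def IsWeakSolPAut {N : ℕ} (R : ℝ) (g f : ℝ → ℝ) (u : EuclideanSpace ℝ (Fin N) → ℝ) : Prop :=
  ContDiffOn ℝ 1 u (closedBall 0 R) ∧
  (∀ x ∈ closedBall (0:EuclideanSpace ℝ (Fin N)) R, 0 ≤ u x) ∧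
  (∃ x ∈ closedBall (0:EuclideanSpace ℝ (Fin N)) R, u x ≠ 0) ∧
  (∀ x ∈ sphere (0:EuclideanSpace ℝ (Fin N)) R, u x = 0) ∧
  IsDistribSolAut (ball 0 R) g f u

/-- `G(t) = ∫₀ᵗ g(s) ds`. -/
def Gfun (g : ℝ → ℝ) (t : ℝ) : ℝ := ∫ s in (0:ℝ)..t, g s

/-- The variational functional `J(v) = ∫_Ω (G(|∇v|) - F(v)) dx`. -/
def Jfun {N : ℕ} (g f : ℝ → ℝ) (Ω : Set (EuclideanSpace ℝ (Fin N)))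
    (v : EuclideanSpace ℝ (Fin N) → ℝ) : ℝ :=
  ∫ x in Ω, (Gfun g ‖gradient v x‖ - Gfun f (v x))

/-- `v ∈ X`, i.e. `v ∈ C¹(clos Ω)` with `v = 0` on `∂Ω`. -/
def MemX {N : ℕ} (Ω : Set (EuclideanSpace ℝ (Fin N)))
    (v : EuclideanSpace ℝ (Fin N) → ℝ) : Prop :=
  ContDiffOn ℝ 1 v (closure Ω) ∧ ∀ x ∈ frontier Ω, v x = 0

/-- `u` is a global minimizer of `J` in `X`. -/
def IsGlobalMinJ {N : ℕ} (g f : ℝ → ℝ) (Ω : Set (EuclideanSpace ℝ (Fin N)))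
    (u : EuclideanSpace ℝ (Fin N) → ℝ) : Prop :=
  MemX Ω u ∧ ∀ v, MemX Ω v → Jfun g f Ω u ≤ Jfun g f Ω v

/-- `u` is a local minimizer of `J` in `X` (w.r.t. the `C¹` distance). -/
def IsLocalMinJ {N : ℕ} (g f : ℝ → ℝ) (Ω : Set (EuclideanSpace ℝ (Fin N)))
    (u : EuclideanSpace ℝ (Fin N) → ℝ) : Prop :=
  MemX Ω u ∧ ∃ ε > (0:ℝ), ∀ v, MemX Ω v →
    (∀ x ∈ Ω, |v x - u x| + ‖gradient v x - gradient u x‖ < ε) →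
    Jfun g f Ω u ≤ Jfun g f Ω v

/-- `Ω` has `C¹` boundary: near every boundary point, `Ω` is the sublevel set of a `C¹`
defining function with nonvanishing gradient. -/
def HasC1Boundary {N : ℕ} (Ω : Set (EuclideanSpace ℝ (Fin N))) : Prop :=
  ∀ y ∈ frontier Ω, ∃ (V : Set (EuclideanSpace ℝ (Fin N))) (ρ : EuclideanSpace ℝ (Fin N) → ℝ),
    IsOpen V ∧ y ∈ V ∧ ContDiffOn ℝ 1 ρ V ∧ (∀ x ∈ V, (x ∈ Ω ↔ ρ x < 0)) ∧ gradient ρ y ≠ 0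

/-- The Neumann condition `∂u/∂ν = 0` on `∂Ω`; for `u ∈ X` (so that `u` vanishes on the
boundary and all tangential derivatives vanish) this is equivalent to the vanishing of the
full derivative of `u` (within `clos Ω`) at every boundary point. -/
def NeumannZero {N : ℕ} (Ω : Set (EuclideanSpace ℝ (Fin N)))
    (u : EuclideanSpace ℝ (Fin N) → ℝ) : Prop :=
  ∀ y ∈ frontier Ω, HasFDerivWithinAt u (0 : EuclideanSpace ℝ (Fin N) →L[ℝ] ℝ) (closure Ω) y

/-- `u` is radially symmetric and radially non-increasing on `clos B_R`, with `C¹`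
profile `U` (with derivative `U'`). -/
def RadialNonincreasing {N : ℕ} (R : ℝ) (u : EuclideanSpace ℝ (Fin N) → ℝ)
    (U U' : ℝ → ℝ) : Prop :=
  C1On U U' 0 R ∧ AntitoneOn U (Icc 0 R) ∧
    ∀ x ∈ closedBall (0:EuclideanSpace ℝ (Fin N)) R, u x = U ‖x‖

end

section Aux
open Set Metric MeasureTheory Bornology
open scoped RealInnerProductSpace Classical

noncomputable section

abbrev Eu (N : ℕ) := EuclideanSpace ℝ (Fin N)

structure Gd (g : ℝ → ℝ) : Prop where
  cont : Continuous g
  nonpos : ∀ t ≤ 0, g t = 0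
  c1 : ContDiffOn ℝ 1 g (Ioi 0)
  dpos : ∀ t, 0 < t → 0 < deriv g t

namespace Gd
variable {g : ℝ → ℝ}

theorem zero (hg : Gd g) : g 0 = 0 := hg.nonpos 0 le_rfl

theorem smono (hg : Gd g) : StrictMonoOn g (Ici 0) := by
  apply strictMonoOn_of_deriv_pos (convex_Ici 0) hg.cont.continuousOn
  intro x hx
  rw [interior_Ici] at hx
  exact hg.dpos x hx

theorem mono (hg : Gd g) : MonotoneOn g (Ici 0) := hg.smono.monotoneOn

theorem pos (hg : Gd g) {t : ℝ} (ht : 0 < t) : 0 < g t := by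
  have := hg.smono (self_mem_Ici) ht.le ht
  rwa [hg.zero] at this

theorem nonneg (hg : Gd g) (t : ℝ) : 0 ≤ g t := by
  rcases le_or_gt t 0 with h | h
  · rw [hg.nonpos t h]
  · exact (hg.pos h).le

theorem mon (hg : Gd g) : Monotone g := by
  intro s t hst
  rcases le_or_gt s 0 with h | h
  · rw [hg.nonpos s h]; exact hg.nonneg t
  · exact hg.mono h.le (h.le.trans hst) hst

end Gd

theorem Gfun_hasDerivAt {g : ℝ → ℝ} (hg : Continuous g) (t : ℝ) : HasDerivAt (Gfun g) (g t) t :=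
  intervalIntegral.integral_hasDerivAt_right (hg.intervalIntegrable _ _)
    (hg.stronglyMeasurableAtFilter _ _) hg.continuousAt

theorem Gfun_cont {g : ℝ → ℝ} (hg : Continuous g) : Continuous (Gfun g) :=
  continuous_iff_continuousAt.2 fun t => (Gfun_hasDerivAt hg t).continuousAt

theorem Gfun_zero (g : ℝ → ℝ) : Gfun g 0 = 0 := by simp [Gfun]

theorem Gfun_sub {g : ℝ → ℝ} (hg : Continuous g) (s t : ℝ) :
    Gfun g t - Gfun g s = ∫ x in s..t, g x := by
  unfold Gfun
  rw [intervalIntegral.integral_interval_sub_left (hg.intervalIntegrable _ _)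
    (hg.intervalIntegrable _ _)]

/-- supporting line inequality -/
theorem Gd.convex {g : ℝ → ℝ} (hg : Gd g) (s t : ℝ) : g s * (t - s) ≤ Gfun g t - Gfun g s := by
  rw [Gfun_sub hg.cont]
  rcases le_total s t with h | h
  · have := intervalIntegral.integral_mono_on h (μ := volume) (f := fun _ => g s) (g := g)
      intervalIntegrable_const (hg.cont.intervalIntegrable _ _) (fun x hx => hg.mon hx.1)
    simp at this
    nlinarith
  · have := intervalIntegral.integral_mono_on h (μ := volume) (g := fun _ => g s) (f := g)
      (hg.cont.intervalIntegrable _ _) intervalIntegrable_const (fun x hx => hg.mon hx.2)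
    rw [intervalIntegral.integral_symm]
    simp at this
    nlinarith

theorem Gd.G_nonneg {g : ℝ → ℝ} (hg : Gd g) (t : ℝ) : 0 ≤ Gfun g t := by
  have := hg.convex 0 t
  rw [hg.zero, Gfun_zero] at this
  linarith

section vec
variable {N : ℕ} {g : ℝ → ℝ}

theorem gvec_eq (g : ℝ → ℝ) (y : Eu N) : gvec g y = (g ‖y‖ / ‖y‖) • y := by
  unfold gvec; split_ifs with h
  · simp [h]
  · rfl

theorem gvec_zero (g : ℝ → ℝ) : gvec g (0 : Eu N) = 0 := by simp [gvec]

theorem gvec_norm (hg : Gd g) (y : Eu N) : ‖gvec g y‖ = g ‖y‖ := by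
  rw [gvec_eq, norm_smul, Real.norm_of_nonneg (div_nonneg (hg.nonneg _) (norm_nonneg _))]
  by_cases h : y = 0
  · simp [h, hg.zero]
  · have : ‖y‖ ≠ 0 := norm_ne_zero_iff.2 h
    field_simp

theorem gvec_cont (hg : Gd g) : Continuous (gvec g : Eu N → Eu N) := by
  rw [continuous_iff_continuousAt]
  intro x
  by_cases h : x = 0
  · subst h
    unfold ContinuousAt
    rw [gvec_zero, tendsto_zero_iff_norm_tendsto_zero]
    simp_rw [gvec_norm hg]
    have : Continuous (fun e : Eu N => g ‖e‖) := hg.cont.comp continuous_norm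
    have := this.tendsto 0
    simpa [hg.zero] using this
  · have : (gvec g : Eu N → Eu N) = fun y => (g ‖y‖ / ‖y‖) • y := funext (gvec_eq g)
    rw [this]
    have h1 : ContinuousAt (fun y : Eu N => g ‖y‖) x := (hg.cont.comp continuous_norm).continuousAt
    exact (h1.div continuous_norm.continuousAt (norm_ne_zero_iff.2 h)).smul continuousAt_id

theorem gvec_inner (g : ℝ → ℝ) (p q : Eu N) : ⟪gvec g p, q⟫ = g ‖p‖ / ‖p‖ * ⟪p, q⟫ := by
  rw [gvec_eq, real_inner_smul_left]

theorem gvec_inner_self (hg : Gd g) (p : Eu N) : ⟪gvec g p, p⟫ = g ‖p‖ * ‖p‖ := by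
  rw [gvec_inner, real_inner_self_eq_norm_sq]
  by_cases h : p = 0
  · simp [h]
  · have : ‖p‖ ≠ 0 := norm_ne_zero_iff.2 h
    field_simp

theorem gvec_inner_le (hg : Gd g) (p q : Eu N) : ⟪gvec g p, q⟫ ≤ g ‖p‖ * ‖q‖ := by
  rw [← gvec_norm hg]; exact real_inner_le_norm _ _

theorem gvec_convex (hg : Gd g) (p q : Eu N) :
    ⟪gvec g p, q - p⟫ ≤ Gfun g ‖q‖ - Gfun g ‖p‖ := by
  rw [inner_sub_right, gvec_inner_self hg]
  have := gvec_inner_le hg p q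
  have := hg.convex ‖p‖ ‖q‖
  nlinarith

/-- the Legendre-type function -/
def Hv (g : ℝ → ℝ) (p : Eu N) : ℝ := ⟪gvec g p, p⟫ - Gfun g ‖p‖

theorem Hv_cont (hg : Gd g) : Continuous (Hv g : Eu N → ℝ) := by
  unfold Hv
  have := gvec_cont (N := N) hg
  have := Gfun_cont hg.cont
  fun_prop

/-- derivative bounds on a compact interval -/
theorem Gd.bounds (hg : Gd g) {d M : ℝ} (hd : 0 < d) (hdM : d ≤ M) :
    ∃ c C : ℝ, 0 < c ∧ 0 < C ∧ ∀ s ∈ Icc d M, ∀ t ∈ Icc d M, s ≤ t →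
      c * (t - s) ≤ g t - g s ∧ g t - g s ≤ C * (t - s) := by
  have hc : ContinuousOn (deriv g) (Icc d M) :=
    (hg.c1.continuousOn_deriv_of_isOpen isOpen_Ioi le_rfl).mono fun x hx => hd.trans_le hx.1
  obtain ⟨x, hx, hxm⟩ := isCompact_Icc.exists_isMinOn (nonempty_Icc.2 hdM) hc
  obtain ⟨y, hy, hyM⟩ := isCompact_Icc.exists_isMaxOn (nonempty_Icc.2 hdM) hc
  refine ⟨deriv g x, deriv g y, hg.dpos x (hd.trans_le hx.1), hg.dpos y (hd.trans_le hy.1), ?_⟩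
  intro s hs t ht hst
  have hdiff : DifferentiableOn ℝ g (interior (Icc d M)) := by
    intro z hz
    have hz := interior_subset hz
    have : ContDiffAt ℝ 1 g z := hg.c1.contDiffAt (Ioi_mem_nhds (hd.trans_le hz.1))
    exact (this.differentiableAt one_ne_zero).differentiableWithinAt
  exact ⟨(convex_Icc d M).mul_sub_le_image_sub_of_le_deriv hg.cont.continuousOn hdiff
      (fun z hz => hxm (interior_subset hz)) s hs t ht hst,
    (convex_Icc d M).image_sub_le_mul_sub_of_deriv_le hg.cont.continuousOn hdiff
      (fun z hz => hyM (interior_subset hz)) s hs t ht hst⟩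

set_option maxHeartbeats 1000000 in
theorem annulus_bounds (hg : Gd g) {d M : ℝ} (hd : 0 < d) (hdM : d ≤ M) :
    ∃ c C : ℝ, 0 < c ∧ 0 < C ∧ ∀ p q : Eu N, ‖p‖ ∈ Icc d M → ‖q‖ ∈ Icc d M →
      c * ‖q - p‖ ^ 2 ≤ ⟪gvec g q - gvec g p, q - p⟫ ∧
      ‖gvec g q - gvec g p‖ ≤ C * ‖q - p‖ ∧ |Hv g q - Hv g p| ≤ C * ‖q - p‖ := by
  obtain ⟨c, C, hc, hC, hb⟩ := hg.bounds hd hdM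
  have hM : 0 < M := hd.trans_le hdM
  have hgd := hg.pos hd
  have hgM := hg.pos hM
  refine ⟨min c (g d / M), C + g M / d + M * C, lt_min hc (by positivity), by positivity, ?_⟩
  intro p q hp hq
  have hp0 : 0 < ‖p‖ := hd.trans_le hp.1
  have hq0 : 0 < ‖q‖ := hd.trans_le hq.1
  have hsq : ‖q - p‖ ^ 2 = (‖q‖ - ‖p‖) ^ 2 + 2 * (‖p‖ * ‖q‖ - ⟪p, q⟫) := by
    rw [norm_sub_sq_real, real_inner_comm]; ring
  have hcs : 0 ≤ ‖p‖ * ‖q‖ - ⟪p, q⟫ := sub_nonneg.2 (real_inner_le_norm _ _)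
  set X := ‖p‖ * ‖q‖ - ⟪p, q⟫ with hX
  have hpq : ⟪p, q⟫ = ‖p‖ * ‖q‖ - X := by rw [hX]; ring
  have hgp : g d ≤ g ‖p‖ := hg.mon hp.1
  have hgq : g d ≤ g ‖q‖ := hg.mon hq.1
  have hgp2 : g ‖p‖ ≤ g M := hg.mon hp.2
  have hgq2 : g ‖q‖ ≤ g M := hg.mon hq.2
  have l1 : g d / M ≤ g ‖p‖ / ‖p‖ := div_le_div₀ (hg.nonneg _) hgp hp0 hp.2
  have l2 : g d / M ≤ g ‖q‖ / ‖q‖ := div_le_div₀ (hg.nonneg _) hgq hq0 hq.2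
  have m1 : g ‖p‖ / ‖p‖ ≤ g M / d := div_le_div₀ (hg.nonneg _) hgp2 hd hp.1
  have m2 : g ‖q‖ / ‖q‖ ≤ g M / d := div_le_div₀ (hg.nonneg _) hgq2 hd hq.1
  have hdiff : c * (‖q‖ - ‖p‖) ^ 2 ≤ (g ‖q‖ - g ‖p‖) * (‖q‖ - ‖p‖) ∧
      |g ‖q‖ - g ‖p‖| ≤ C * |‖q‖ - ‖p‖| := by
    rcases le_total ‖p‖ ‖q‖ with h | h
    · have := hb _ hp _ hq h
      constructor
      · nlinarith
      · rw [abs_of_nonneg (sub_nonneg.2 (hg.mon h)), abs_of_nonneg (sub_nonneg.2 h)]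
        exact this.2
    · have := hb _ hq _ hp h
      constructor
      · nlinarith
      · rw [abs_of_nonpos (sub_nonpos.2 (hg.mon h)), abs_of_nonpos (sub_nonpos.2 h)]
        linarith [this.2]
  have hn : |‖q‖ - ‖p‖| ≤ ‖q - p‖ := abs_norm_sub_norm_le q p
  have cq : g ‖q‖ / ‖q‖ * ‖q‖ = g ‖q‖ := by field_simp
  have cp : g ‖p‖ / ‖p‖ * ‖p‖ = g ‖p‖ := by field_simp
  refine ⟨?_, ?_, ?_⟩
  · have e : ⟪gvec g q - gvec g p, q - p⟫ = (g ‖q‖ - g ‖p‖) * (‖q‖ - ‖p‖) +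
        (g ‖q‖ / ‖q‖ + g ‖p‖ / ‖p‖) * X := by
      rw [inner_sub_left, inner_sub_right, inner_sub_right, gvec_inner_self hg, gvec_inner_self hg,
        gvec_inner, gvec_inner, real_inner_comm p q, hpq]
      linear_combination (-‖p‖) * cq + (-‖q‖) * cp
    rw [e, hsq]
    have h1 : min c (g d / M) ≤ c := min_le_left _ _
    have h2 : min c (g d / M) ≤ g d / M := min_le_right _ _
    nlinarith [sq_nonneg (‖q‖ - ‖p‖)]
  · have e : ‖gvec g q - gvec g p‖ ^ 2 = (g ‖q‖ - g ‖p‖) ^ 2 +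
        2 * ((g ‖q‖ / ‖q‖) * (g ‖p‖ / ‖p‖)) * X := by
      rw [norm_sub_sq_real, gvec_norm hg, gvec_norm hg, gvec_inner, gvec_eq, real_inner_smul_right,
        real_inner_comm p q, hpq]
      linear_combination (-2 * (g ‖p‖ / ‖p‖) * ‖p‖) * cq + (-2 * g ‖q‖) * cp
    refine le_of_sq_le_sq ?_ (by positivity)
    rw [e, mul_pow, hsq]
    have h3 : (g ‖q‖ - g ‖p‖) ^ 2 ≤ C ^ 2 * (‖q‖ - ‖p‖) ^ 2 := by
      rw [← mul_pow]; apply sq_le_sq.2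
      rw [abs_mul, abs_of_pos hC]; exact hdiff.2
    have h4 : (g ‖q‖ / ‖q‖) * (g ‖p‖ / ‖p‖) ≤ (g M / d) ^ 2 := by
      rw [sq]; exact mul_le_mul m2 m1 (div_nonneg (hg.nonneg _) hp0.le) (by positivity)
    have p1 := mul_pos hM hC
    have p2 := div_pos hgM hd
    have h5 : C ^ 2 ≤ (C + g M / d + M * C) ^ 2 :=
      pow_le_pow_left₀ hC.le (by linarith) 2
    have h6 : (g M / d) ^ 2 ≤ (C + g M / d + M * C) ^ 2 :=
      pow_le_pow_left₀ p2.le (by linarith) 2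
    have k1 := mul_le_mul_of_nonneg_right (h4.trans h6) hcs
    have k2 := mul_le_mul_of_nonneg_right h5 (sq_nonneg (‖q‖ - ‖p‖))
    linarith
  · have key : ∀ s ∈ Icc d M, ∀ t ∈ Icc d M, s ≤ t →
        |(g t * t - Gfun g t) - (g s * s - Gfun g s)| ≤ M * C * (t - s) := by
      intro s hs t ht hst
      have h1 := hg.convex s t
      have h2 := hg.convex t s
      have h3 := (hb s hs t ht hst).2
      have h4 := hg.mon hst
      have hs0 : 0 < s := hd.trans_le hs.1
      rw [abs_le]; constructor
      · have : 0 ≤ M * C * (t - s) := mul_nonneg (by positivity) (by linarith)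
        nlinarith [mul_nonneg hs0.le (sub_nonneg.2 h4)]
      · have : t * (g t - g s) ≤ M * (C * (t - s)) :=
          mul_le_mul ht.2 h3 (by linarith) hM.le
        nlinarith
    have key2 : |Hv g q - Hv g p| ≤ M * C * |‖q‖ - ‖p‖| := by
      unfold Hv
      rw [gvec_inner_self hg, gvec_inner_self hg]
      rcases le_total ‖p‖ ‖q‖ with h | h
      · rw [abs_of_nonneg (sub_nonneg.2 h)]; exact key _ hp _ hq h
      · rw [abs_sub_comm, abs_of_nonpos (sub_nonpos.2 h), neg_sub]; exact key _ hq _ hp h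
    refine key2.trans ?_
    have h1 : M * C ≤ C + g M / d + M * C := by
      have := div_pos hgM hd
      linarith
    exact mul_le_mul h1 hn (abs_nonneg _) (by positivity)

end vec
end

open Set Metric MeasureTheory Bornology
open scoped RealInnerProductSpace Classical Topology

noncomputable section

section hgrad
variable {N : ℕ} {u v : Eu N → ℝ} {D V x : Eu N}

theorem hgr_fd : HasGradientAt u D x ↔ HasFDerivAt u (innerSL ℝ D) x := by
  rw [hasGradientAt_iff_hasFDerivAt]; rfl

theorem hgr_add (hu : HasGradientAt u D x) (hv : HasGradientAt v V x) :
    HasGradientAt (fun y => u y + v y) (D + V) x := by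
  rw [hgr_fd] at *
  rw [map_add]; exact hu.add hv

theorem hgr_sub (hu : HasGradientAt u D x) (hv : HasGradientAt v V x) :
    HasGradientAt (fun y => u y - v y) (D - V) x := by
  rw [hgr_fd] at *
  rw [map_sub]; exact hu.sub hv

theorem hgr_mul (hu : HasGradientAt u D x) (hv : HasGradientAt v V x) :
    HasGradientAt (fun y => u y * v y) (u x • V + v x • D) x := by
  rw [hgr_fd] at *
  have := hu.mul hv
  rw [map_add, map_smul, map_smul]; exact this

theorem hgr_cmul (c : ℝ) (hu : HasGradientAt u D x) :
    HasGradientAt (fun y => c * u y) (c • D) x := by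
  rw [hgr_fd] at *
  rw [map_smul]; exact hu.const_mul c

theorem hgr_comp {φ : ℝ → ℝ} {d : ℝ} (hφ : HasDerivAt φ d (u x)) (hu : HasGradientAt u D x) :
    HasGradientAt (fun y => φ (u y)) (d • D) x := by
  rw [hgr_fd] at *
  rw [map_smul]; exact hφ.comp_hasFDerivAt x hu

theorem hgr_fcomp {Φ : Eu N → Eu N} {L : Eu N →L[ℝ] Eu N} (hΦ : HasFDerivAt Φ L x)
    (hu : HasGradientAt u D (Φ x)) :
    HasGradientAt (fun y => u (Φ y)) (L.adjoint D) x := by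
  rw [hgr_fd] at *
  have h1 := hu.comp x hΦ
  have h2 : innerSL ℝ (L.adjoint D) = (innerSL ℝ D).comp L := by
    ext z
    simp [ContinuousLinearMap.adjoint_inner_left]
  rw [h2]; exact h1

theorem hgr_trans (h : Eu N) (hu : HasGradientAt u D (x + h)) :
    HasGradientAt (fun y => u (y + h)) D x := by
  have := hgr_fcomp (Φ := fun y => y + h) (L := ContinuousLinearMap.id ℝ (Eu N))
    ((hasFDerivAt_id x).add_const h) hu
  convert this using 1
  rw [ContinuousLinearMap.adjoint_id]; rfl

theorem hgr_line (h : Eu N) (s : ℝ) (hu : HasGradientAt u D (x + s • h)) :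
    HasDerivAt (fun t : ℝ => u (x + t • h)) ⟪D, h⟫ s := by
  rw [hgr_fd] at hu
  have h1 : HasDerivAt (fun t : ℝ => x + t • h) h s := by
    simpa using ((hasDerivAt_id s).smul_const h).const_add x
  exact hu.comp_hasDerivAt s h1

theorem hgr_norm_sq (x0 : Eu N) : HasGradientAt (fun y => ‖y - x0‖ ^ 2) ((2:ℝ) • (x - x0)) x := by
  rw [hgr_fd]
  have := ((hasStrictFDerivAt_norm_sq (x - x0)).hasFDerivAt).comp x ((hasFDerivAt_id x).sub_const x0)
  have h2 : innerSL ℝ ((2:ℝ) • (x - x0)) =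
      ((2 • (innerSL ℝ) (x - x0)).comp (ContinuousLinearMap.id ℝ (Eu N))) := by
    ext z; simp [inner_smul_left]
  rw [h2]; exact this

end hgrad

/-- C1 function with explicit gradient on a set -/
structure C1S {N : ℕ} (O : Set (Eu N)) (u : Eu N → ℝ) (D : Eu N → Eu N) : Prop where
  op : IsOpen O
  uc : Continuous u
  grad : ∀ x ∈ O, HasGradientAt u (D x) x
  cont : ContinuousOn D O

/-- C1 compactly supported test function with explicit gradient -/
structure Tst {N : ℕ} (O : Set (Eu N)) (ψ : Eu N → ℝ) (P : Eu N → Eu N) : Prop where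
  grad : ∀ x, HasGradientAt ψ (P x) x
  cont : Continuous P
  supp : ∃ K, IsCompact K ∧ K ⊆ O ∧ (∀ x ∉ K, ψ x = 0) ∧ ∀ x ∉ K, P x = 0

def WeakEq {N : ℕ} (O : Set (Eu N)) (g f : ℝ → ℝ) (u : Eu N → ℝ) (D : Eu N → Eu N) : Prop :=
  ∀ ψ P, Tst O ψ P → ∫ x, ⟪gvec g (D x), P x⟫ = ∫ x, f (u x) * ψ x

structure Sol {N : ℕ} (O : Set (Eu N)) (g f : ℝ → ℝ) (u : Eu N → ℝ) (D : Eu N → Eu N) : Prop where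
  c1 : C1S O u D
  weak : WeakEq O g f u D

section tst
variable {N : ℕ} {O : Set (Eu N)} {u ψ : Eu N → ℝ} {D P : Eu N → Eu N}

theorem Tst.ucont (h : Tst O ψ P) : Continuous ψ :=
  continuous_iff_continuousAt.2 fun x => (hgr_fd.1 (h.grad x)).continuousAt

theorem Tst.mono {O' : Set (Eu N)} (h : Tst O ψ P) (hO : O ⊆ O') : Tst O' ψ P :=
  ⟨h.grad, h.cont, by obtain ⟨K, a, b, c⟩ := h.supp; exact ⟨K, a, b.trans hO, c⟩⟩

theorem grad_zero_off {K : Set (Eu N)} (hK : IsClosed K) (hg : ∀ x, HasGradientAt ψ (P x) x)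
    (h0 : ∀ x ∉ K, ψ x = 0) : ∀ x ∉ K, P x = 0 := by
  intro x hx
  have h1 : ψ =ᶠ[𝓝 x] fun _ => (0:ℝ) := by
    filter_upwards [hK.isOpen_compl.mem_nhds hx] with y hy using h0 y hy
  exact ((hg x).congr_of_eventuallyEq h1.symm).unique (hasGradientAt_const x 0)

/-- build a test function from local data -/
theorem tst_mk {K : Set (Eu N)} (hO : IsOpen O) (hK : IsCompact K) (hKO : K ⊆ O)
    (h0 : ∀ x ∉ K, ψ x = 0) (hg : ∀ x ∈ O, HasGradientAt ψ (P x) x) (hc : ContinuousOn P O) :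
    Tst O ψ (fun x => if x ∈ O then P x else 0) := by
  have hg' : ∀ x, HasGradientAt ψ (if x ∈ O then P x else 0) x := by
    intro x
    split_ifs with h
    · exact hg x h
    · have hx : x ∉ K := fun h' => h (hKO h')
      have h1 : ψ =ᶠ[𝓝 x] fun _ => (0:ℝ) := by
        filter_upwards [hK.isClosed.isOpen_compl.mem_nhds hx] with y hy using h0 y hy
      exact (hasGradientAt_const x 0).congr_of_eventuallyEq h1
  have hz := grad_zero_off hK.isClosed hg' h0
  refine ⟨hg', ?_, K, hK, hKO, h0, hz⟩
  rw [continuous_iff_continuousAt]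
  intro x
  by_cases hx : x ∈ O
  · refine (hc.continuousAt (hO.mem_nhds hx)).congr ?_
    filter_upwards [hO.mem_nhds hx] with y hy
    simp [hy]
  · have hx : x ∉ K := fun h' => hx (hKO h')
    refine (continuousAt_const (y := (0 : Eu N))).congr ?_
    filter_upwards [hK.isClosed.isOpen_compl.mem_nhds hx] with y hy
    exact (hz y hy).symm

/-- continuity of products with compactly supported functions -/
theorem cont_of_supp {F : Eu N → ℝ} {K : Set (Eu N)} (hO : IsOpen O) (hK : IsClosed K) (hKO : K ⊆ O)
    (h0 : ∀ x ∉ K, F x = 0) (hc : ContinuousOn F O) : Continuous F := by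
  rw [continuous_iff_continuousAt]
  intro x
  by_cases hx : x ∈ O
  · exact hc.continuousAt (hO.mem_nhds hx)
  · have hx : x ∉ K := fun h' => hx (hKO h')
    refine (continuousAt_const (y := (0 : ℝ))).congr ?_
    filter_upwards [hK.isOpen_compl.mem_nhds hx] with y hy
    exact (h0 y hy).symm

theorem int_of_supp {F : Eu N → ℝ} {K : Set (Eu N)} (hO : IsOpen O) (hK : IsCompact K) (hKO : K ⊆ O)
    (h0 : ∀ x ∉ K, F x = 0) (hc : ContinuousOn F O) : Integrable F :=
  (cont_of_supp hO hK.isClosed hKO h0 hc).integrable_of_hasCompactSupport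
    (HasCompactSupport.intro hK h0)

/-- uniform differentiability -/
theorem unif_diff {K : Set (Eu N)} (h : C1S O u D) (hK : IsCompact K) (hKO : K ⊆ O) {ε : ℝ}
    (hε : 0 < ε) : ∃ δ > 0, ∀ x ∈ K, ∀ y, ‖y‖ < δ → x + y ∈ O ∧ ‖D (x + y) - D x‖ ≤ ε ∧
      |u (x + y) - u x - ⟪D x, y⟫| ≤ ε * ‖y‖ := by
  obtain ⟨r, hr, hrO⟩ := hK.exists_cthickening_subset_open h.op hKO
  have hcK : IsCompact (cthickening r K) := hK.cthickening
  have huc := hcK.uniformContinuousOn_of_continuous (h.cont.mono hrO)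
  obtain ⟨δ, hδ, hd⟩ := Metric.uniformContinuousOn_iff.1 huc ε hε
  have hmem : ∀ x ∈ K, ∀ y, ‖y‖ < min δ r → x + y ∈ cthickening r K := by
    intro x hx y hy
    apply mem_cthickening_of_dist_le _ x _ _ hx
    simpa using (hy.trans_le (min_le_right _ _)).le
  have hDD : ∀ x ∈ K, ∀ y, ‖y‖ < min δ r → ‖D (x + y) - D x‖ ≤ ε := by
    intro x hx y hy
    rw [← dist_eq_norm]
    refine (hd _ (hmem x hx y hy) _ (self_subset_cthickening K hx) ?_).le
    simpa using hy.trans_le (min_le_left _ _)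
  refine ⟨min δ r, lt_min hδ hr, fun x hx y hy => ⟨hrO (hmem x hx y hy), hDD x hx y hy, ?_⟩⟩
  have := (convex_ball (0 : Eu N) (min δ r)).norm_image_sub_le_of_norm_hasFDerivWithin_le'
    (f := fun z => u (z + x)) (f' := fun z => innerSL ℝ (D (z + x))) (φ := innerSL ℝ (D x)) (C := ε)
    (x := 0) (y := y)
    (fun z hz => ((hgr_fd.1 (hgr_trans x (h.grad (z + x) (by
      rw [add_comm]; exact hrO (hmem x hx z (by simpa using hz)))))).hasFDerivWithinAt))
    (fun z hz => by
      rw [← map_sub, innerSL_apply_norm, add_comm]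
      exact hDD x hx z (by simpa using hz))
    (by simpa using lt_min hδ hr) (by simpa using hy)
  simpa [add_comm] using this

theorem C1S.hasFDerivAt (h : C1S O u D) {x : Eu N} (hx : x ∈ O) :
    HasFDerivAt u (innerSL ℝ (D x)) x := hgr_fd.1 (h.grad x hx)

theorem C1S.mono {O' : Set (Eu N)} (h : C1S O u D) (ho : IsOpen O') (hO : O' ⊆ O) : C1S O' u D :=
  ⟨ho, h.uc, fun x hx => h.grad x (hO hx), h.cont.mono hO⟩

theorem Tst.c1s (h : Tst O ψ P) : C1S univ ψ P :=
  ⟨isOpen_univ, h.ucont, fun x _ => h.grad x, h.cont.continuousOn⟩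

theorem Sol.mono {O' : Set (Eu N)} {g f : ℝ → ℝ} (h : Sol O g f u D) (ho : IsOpen O') (hO : O' ⊆ O) :
    Sol O' g f u D :=
  ⟨h.c1.mono ho hO, fun ψ P hψ => h.weak ψ P (hψ.mono hO)⟩

end tst

/-- uniform convergence in integrals -/
theorem tendsto_int_unif {α : Type*} [MeasurableSpace α] {μ : Measure α} {l : Filter ℝ}
    [l.IsCountablyGenerated] {k q0 : α → ℝ} {q : ℝ → α → ℝ} (hk : Integrable k μ)
    (h0 : Integrable (fun x => k x * q0 x) μ)
    (hm : ∀ᶠ τ in l, AEStronglyMeasurable (fun x => k x * q τ x) μ)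
    (h : ∀ ε > 0, ∀ᶠ τ in l, ∀ x, k x ≠ 0 → |q τ x - q0 x| ≤ ε) :
    Filter.Tendsto (fun τ => ∫ x, k x * q τ x ∂μ) l (𝓝 (∫ x, k x * q0 x ∂μ)) := by
  apply tendsto_integral_filter_of_dominated_convergence (fun x => ‖k x * q0 x‖ + ‖k x‖) hm
  · filter_upwards [h 1 one_pos] with τ hτ
    refine Filter.Eventually.of_forall fun x => ?_
    by_cases hx : k x = 0
    · simp [hx]
    · have h1 : k x * q τ x = k x * q0 x + k x * (q τ x - q0 x) := by ring
      rw [h1]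
      refine (norm_add_le _ _).trans ?_
      gcongr
      rw [norm_mul]
      have := hτ x hx
      exact mul_le_of_le_one_right (norm_nonneg _) this
  · exact h0.norm.add hk.norm
  · refine Filter.Eventually.of_forall fun x => ?_
    by_cases hx : k x = 0
    · simp [hx, tendsto_const_nhds]
    · refine Filter.Tendsto.const_mul _ ?_
      rw [Metric.tendsto_nhds]
      intro ε hε
      filter_upwards [h (ε/2) (by positivity)] with τ hτ
      rw [Real.dist_eq]
      linarith [hτ x hx]
end

open Set Metric MeasureTheory Bornology
open scoped RealInnerProductSpace Classical Topology

noncomputable section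

theorem integral_sub3 {α : Type*} [MeasurableSpace α] {μ : Measure α} {a b c : α → ℝ}
    (ha : Integrable a μ) (hb : Integrable b μ) (hc : Integrable c μ) :
    ∫ x, (a x - b x - c x) ∂μ = ∫ x, a x ∂μ - ∫ x, b x ∂μ - ∫ x, c x ∂μ := by
  have h : Integrable (fun x => a x - b x) μ := ha.sub hb
  rw [integral_sub h hc, integral_sub ha hb]

section noether
variable {N : ℕ} {O : Set (Eu N)} {g f : ℝ → ℝ} {u κ : Eu N → ℝ} {D P : Eu N → Eu N}

theorem int_grad (hg : Gd g) (h : C1S O u D) (hκ : Tst O κ P) :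
    Integrable (fun x => ⟪gvec g (D x), P x⟫) := by
  obtain ⟨K, hK, hKO, h0, h1⟩ := hκ.supp
  refine int_of_supp h.op hK hKO (fun x hx => by simp [h1 x hx]) ?_
  exact ((gvec_cont hg).comp_continuousOn h.cont).inner hκ.cont.continuousOn

theorem int_rhs (hf : Continuous f) (h : C1S O u D) (hκ : Tst O κ P) :
    Integrable (fun x => f (u x) * κ x) := by
  obtain ⟨K, hK, hKO, h0, h1⟩ := hκ.supp
  refine int_of_supp isOpen_univ hK (subset_univ _) (fun x hx => by simp [h0 x hx]) ?_
  exact ((hf.comp h.uc).mul hκ.ucont).continuousOn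

set_option maxHeartbeats 400000 in
theorem noether_le (hg : Gd g) (hf : Continuous f) (h : Sol O g f u D) (hκ : Tst O κ P)
    (hpos : ∀ x, 0 ≤ κ x) (e : Eu N) :
    ∫ x, (f (u x) * κ x) * ⟪D x, e⟫ ≤
      (∫ x, ⟪gvec g (D x), P x⟫ * ⟪D x, e⟫) + ∫ x, Gfun g ‖D x‖ * ⟪P x, -e⟫ := by
  have hO := h.c1.op
  obtain ⟨K, hK, hKO, h0, h1⟩ := hκ.supp
  obtain ⟨r, hr, hrO⟩ := hK.exists_cthickening_subset_open hO hKO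
  have hcK : IsCompact (cthickening r K) := hK.cthickening
  set K' := cthickening r K with hK'
  have hKK' : K ⊆ K' := self_subset_cthickening K
  have hDe : ContinuousOn (fun x => ⟪D x, e⟫) O := h.c1.cont.inner continuousOn_const
  have hΓ : ContinuousOn (fun x => Gfun g ‖D x‖) O :=
    (Gfun_cont hg.cont).comp_continuousOn h.c1.cont.norm
  obtain ⟨q, hq⟩ : ∃ q : ℝ → Eu N → ℝ, q = fun τ x => (u (x + τ • e) - u x) / τ := ⟨_, rfl⟩
  obtain ⟨s, hs⟩ : ∃ s : ℝ → Eu N → ℝ, s = fun τ x => (κ (x + τ • (-e)) - κ x) / τ := ⟨_, rfl⟩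
  have hqc : ∀ τ, Continuous (q τ) := by
    intro τ; have := h.c1.uc; simp only [hq]; fun_prop
  have hsc : ∀ τ, Continuous (s τ) := by
    intro τ; have := hκ.ucont; simp only [hs]; fun_prop
  have hsmall : ∀ δ > 0, ∀ᶠ τ : ℝ in 𝓝[>] 0, 0 < τ ∧ ‖τ • e‖ < δ := by
    intro δ hδ
    have h1 : Filter.Tendsto (fun τ : ℝ => ‖τ • e‖) (𝓝[>] 0) (𝓝 0) := by
      have : Continuous (fun τ : ℝ => ‖τ • e‖) := by fun_prop
      have := this.tendsto 0
      simp only [zero_smul, norm_zero] at this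
      exact this.mono_left nhdsWithin_le_nhds
    filter_upwards [h1.eventually_lt_const hδ, self_mem_nhdsWithin] with τ h2 h3 using ⟨h3, h2⟩
  -- uniform convergence
  have hqu : ∀ ε > 0, ∀ᶠ τ in 𝓝[>] (0:ℝ), ∀ x ∈ K, |q τ x - ⟪D x, e⟫| ≤ ε := by
    intro ε hε
    obtain ⟨δ, hδ, hd⟩ := unif_diff h.c1 hK hKO (ε := ε / (‖e‖ + 1)) (by positivity)
    filter_upwards [hsmall δ hδ] with τ hτ x hx
    have h3 := (hd x hx _ hτ.2).2.2
    have h4 : q τ x - ⟪D x, e⟫ = (u (x + τ • e) - u x - ⟪D x, τ • e⟫) / τ := by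
      simp only [hq, real_inner_smul_right]
      have := hτ.1.ne'
      field_simp
    rw [h4, abs_div, abs_of_pos hτ.1, div_le_iff₀ hτ.1]
    refine h3.trans ?_
    rw [norm_smul, Real.norm_of_nonneg hτ.1.le]
    have h5 : ε / (‖e‖ + 1) * ‖e‖ ≤ ε := by
      rw [div_mul_eq_mul_div, div_le_iff₀ (by positivity)]
      nlinarith [norm_nonneg e]
    nlinarith [hτ.1]
  have hsu : ∀ ε > 0, ∀ᶠ τ in 𝓝[>] (0:ℝ), ∀ x ∈ K', |s τ x - ⟪P x, -e⟫| ≤ ε := by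
    intro ε hε
    obtain ⟨δ, hδ, hd⟩ := unif_diff hκ.c1s hcK (subset_univ _) (ε := ε / (‖e‖ + 1)) (by positivity)
    filter_upwards [hsmall δ hδ] with τ hτ x hx
    have h3 := (hd x hx (τ • (-e)) (by simpa using hτ.2)).2.2
    have h4 : s τ x - ⟪P x, -e⟫ = (κ (x + τ • (-e)) - κ x - ⟪P x, τ • (-e)⟫) / τ := by
      simp only [hs, real_inner_smul_right]
      have := hτ.1.ne'
      field_simp
    rw [h4, abs_div, abs_of_pos hτ.1, div_le_iff₀ hτ.1]
    refine h3.trans ?_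
    rw [norm_smul, Real.norm_of_nonneg hτ.1.le, norm_neg]
    have h5 : ε / (‖e‖ + 1) * ‖e‖ ≤ ε := by
      rw [div_mul_eq_mul_div, div_le_iff₀ (by positivity)]
      nlinarith [norm_nonneg e]
    nlinarith [hτ.1]
  have i1 := int_rhs hf h.c1 hκ
  have i2 := int_grad hg h.c1 hκ
  have i3 : Integrable (K'.indicator fun x => Gfun g ‖D x‖) :=
    (integrable_indicator_iff hcK.measurableSet).2 ((hΓ.mono hrO).integrableOn_compact hcK)
  have T1 : Filter.Tendsto (fun τ => ∫ x, (f (u x) * κ x) * q τ x) (𝓝[>] 0)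
      (𝓝 (∫ x, (f (u x) * κ x) * ⟪D x, e⟫)) := by
    apply tendsto_int_unif i1
    · refine int_of_supp hO hK hKO (fun x hx => by simp [h0 x hx]) ?_
      exact ((hf.comp h.c1.uc).mul hκ.ucont).continuousOn.mul hDe
    · exact Filter.Eventually.of_forall fun τ => i1.1.mul (hqc τ).aestronglyMeasurable
    · intro ε hε
      filter_upwards [hqu ε hε] with τ hτ x hx
      exact hτ x (by by_contra h'; simp [h0 x h'] at hx)
  have T2 : Filter.Tendsto (fun τ => ∫ x, ⟪gvec g (D x), P x⟫ * q τ x) (𝓝[>] 0)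
      (𝓝 (∫ x, ⟪gvec g (D x), P x⟫ * ⟪D x, e⟫)) := by
    apply tendsto_int_unif i2
    · refine int_of_supp hO hK hKO (fun x hx => by simp [h1 x hx]) ?_
      exact (((gvec_cont hg).comp_continuousOn h.c1.cont).inner hκ.cont.continuousOn).mul hDe
    · exact Filter.Eventually.of_forall fun τ => i2.1.mul (hqc τ).aestronglyMeasurable
    · intro ε hε
      filter_upwards [hqu ε hε] with τ hτ x hx
      exact hτ x (by by_contra h'; simp [h1 x h'] at hx)
  have T3 : Filter.Tendsto (fun τ => ∫ x, (K'.indicator fun x => Gfun g ‖D x‖) x * s τ x) (𝓝[>] 0)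
      (𝓝 (∫ x, (K'.indicator fun x => Gfun g ‖D x‖) x * ⟪P x, -e⟫)) := by
    apply tendsto_int_unif i3
    · have : (fun x => (K'.indicator fun x => Gfun g ‖D x‖) x * ⟪P x, -e⟫) =
          fun x => Gfun g ‖D x‖ * ⟪P x, -e⟫ := by
        ext x; by_cases hx : x ∈ K'
        · simp [hx]
        · simp [hx, h1 x (fun h' => hx (hKK' h'))]
      rw [this]
      refine int_of_supp hO hK hKO (fun x hx => by simp [h1 x hx]) ?_
      exact hΓ.mul (hκ.cont.inner continuous_const).continuousOn
    · exact Filter.Eventually.of_forall fun τ => i3.1.mul (hsc τ).aestronglyMeasurable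
    · intro ε hε
      filter_upwards [hsu ε hε] with τ hτ x hx
      exact hτ x (by by_contra h'; simp [h'] at hx)
  have e3 : ∫ x, (K'.indicator fun x => Gfun g ‖D x‖) x * ⟪P x, -e⟫ =
      ∫ x, Gfun g ‖D x‖ * ⟪P x, -e⟫ := by
    congr 1; ext x; by_cases hx : x ∈ K'
    · simp [hx]
    · simp [hx, h1 x (fun h' => hx (hKK' h'))]
  rw [← e3]
  refine le_of_tendsto_of_tendsto T1 (T2.add T3) ?_
  filter_upwards [hsmall r hr] with τ hτ
  obtain ⟨hτ0, hτr⟩ := hτ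
  -- test function
  have hmemK : ∀ x ∈ K, x + τ • e ∈ K' := by
    intro x hx
    apply mem_cthickening_of_dist_le _ x _ _ hx
    simpa using hτr.le
  set O' := O ∩ {x | x + τ • e ∈ O} with hO'
  have hcadd : Continuous (fun x : Eu N => x + τ • e) := by fun_prop
  have hO'o : IsOpen O' := hO.inter (hO.preimage hcadd)
  have hKO' : K ⊆ O' := fun x hx => ⟨hKO hx, hrO (hmemK x hx)⟩
  have hP1 : ∀ x ∈ O', HasGradientAt (fun x => κ x * (τ⁻¹ * (u (x + τ • e) - u x)))
      (κ x • (τ⁻¹ • (D (x + τ • e) - D x)) + (τ⁻¹ * (u (x + τ • e) - u x)) • P x) x := by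
    intro x hx
    have b1 := hgr_trans (τ • e) (h.c1.grad _ hx.2)
    have b2 := hgr_cmul τ⁻¹ (hgr_sub b1 (h.c1.grad x hx.1))
    exact hgr_mul (hκ.grad x) b2
  have hP2 : ContinuousOn (fun x => κ x • (τ⁻¹ • (D (x + τ • e) - D x)) +
      (τ⁻¹ * (u (x + τ • e) - u x)) • P x) O' := by
    have a1 : ContinuousOn (fun x => D (x + τ • e)) O' :=
      h.c1.cont.comp hcadd.continuousOn (fun x hx => hx.2)
    have a2 : ContinuousOn D O' := h.c1.cont.mono inter_subset_left
    have a3 := hκ.ucont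
    have a4 := hκ.cont
    have a5 : Continuous (fun x => τ⁻¹ * (u (x + τ • e) - u x)) :=
      continuous_const.mul ((h.c1.uc.comp hcadd).sub h.c1.uc)
    have a6 : ContinuousOn (fun x => τ⁻¹ • (D (x + τ • e) - D x)) O' :=
      (a1.sub a2).const_smul τ⁻¹
    have a7 : ContinuousOn (fun x => κ x • (τ⁻¹ • (D (x + τ • e) - D x))) O' :=
      a3.continuousOn.smul a6
    have a8 : ContinuousOn (fun x => (τ⁻¹ * (u (x + τ • e) - u x)) • P x) O' :=
      (a5.smul a4).continuousOn
    exact a7.add a8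
  have ht := tst_mk hO'o hK hKO' (fun x hx => by simp [h0 x hx]) hP1 hP2
  have hw := h.weak _ _ (ht.mono inter_subset_left)
  have er : ∫ x, f (u x) * (κ x * (τ⁻¹ * (u (x + τ • e) - u x))) = ∫ x, (f (u x) * κ x) * q τ x := by
    congr 1; ext x; simp only [hq]; ring
  rw [er] at hw
  rw [← hw]
  have ei : Integrable (fun x => κ x * Gfun g ‖D x‖) :=
    int_of_supp hO hK hKO (fun x hx => by simp [h0 x hx]) (hκ.ucont.continuousOn.mul hΓ)
  have ei2 : Integrable (fun x => κ x * Gfun g ‖D (x + τ • e)‖) :=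
    int_of_supp hO'o hK hKO' (fun x hx => by simp [h0 x hx]) (hκ.ucont.continuousOn.mul
      (hΓ.comp hcadd.continuousOn (fun x hx => hx.2)))
  have et : ∫ x, κ x * Gfun g ‖D (x + τ • e)‖ = ∫ x, κ (x + τ • (-e)) * Gfun g ‖D x‖ := by
    rw [← integral_add_right_eq_self (fun x => κ (x + τ • (-e)) * Gfun g ‖D x‖) (τ • e)]
    congr 1; ext x; simp
  have ei3 : Integrable (fun x => κ (x + τ • (-e)) * Gfun g ‖D x‖) := by
    have := ei2.comp_add_right (τ • (-e))
    simpa using this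
  have i4 : ∫ x, (K'.indicator fun x => Gfun g ‖D x‖) x * s τ x =
      ∫ x, τ⁻¹ * (κ x * Gfun g ‖D (x + τ • e)‖ - κ x * Gfun g ‖D x‖) := by
    rw [integral_const_mul, integral_sub ei2 ei, et, ← integral_sub ei3 ei, ← integral_const_mul]
    congr 1; ext x
    simp only [hs]
    by_cases hx : x ∈ K'
    · simp [hx]; ring
    · have z1 : κ x = 0 := h0 x (fun h' => hx (hKK' h'))
      have z2 : κ (x + τ • (-e)) = 0 := h0 _ (fun h' => hx (by simpa using hmemK _ h'))
      rw [z1, z2]; simp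
  rw [i4]
  have ia : Integrable (fun x => ⟪gvec g (D x), P x⟫ * q τ x) :=
    int_of_supp hO hK hKO (fun x hx => by simp [h1 x hx])
      ((((gvec_cont hg).comp_continuousOn h.c1.cont).inner hκ.cont.continuousOn).mul
        (hqc τ).continuousOn)
  have ib : Integrable (fun x => τ⁻¹ * (κ x * Gfun g ‖D (x + τ • e)‖ - κ x * Gfun g ‖D x‖)) :=
    (ei2.sub ei).const_mul _
  rw [← integral_add ia ib]
  apply integral_mono (int_grad hg (h.c1.mono hO'o inter_subset_left) ht) (ia.add ib)
  intro x
  by_cases hx : x ∈ K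
  · have hxO : x ∈ O' := hKO' hx
    simp only [hxO, if_true, Pi.add_apply]
    rw [inner_add_right, real_inner_smul_right, real_inner_smul_right, real_inner_smul_right]
    have hc := gvec_convex hg (D x) (D (x + τ • e))
    have hp := mul_le_mul_of_nonneg_left hc (mul_nonneg (hpos x) (inv_nonneg.2 hτ0.le))
    simp only [hq]
    have e1 : (u (x + τ • e) - u x) / τ = τ⁻¹ * (u (x + τ • e) - u x) := by ring
    rw [e1]
    nlinarith
  · have z1 := h0 x hx
    have z2 := h1 x hx
    simp [z1, z2]

theorem noether (hg : Gd g) (hf : Continuous f) (h : Sol O g f u D) (hκ : Tst O κ P)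
    (hpos : ∀ x, 0 ≤ κ x) (e : Eu N) :
    ∫ x, (⟪gvec g (D x), P x⟫ * ⟪D x, e⟫ - Gfun g ‖D x‖ * ⟪P x, e⟫ -
      (f (u x) * κ x) * ⟪D x, e⟫) = 0 := by
  have hO := h.c1.op
  obtain ⟨K, hK, hKO, h0, h1⟩ := hκ.supp
  have hDe : ContinuousOn (fun x => ⟪D x, e⟫) O := h.c1.cont.inner continuousOn_const
  have hΓ : ContinuousOn (fun x => Gfun g ‖D x‖) O :=
    (Gfun_cont hg.cont).comp_continuousOn h.c1.cont.norm
  have i1 : Integrable (fun x => (f (u x) * κ x) * ⟪D x, e⟫) :=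
    int_of_supp hO hK hKO (fun x hx => by simp [h0 x hx])
      (((hf.comp h.c1.uc).mul hκ.ucont).continuousOn.mul hDe)
  have i2 : Integrable (fun x => ⟪gvec g (D x), P x⟫ * ⟪D x, e⟫) :=
    int_of_supp hO hK hKO (fun x hx => by simp [h1 x hx])
      ((((gvec_cont hg).comp_continuousOn h.c1.cont).inner hκ.cont.continuousOn).mul hDe)
  have i3 : Integrable (fun x => Gfun g ‖D x‖ * ⟪P x, e⟫) :=
    int_of_supp hO hK hKO (fun x hx => by simp [h1 x hx])
      (hΓ.mul (hκ.cont.inner continuous_const).continuousOn)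
  have a := noether_le hg hf h hκ hpos e
  have b := noether_le hg hf h hκ hpos (-e)
  simp only [inner_neg_right, mul_neg, integral_neg, neg_neg] at a b
  rw [integral_sub3 i2 i3 i1]
  linarith
end noether
end

open Set Metric MeasureTheory Bornology
open scoped RealInnerProductSpace Classical Topology

noncomputable section

section logest
variable {N : ℕ}

theorem grad_of_contDiff {ψ : Eu N → ℝ} (h : ContDiff ℝ 1 ψ) :
    (∀ x, HasGradientAt ψ (gradient ψ x) x) ∧ Continuous (gradient ψ) := by
  refine ⟨fun x => (h.differentiable one_ne_zero x).hasGradientAt, ?_⟩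
  unfold gradient
  exact (LinearIsometryEquiv.continuous _).comp (h.continuous_fderiv one_ne_zero)

/-- a smooth cutoff with explicit gradient -/
theorem exists_cutoff (z0 : Eu N) {r : ℝ} (hr : 0 < r) :
    ∃ (ζ : Eu N → ℝ) (Z : Eu N → Eu N), Tst (ball z0 r) ζ Z ∧ (∀ x, 0 ≤ ζ x) ∧
      ∀ x ∈ ball z0 (r / 2), ζ x = 1 := by
  let b : ContDiffBump z0 := ⟨r / 2, 3 * r / 4, by positivity, by linarith⟩
  have hb : ContDiff ℝ 1 (b : Eu N → ℝ) := b.contDiff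
  obtain ⟨h1, h2⟩ := grad_of_contDiff hb
  have h0 : ∀ x ∉ closedBall z0 (3 * r / 4), b x = 0 := by
    intro x hx
    apply b.zero_of_le_dist
    simp only [mem_closedBall, not_le] at hx
    exact hx.le
  refine ⟨b, gradient b, ⟨h1, h2, closedBall z0 (3 * r / 4), isCompact_closedBall _ _,
    closedBall_subset_ball (by linarith), h0, grad_zero_off isClosed_closedBall h1 h0⟩,
    fun x => b.nonneg, fun x hx => b.one_of_mem_closedBall (ball_subset_closedBall hx)⟩

theorem energy_est {z0 : Eu N} {r A : ℝ} (hr : 0 < r) (hA : 0 < A) {σ : Eu N → ℝ} {S B : Eu N → Eu N}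
    (hσ : ∀ z ∈ ball z0 r, HasGradientAt σ (S z) z) (hS : ContinuousOn S (ball z0 r))
    (hB : ContinuousOn B (ball z0 r)) (h0 : ∀ z ∈ ball z0 r, 0 ≤ σ z)
    (h1 : ∀ z ∈ ball z0 r, ‖B z‖ ^ 2 ≤ A * ⟪B z, S z⟫)
    (h2 : ∀ z ∈ ball z0 r, ‖S z‖ ^ 2 ≤ A * ⟪B z, S z⟫)
    (hw : ∀ κ X, Tst (ball z0 r) κ X → (∀ x, 0 ≤ κ x) → ∫ x, ⟪B x, X x⟫ = 0) :
    ∃ C, ∀ ε > 0, IntegrableOn (fun z => ‖S z‖ ^ 2 / (σ z + ε) ^ 2) (ball z0 (r / 2)) ∧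
      ∫ z in ball z0 (r / 2), ‖S z‖ ^ 2 / (σ z + ε) ^ 2 ≤ C := by
  obtain ⟨ζ, Z, hζ, hζ0, hζ1⟩ := exists_cutoff z0 hr
  obtain ⟨K, hK, hKO, hz0, hz1⟩ := hζ.supp
  have hO : IsOpen (ball z0 r) := isOpen_ball
  have hσc : ContinuousOn σ (ball z0 r) := fun z hz =>
    (hgr_fd.1 (hσ z hz)).continuousAt.continuousWithinAt
  refine ⟨A * (4 * A * ∫ x, ‖Z x‖ ^ 2), fun ε hε => ?_⟩
  have hpos : ∀ z ∈ ball z0 r, 0 < σ z + ε := fun z hz => by linarith [h0 z hz]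
  have hσe : ContinuousOn (fun z => σ z + ε) (ball z0 r) := hσc.add continuousOn_const
  have hinv : ContinuousOn (fun z => (σ z + ε)⁻¹) (ball z0 r) :=
    hσe.inv₀ fun z hz => (hpos z hz).ne'
  have hinv2 : ContinuousOn (fun z => ((σ z + ε) ^ 2)⁻¹) (ball z0 r) :=
    (hσe.pow 2).inv₀ fun z hz => (pow_pos (hpos z hz) 2).ne'
  have hζc := hζ.ucont.continuousOn (s := ball z0 r)
  have hZc := hζ.cont.continuousOn (s := ball z0 r)
  have hBS : ContinuousOn (fun z => ⟪B z, S z⟫) (ball z0 r) := hB.inner hS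
  have hBZ : ContinuousOn (fun z => ⟪B z, Z z⟫) (ball z0 r) := hB.inner hZc
  -- the test function
  have hP1 : ∀ z ∈ ball z0 r, HasGradientAt (fun z => (ζ z * ζ z) * (σ z + ε)⁻¹)
      ((ζ z * ζ z) • ((-((σ z + ε) ^ 2)⁻¹) • S z) + (σ z + ε)⁻¹ • (ζ z • Z z + ζ z • Z z)) z := by
    intro z hz
    have d1 := hgr_mul (hζ.grad z) (hζ.grad z)
    have d2 : HasDerivAt (fun t : ℝ => (t + ε)⁻¹) (-((σ z + ε) ^ 2)⁻¹) (σ z) := by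
      have h3 : HasDerivAt (fun t : ℝ => t + ε) 1 (σ z) := (hasDerivAt_id (σ z)).add_const ε
      have := h3.fun_inv (hpos z hz).ne'
      have e : -(1:ℝ) / (σ z + ε) ^ 2 = -((σ z + ε) ^ 2)⁻¹ := by rw [neg_div, one_div]
      rw [e] at this
      exact this
    have d3 := hgr_comp (φ := fun t => (t + ε)⁻¹) d2 (hσ z hz)
    exact hgr_mul d1 d3
  have hP2 : ContinuousOn (fun z => (ζ z * ζ z) • ((-((σ z + ε) ^ 2)⁻¹) • S z) +
      (σ z + ε)⁻¹ • (ζ z • Z z + ζ z • Z z)) (ball z0 r) := by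
    have c1 : ContinuousOn (fun z => (-((σ z + ε) ^ 2)⁻¹) • S z) (ball z0 r) := hinv2.neg.smul hS
    have c2 : ContinuousOn (fun z => (ζ z * ζ z)) (ball z0 r) := hζc.mul hζc
    have c3 : ContinuousOn (fun z => ζ z • Z z) (ball z0 r) := hζc.smul hZc
    have c4 : ContinuousOn (fun z => ζ z • Z z + ζ z • Z z) (ball z0 r) := c3.add c3
    have c5 : ContinuousOn (fun z => (σ z + ε)⁻¹ • (ζ z • Z z + ζ z • Z z)) (ball z0 r) :=
      hinv.smul c4
    have c6 : ContinuousOn (fun z => (ζ z * ζ z) • ((-((σ z + ε) ^ 2)⁻¹) • S z)) (ball z0 r) :=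
      c2.smul c1
    exact c6.add c5
  have ht := tst_mk hO hK hKO (fun z hz => by simp [hz0 z hz]) hP1 hP2
  have heqI := hw _ _ ht (fun z => by
    by_cases hz : z ∈ ball z0 r
    · exact mul_nonneg (mul_self_nonneg _) (inv_nonneg.2 (hpos z hz).le)
    · rw [hz0 z (fun h => hz (hKO h))]; simp)
  -- integrability
  have iE : Integrable (fun z => ζ z ^ 2 * ⟪B z, S z⟫ * ((σ z + ε) ^ 2)⁻¹) :=
    int_of_supp hO hK hKO (fun z hz => by simp [hz0 z hz]) (((hζc.pow 2).mul hBS).mul hinv2)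
  have iM : Integrable (fun z => 2 * ζ z * ⟪B z, Z z⟫ * (σ z + ε)⁻¹) :=
    int_of_supp hO hK hKO (fun z hz => by simp [hz0 z hz])
      (((continuousOn_const.mul hζc).mul hBZ).mul hinv)
  have iZ : Integrable (fun z => ‖Z z‖ ^ 2) :=
    int_of_supp hO hK hKO (fun z hz => by simp [hz1 z hz]) (hZc.norm.pow 2)
  have iS : Integrable (fun z => ζ z ^ 2 * ‖S z‖ ^ 2 * ((σ z + ε) ^ 2)⁻¹) :=
    int_of_supp hO hK hKO (fun z hz => by simp [hz0 z hz]) (((hζc.pow 2).mul (hS.norm.pow 2)).mul hinv2)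
  have hsplit : ∫ z, ζ z ^ 2 * ⟪B z, S z⟫ * ((σ z + ε) ^ 2)⁻¹ =
      ∫ z, 2 * ζ z * ⟪B z, Z z⟫ * (σ z + ε)⁻¹ := by
    have : ∫ z, (2 * ζ z * ⟪B z, Z z⟫ * (σ z + ε)⁻¹ -
        ζ z ^ 2 * ⟪B z, S z⟫ * ((σ z + ε) ^ 2)⁻¹) = 0 := by
      rw [← heqI]
      congr 1; ext z
      by_cases hz : z ∈ K
      · simp only [hKO hz, if_true]
        simp only [inner_add_right, real_inner_smul_right]
        ring
      · simp [hz0 z hz]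
    rw [integral_sub iM iE] at this
    linarith
  have hle : ∫ z, 2 * ζ z * ⟪B z, Z z⟫ * (σ z + ε)⁻¹ ≤
      ∫ z, (2⁻¹ * (ζ z ^ 2 * ⟪B z, S z⟫ * ((σ z + ε) ^ 2)⁻¹) + 2 * A * ‖Z z‖ ^ 2) := by
    apply integral_mono iM ((iE.const_mul _).add (iZ.const_mul _))
    intro z
    by_cases hz : z ∈ K
    · have hzO := hKO hz
      have k1 := real_inner_le_norm (B z) (Z z)
      have k2 := h1 z hzO
      set w := (σ z + ε)⁻¹ with hwdef
      have hwp : 0 < w := inv_pos.2 (hpos z hzO)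
      have hw2 : ((σ z + ε) ^ 2)⁻¹ = w ^ 2 := by rw [hwdef, inv_pow]
      show 2 * ζ z * ⟪B z, Z z⟫ * w ≤
        2⁻¹ * (ζ z ^ 2 * ⟪B z, S z⟫ * ((σ z + ε) ^ 2)⁻¹) + 2 * A * ‖Z z‖ ^ 2
      rw [hw2]
      have k3 : 2 * ζ z * ⟪B z, Z z⟫ * w ≤ 2 * (ζ z * w * ‖B z‖) * ‖Z z‖ := by
        have := mul_le_mul_of_nonneg_left k1 (mul_nonneg (mul_nonneg zero_le_two (hζ0 z)) hwp.le)
        linarith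
      have k4 : 2 * (ζ z * w * ‖B z‖) * ‖Z z‖ ≤
          (2 * A)⁻¹ * (ζ z * w * ‖B z‖) ^ 2 + 2 * A * ‖Z z‖ ^ 2 := by
        have := sq_nonneg ((ζ z * w * ‖B z‖) - 2 * A * ‖Z z‖)
        have h2A : 0 < (2 * A)⁻¹ := by positivity
        have e1 : (2 * A)⁻¹ * ((ζ z * w * ‖B z‖) - 2 * A * ‖Z z‖) ^ 2 =
          (2 * A)⁻¹ * (ζ z * w * ‖B z‖) ^ 2 - 2 * (ζ z * w * ‖B z‖) * ‖Z z‖ + 2 * A * ‖Z z‖ ^ 2 := by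
          field_simp; ring
        have := mul_nonneg h2A.le this
        linarith
      have k5 : (2 * A)⁻¹ * (ζ z * w * ‖B z‖) ^ 2 ≤ 2⁻¹ * (ζ z ^ 2 * ⟪B z, S z⟫ * w ^ 2) := by
        have e1 : (2 * A)⁻¹ * (ζ z * w * ‖B z‖) ^ 2 = ((2 * A)⁻¹ * (ζ z * w) ^ 2) * ‖B z‖ ^ 2 := by ring
        have e2 : 2⁻¹ * (ζ z ^ 2 * ⟪B z, S z⟫ * w ^ 2) =
            ((2 * A)⁻¹ * (ζ z * w) ^ 2) * (A * ⟪B z, S z⟫) := by field_simp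
        rw [e1, e2]
        exact mul_le_mul_of_nonneg_left k2 (by positivity)
      linarith
    · show 2 * ζ z * ⟪B z, Z z⟫ * (σ z + ε)⁻¹ ≤
        2⁻¹ * (ζ z ^ 2 * ⟪B z, S z⟫ * ((σ z + ε) ^ 2)⁻¹) + 2 * A * ‖Z z‖ ^ 2
      rw [hz0 z hz, hz1 z hz]; simp
  rw [integral_add (iE.const_mul _) (iZ.const_mul _), integral_const_mul, integral_const_mul,
    ← hsplit] at hle
  have hE : ∫ z, ζ z ^ 2 * ⟪B z, S z⟫ * ((σ z + ε) ^ 2)⁻¹ ≤ 4 * A * ∫ x, ‖Z x‖ ^ 2 := by linarith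
  have hSE : ∫ z, ζ z ^ 2 * ‖S z‖ ^ 2 * ((σ z + ε) ^ 2)⁻¹ ≤
      ∫ z, A * (ζ z ^ 2 * ⟪B z, S z⟫ * ((σ z + ε) ^ 2)⁻¹) := by
    apply integral_mono iS (iE.const_mul _)
    intro z
    by_cases hz : z ∈ K
    · have := mul_le_mul_of_nonneg_left (h2 z (hKO hz))
        (mul_nonneg (sq_nonneg (ζ z)) (inv_nonneg.2 (sq_nonneg (σ z + ε))))
      simp only; linarith
    · simp [hz0 z hz]
  rw [integral_const_mul] at hSE
  have hcongr : EqOn (fun z => ζ z ^ 2 * ‖S z‖ ^ 2 * ((σ z + ε) ^ 2)⁻¹)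
      (fun z => ‖S z‖ ^ 2 / (σ z + ε) ^ 2) (ball z0 (r / 2)) := by
    intro z hz
    simp only [hζ1 z hz]
    ring
  refine ⟨iS.integrableOn.congr_fun hcongr measurableSet_ball, ?_⟩
  rw [← setIntegral_congr_fun measurableSet_ball hcongr]
  calc _ ≤ ∫ z, ζ z ^ 2 * ‖S z‖ ^ 2 * ((σ z + ε) ^ 2)⁻¹ :=
        setIntegral_le_integral iS (Filter.Eventually.of_forall fun z => by
          simp only [Pi.zero_apply]; positivity)
    _ ≤ _ := hSE
    _ ≤ _ := mul_le_mul_of_nonneg_left hE hA.le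

end logest
end

open Set Metric MeasureTheory Bornology
open scoped RealInnerProductSpace Classical Topology

noncomputable section

section loguc
variable {N : ℕ}

theorem log_seg {z0 : Eu N} {r ε : ℝ} (hε : 0 < ε) {σ : Eu N → ℝ} {S : Eu N → Eu N}
    (hσ : ∀ z ∈ ball z0 r, HasGradientAt σ (S z) z) (hS : ContinuousOn S (ball z0 r))
    (h0 : ∀ z ∈ ball z0 r, 0 ≤ σ z) {z h : Eu N} (hz : z ∈ ball z0 r) (hzh : z + h ∈ ball z0 r) :
    ENNReal.ofReal (Real.log (σ (z + h) + ε) - Real.log (σ z + ε)) ≤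
      ∫⁻ t in Ioc (0:ℝ) 1, ENNReal.ofReal
        (‖h‖ * (1 + ‖S (z + t • h)‖ ^ 2 / (σ (z + t • h) + ε) ^ 2)) := by
  have hseg : ∀ t ∈ Icc (0:ℝ) 1, z + t • h ∈ ball z0 r := by
    intro t ht
    have := (convex_ball z0 r).add_smul_mem hz hzh ht
    exact this
  have hpath : Continuous (fun t : ℝ => z + t • h) := by fun_prop
  have hσc : ContinuousOn σ (ball z0 r) := fun z hz =>
    (hgr_fd.1 (hσ z hz)).continuousAt.continuousWithinAt
  have hpos : ∀ t ∈ Icc (0:ℝ) 1, 0 < σ (z + t • h) + ε := fun t ht => by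
    linarith [h0 _ (hseg t ht)]
  have cσ : ContinuousOn (fun t : ℝ => σ (z + t • h) + ε) (Icc 0 1) :=
    (hσc.comp hpath.continuousOn hseg).add continuousOn_const
  have cS : ContinuousOn (fun t : ℝ => S (z + t • h)) (Icc 0 1) :=
    hS.comp hpath.continuousOn hseg
  have hd : ∀ t ∈ Icc (0:ℝ) 1, HasDerivAt (fun t : ℝ => Real.log (σ (z + t • h) + ε))
      (⟪S (z + t • h), h⟫ / (σ (z + t • h) + ε)) t := by
    intro t ht
    have h2 : HasDerivAt (fun t : ℝ => σ (z + t • h)) ⟪S (z + t • h), h⟫ t :=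
      hgr_line h t (hσ _ (hseg t ht))
    exact (h2.add_const ε).log (hpos t ht).ne'
  have cd : ContinuousOn (fun t : ℝ => ⟪S (z + t • h), h⟫ / (σ (z + t • h) + ε)) (Icc 0 1) :=
    (cS.inner continuousOn_const).div cσ fun t ht => (hpos t ht).ne'
  have heqI : ∫ t in (0:ℝ)..1, ⟪S (z + t • h), h⟫ / (σ (z + t • h) + ε) =
      Real.log (σ (z + h) + ε) - Real.log (σ z + ε) := by
    rw [intervalIntegral.integral_eq_sub_of_hasDerivAt
      (f := fun t : ℝ => Real.log (σ (z + t • h) + ε))]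
    · simp
    · intro t ht; rw [uIcc_of_le zero_le_one] at ht; exact hd t ht
    · apply ContinuousOn.intervalIntegrable
      rwa [uIcc_of_le zero_le_one]
  have cQ : ContinuousOn (fun t : ℝ => ‖h‖ * (1 + ‖S (z + t • h)‖ ^ 2 / (σ (z + t • h) + ε) ^ 2))
      (Icc 0 1) :=
    continuousOn_const.mul (continuousOn_const.add ((cS.norm.pow 2).div (cσ.pow 2)
      fun t ht => (pow_pos (hpos t ht) 2).ne'))
  have iQ : IntegrableOn (fun t : ℝ => ‖h‖ * (1 + ‖S (z + t • h)‖ ^ 2 / (σ (z + t • h) + ε) ^ 2))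
      (Ioc 0 1) := (cQ.integrableOn_Icc).mono_set Ioc_subset_Icc_self
  have iD : IntegrableOn (fun t : ℝ => ⟪S (z + t • h), h⟫ / (σ (z + t • h) + ε))
      (Ioc 0 1) := (cd.integrableOn_Icc).mono_set Ioc_subset_Icc_self
  rw [← ofReal_integral_eq_lintegral_ofReal iQ]
  · apply ENNReal.ofReal_le_ofReal
    rw [← heqI, intervalIntegral.integral_of_le zero_le_one]
    apply setIntegral_mono_on iD iQ measurableSet_Ioc
    intro t ht
    have hp := hpos t (Ioc_subset_Icc_self ht)
    have k1 := real_inner_le_norm (S (z + t • h)) h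
    set a := ‖S (z + t • h)‖
    set s := σ (z + t • h) + ε
    have k2 : a / s ≤ 1 + a ^ 2 / s ^ 2 := by
      rw [← div_pow]; nlinarith [sq_nonneg (a / s - 1)]
    calc _ ≤ (a * ‖h‖) / s := by gcongr
      _ = ‖h‖ * (a / s) := by ring
      _ ≤ _ := by gcongr
  · refine Filter.Eventually.of_forall fun t => ?_
    simp only [Pi.zero_apply]; positivity

theorem log_uc {z0 : Eu N} {r : ℝ} {σ : Eu N → ℝ} {S : Eu N → Eu N}
    (hσ : ∀ z ∈ ball z0 r, HasGradientAt σ (S z) z) (hS : ContinuousOn S (ball z0 r))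
    (h0 : ∀ z ∈ ball z0 r, 0 ≤ σ z) {C : ℝ}
    (hE : ∀ ε > 0, IntegrableOn (fun z => ‖S z‖ ^ 2 / (σ z + ε) ^ 2) (ball z0 r) ∧
      ∫ z in ball z0 r, ‖S z‖ ^ 2 / (σ z + ε) ^ 2 ≤ C) {z1 : Eu N} {ρ : ℝ} (hρ : 0 < ρ)
    (hb : ball z1 ρ ⊆ ball z0 r) (hz : ∀ z ∈ ball z1 ρ, σ z = 0) :
    ∀ z ∈ ball z0 r, σ z = 0 := by
  by_contra! hcon
  obtain ⟨z2, hz2, hne⟩ := hcon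
  have hp2 : 0 < σ z2 := lt_of_le_of_ne (h0 z2 hz2) hne.symm
  have hσc : ContinuousOn σ (ball z0 r) := fun z hz =>
    (hgr_fd.1 (hσ z hz)).continuousAt.continuousWithinAt
  have hO : IsOpen (ball z0 r) := isOpen_ball
  -- a small ball around z2
  have hnb : {z | z ∈ ball z0 r ∧ σ z2 / 2 < σ z} ∈ 𝓝 z2 := by
    have := (hσc.continuousAt (hO.mem_nhds hz2)).eventually (lt_mem_nhds (half_lt_self hp2))
    filter_upwards [this, hO.mem_nhds hz2] with z h1 h2 using ⟨h2, h1⟩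
  obtain ⟨ρ2, hρ2, hsub⟩ := Metric.mem_nhds_iff.1 hnb
  set s0 := σ z2 / 2 with hs0
  have hs0p : 0 < s0 := half_pos hp2
  set q := min ρ ρ2 with hq
  have hqp : 0 < q := lt_min hρ hρ2
  set h := z2 - z1 with hh
  have hshift : ∀ z ∈ ball z1 q, z + h ∈ ball z2 ρ2 := by
    intro z hz
    rw [mem_ball, dist_eq_norm] at hz ⊢
    have : z + h - z2 = z - z1 := by rw [hh]; abel
    rw [this]; exact lt_of_lt_of_le hz (min_le_right _ _)
  set V := volume (ball z1 q) with hV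
  have hVp : V ≠ 0 := (measure_ball_pos volume z1 hqp).ne'
  have hVt : V ≠ ⊤ := measure_ball_lt_top.ne
  set M := volume.real (ball z0 r) with hM
  have key : ∀ ε > 0, ENNReal.ofReal (Real.log (s0 + ε) - Real.log ε) * V ≤
      ENNReal.ofReal (‖h‖ * (M + C)) := by
    intro ε hε
    obtain ⟨iQ, hQ⟩ := hE ε hε
    let Q : Eu N → ℝ := fun y => ‖h‖ * (1 + ‖S y‖ ^ 2 / (σ y + ε) ^ 2)
    let k : Eu N → ENNReal := (ball z0 r).piecewise (fun y => ENNReal.ofReal (Q y)) (fun _ => 0)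
    have cQ : ContinuousOn Q (ball z0 r) := by
      have a1 : ContinuousOn (fun y => ‖S y‖ ^ 2) (ball z0 r) := hS.norm.pow 2
      have a2 : ContinuousOn (fun y => (σ y + ε) ^ 2) (ball z0 r) :=
        (hσc.add continuousOn_const).pow 2
      exact continuousOn_const.mul (continuousOn_const.add (a1.div a2 fun y hy =>
        (pow_pos (by linarith [h0 y hy]) 2).ne'))
    have hk : Measurable k :=
      ContinuousOn.measurable_piecewise (ENNReal.continuous_ofReal.comp_continuousOn cQ)
        continuousOn_const measurableSet_ball
    have step1 : ENNReal.ofReal (Real.log (s0 + ε) - Real.log ε) * V ≤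
        ∫⁻ z in ball z1 q, ∫⁻ t in Ioc (0:ℝ) 1, k (z + t • h) := by
      rw [hV, ← setLIntegral_const]
      apply setLIntegral_mono' measurableSet_ball
      intro z hz'
      have hzρ : z ∈ ball z1 ρ := ball_subset_ball (min_le_left _ _) hz'
      have hzb := hb hzρ
      have hzh := hsub (hshift z hz')
      have := log_seg hε hσ hS h0 hzb hzh.1
      refine le_trans (ENNReal.ofReal_le_ofReal ?_) (this.trans ?_)
      · rw [hz z hzρ, zero_add]
        have : Real.log (s0 + ε) ≤ Real.log (σ (z + h) + ε) :=
          Real.log_le_log (by linarith) (by linarith [hzh.2])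
        linarith
      · apply setLIntegral_mono' measurableSet_Ioc
        intro t ht
        have hm : z + t • h ∈ ball z0 r :=
          (convex_ball z0 r).add_smul_mem hzb hzh.1 (Ioc_subset_Icc_self ht)
        simp only [k, piecewise_eq_of_mem _ _ _ hm, Q]
        exact le_rfl
    have step2 : ∫⁻ z in ball z1 q, ∫⁻ t in Ioc (0:ℝ) 1, k (z + t • h) ≤ ∫⁻ y, k y := by
      rw [lintegral_lintegral_swap]
      · calc _ ≤ ∫⁻ t in Ioc (0:ℝ) 1, ∫⁻ y, k y := by
              apply lintegral_mono
              intro t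
              calc _ ≤ ∫⁻ z, k (z + t • h) := setLIntegral_le_lintegral _ _
                _ = _ := lintegral_add_right_eq_self k (t • h)
          _ = _ := by simp
      · apply Measurable.aemeasurable
        apply hk.comp
        fun_prop
    have step3 : ∫⁻ y, k y = ENNReal.ofReal (∫ y in ball z0 r, Q y) := by
      have iQ' : IntegrableOn Q (ball z0 r) :=
        ((integrableOn_const (by finiteness)).add iQ).const_mul _
      rw [ofReal_integral_eq_lintegral_ofReal iQ' (Filter.Eventually.of_forall fun y => by
        simp only [Pi.zero_apply, Q]; positivity), ← lintegral_indicator measurableSet_ball]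
      rfl
    have step4 : ∫ y in ball z0 r, Q y ≤ ‖h‖ * (M + C) := by
      simp only [Q]
      have i1 : Integrable (fun _ : Eu N => (1:ℝ)) (volume.restrict (ball z0 r)) :=
        integrableOn_const (by finiteness)
      rw [integral_const_mul, integral_add i1 iQ]
      gcongr
      simp [hM]
    exact step1.trans (step2.trans (step3 ▸ ENNReal.ofReal_le_ofReal step4))
  set T := (|‖h‖ * (M + C)| + 1) / V.toReal with hT
  have hVr : 0 < V.toReal := ENNReal.toReal_pos hVp hVt
  have hT0 : 0 ≤ T := by positivity
  have := key (s0 / Real.exp T) (by positivity)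
  have hlog : T ≤ Real.log (s0 + s0 / Real.exp T) - Real.log (s0 / Real.exp T) := by
    have e1 : Real.log (s0 / Real.exp T) = Real.log s0 - T := by
      rw [Real.log_div hs0p.ne' (Real.exp_pos T).ne', Real.log_exp]
    have e2 : Real.log s0 ≤ Real.log (s0 + s0 / Real.exp T) :=
      Real.log_le_log hs0p (by have : 0 < s0 / Real.exp T := by positivity
                               linarith)
    linarith
  have h5 : ENNReal.ofReal T * V ≤ ENNReal.ofReal (‖h‖ * (M + C)) :=
    le_trans (by gcongr) this
  rw [← ENNReal.ofReal_toReal hVt, ← ENNReal.ofReal_mul hT0] at h5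
  have h6 : T * V.toReal = |‖h‖ * (M + C)| + 1 := by rw [hT]; field_simp
  rw [h6] at h5
  have h7 := (ENNReal.ofReal_le_ofReal_iff').1 h5
  rcases h7 with h7 | h7
  · linarith [le_abs_self (‖h‖ * (M + C))]
  · linarith [abs_nonneg (‖h‖ * (M + C))]

end loguc
end

open Set Metric MeasureTheory Bornology
open scoped RealInnerProductSpace Classical Topology

noncomputable section

section hodo
variable {N : ℕ}

theorem shear_equiv (w e : Eu N) (h : 1 + ⟪w, e⟫ ≠ 0) :
    ∃ L : Eu N ≃L[ℝ] Eu N, (∀ y, L y = y + ⟪w, y⟫ • e) ∧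
      (∀ z, L.symm z = z - (⟪w, z⟫ / (1 + ⟪w, e⟫)) • e) ∧
      (L : Eu N →L[ℝ] Eu N).det = 1 + ⟪w, e⟫ := by
  let A : Eu N →L[ℝ] Eu N := ContinuousLinearMap.id ℝ (Eu N) + (innerSL ℝ w).smulRight e
  let B : Eu N →L[ℝ] Eu N :=
    ContinuousLinearMap.id ℝ (Eu N) - ((1 + ⟪w, e⟫)⁻¹ • innerSL ℝ w).smulRight e
  have hA : ∀ y, A y = y + ⟪w, y⟫ • e := fun y => by simp [A]
  have hB : ∀ z, B z = z - (⟪w, z⟫ / (1 + ⟪w, e⟫)) • e := fun z => by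
    simp [B, div_eq_inv_mul]
  refine ⟨ContinuousLinearEquiv.equivOfInverse A B ?_ ?_, hA, hB, ?_⟩
  · intro y
    rw [hB, hA, inner_add_right, real_inner_smul_right]
    have : (⟪w, y⟫ + ⟪w, y⟫ * ⟪w, e⟫) / (1 + ⟪w, e⟫) = ⟪w, y⟫ := by field_simp
    rw [this]; abel
  · intro z
    rw [hA, hB, inner_sub_right, real_inner_smul_right]
    have : ⟪w, z⟫ - ⟪w, z⟫ / (1 + ⟪w, e⟫) * ⟪w, e⟫ = ⟪w, z⟫ / (1 + ⟪w, e⟫) := by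
      field_simp; ring
    rw [this]; abel
  · have h2 := LinearMap.transvection.det (innerSL ℝ w : Eu N →L[ℝ] ℝ).toLinearMap e
    have h3 : LinearMap.transvection (innerSL ℝ w : Eu N →L[ℝ] ℝ).toLinearMap e =
        (A : Eu N →ₗ[ℝ] Eu N) := by
      ext1 y
      simp [A, LinearMap.transvection]
    rw [h3] at h2
    exact h2

/-- hodograph map -/
def Phi (e : Eu N) (v : Eu N → ℝ) (x : Eu N) : Eu N := x + (v x - ⟪e, x⟫) • e

theorem Phi_fderiv {e : Eu N} {v : Eu N → ℝ} {p x : Eu N} (h : HasGradientAt v p x)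
    {L : Eu N ≃L[ℝ] Eu N} (hL : ∀ y, L y = y + ⟪p - e, y⟫ • e) :
    HasFDerivAt (Phi e v) (L : Eu N →L[ℝ] Eu N) x := by
  have h1 : HasFDerivAt (fun x => v x - ⟪e, x⟫) (innerSL ℝ p - innerSL ℝ e) x :=
    (hgr_fd.1 h).sub (innerSL ℝ e).hasFDerivAt
  have h2 := (hasFDerivAt_id x).add (h1.smul_const e)
  have h3 : (L : Eu N →L[ℝ] Eu N) = ContinuousLinearMap.id ℝ (Eu N) +
      (innerSL ℝ p - innerSL ℝ e).smulRight e := by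
    ext1 y
    simp [hL, inner_sub_left]
  rw [h3]
  exact h2

theorem Phi_cont {e : Eu N} {v : Eu N → ℝ} (h : Continuous v) : Continuous (Phi e v) := by
  unfold Phi
  have h1 : Continuous (fun x => v x - ⟪e, x⟫) := h.sub (continuous_const.inner continuous_id)
  exact continuous_id.add (h1.smul continuous_const)

theorem Phi_inner {e : Eu N} (he : ‖e‖ = 1) (v : Eu N → ℝ) (x : Eu N) : ⟪Phi e v x, e⟫ = v x := by
  unfold Phi
  rw [inner_add_left, real_inner_smul_left, real_inner_self_eq_norm_sq, he, real_inner_comm e x]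
  ring

theorem hodo_map {O W : Set (Eu N)} {e x0 : Eu N} {v : Eu N → ℝ} {D : Eu N → Eu N}
    (h : C1S O v D) (he : ‖e‖ = 1) (hx0 : x0 ∈ O) (hp : 0 < ⟪D x0, e⟫) (hW : W ∈ 𝓝 x0) :
    ∃ r > 0, ∃ T : OpenPartialHomeomorph (Eu N) (Eu N), (∀ x, T x = Phi e v x) ∧ x0 ∈ T.source ∧
      ball (Phi e v x0) r ⊆ T.target ∧
      (∀ z ∈ ball (Phi e v x0) r, T.symm z ∈ W ∧ T.symm z ∈ O ∧ 0 < ⟪D (T.symm z), e⟫) := by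
  have hne : ∀ x, 0 < ⟪D x, e⟫ → 1 + ⟪D x - e, e⟫ ≠ 0 := by
    intro x hx
    rw [inner_sub_left, real_inner_self_eq_norm_sq, he]; linarith
  obtain ⟨L, hL, -, -⟩ := shear_equiv (D x0 - e) e (hne x0 hp)
  have hstrict : HasStrictFDerivAt (Phi e v) (L : Eu N →L[ℝ] Eu N) x0 := by
    let F : Eu N → (Eu N →L[ℝ] Eu N) := fun x =>
      ContinuousLinearMap.id ℝ (Eu N) + (innerSL ℝ (D x - e)).smulRight e
    have hF0 : F x0 = L := by ext1 y; simp [F, hL, inner_sub_left]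
    rw [← hF0]
    apply hasStrictFDerivAt_of_hasFDerivAt_of_continuousAt
    · have hev : ∀ᶠ x in 𝓝 x0, x ∈ O ∧ 0 < ⟪D x, e⟫ := by
        have c1 : ContinuousAt (fun x => ⟪D x, e⟫) x0 :=
          (h.cont.continuousAt (h.op.mem_nhds hx0)).inner continuousAt_const
        filter_upwards [h.op.mem_nhds hx0, c1.eventually (lt_mem_nhds hp)] with x a b using ⟨a, b⟩
      filter_upwards [hev] with x hx
      obtain ⟨L', hL', -, -⟩ := shear_equiv (D x - e) e (hne x hx.2)
      have : F x = L' := by ext1 y; simp [F, hL', inner_sub_left]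
      rw [this]
      exact Phi_fderiv (h.grad x hx.1) hL'
    · have c1 : ContinuousAt (fun x => D x - e) x0 :=
        (h.cont.continuousAt (h.op.mem_nhds hx0)).sub continuousAt_const
      have c2 : ContinuousAt (fun x => innerSL ℝ (D x - e)) x0 :=
        ((innerSL ℝ).continuous.continuousAt).comp c1
      have c3 : Continuous (fun l : Eu N →L[ℝ] ℝ => l.smulRight e) :=
        ((ContinuousLinearMap.smulRightL ℝ (Eu N) (Eu N)).flip e).continuous
      exact continuousAt_const.add (c3.continuousAt.comp c2)
  let T := hstrict.toOpenPartialHomeomorph (Phi e v)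
  have hT : ∀ x, T x = Phi e v x := fun x => rfl
  have hs : x0 ∈ T.source := hstrict.mem_toOpenPartialHomeomorph_source
  have ht : Phi e v x0 ∈ T.target := T.map_source hs
  have hsx : T.symm (Phi e v x0) = x0 := T.left_inv hs
  have hc : ContinuousAt T.symm (Phi e v x0) := T.continuousAt_symm ht
  have hev : ∀ᶠ x in 𝓝 (T.symm (Phi e v x0)), x ∈ W ∧ x ∈ O ∧ 0 < ⟪D x, e⟫ := by
    rw [hsx]
    have c1 : ContinuousAt (fun x => ⟪D x, e⟫) x0 :=
      (h.cont.continuousAt (h.op.mem_nhds hx0)).inner continuousAt_const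
    filter_upwards [hW, h.op.mem_nhds hx0, c1.eventually (lt_mem_nhds hp)] with x a b c
    exact ⟨a, b, c⟩
  have hev2 := (hc.eventually hev).and (T.open_target.mem_nhds ht)
  obtain ⟨r, hr, hsub⟩ := Metric.mem_nhds_iff.1 hev2
  exact ⟨r, hr, T, hT, hs, fun z hz => (hsub hz).2, fun z hz => (hsub hz).1⟩

theorem hodo {O W : Set (Eu N)} {g f : ℝ → ℝ} {e x0 : Eu N} {v : Eu N → ℝ} {D : Eu N → Eu N}
    (hg : Gd g) (hf : Continuous f)
    (h : Sol O g f v D) (he : ‖e‖ = 1) (hx0 : x0 ∈ O) (hp : 0 < ⟪D x0, e⟫) (hW : W ∈ 𝓝 x0) :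
    ∃ r > 0, ∃ S : Eu N → Eu N,
      (∀ z ∈ ball (Phi e v x0) r, S z ∈ W ∧ S z ∈ O ∧ Phi e v (S z) = z ∧ 0 < ⟪D (S z), e⟫) ∧
      ContinuousOn S (ball (Phi e v x0) r) ∧
      (∀ z ∈ ball (Phi e v x0) r, HasGradientAt (fun z => ⟪S z, e⟫)
        ((⟪D (S z), e⟫)⁻¹ • ((1 + ⟪D (S z), e⟫) • e - D (S z))) z) ∧
      (∀ᶠ x in 𝓝 x0, S (Phi e v x) = x) ∧
      (∀ κ X, Tst (ball (Phi e v x0) r) κ X → (∀ x, 0 ≤ κ x) →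
        Integrable (fun z => ⟪gvec g (D (S z)), X z - ⟪X z, e⟫ • e⟫ + Hv g (D (S z)) * ⟪X z, e⟫) ∧
        ∫ z, (⟪gvec g (D (S z)), X z - ⟪X z, e⟫ • e⟫ + Hv g (D (S z)) * ⟪X z, e⟫) =
          ∫ z, f ⟪z, e⟫ * κ z) := by
  obtain ⟨r, hr, T, hT, hTs, hTt, hprop⟩ := hodo_map h.c1 he hx0 hp hW
  set z0 := Phi e v x0 with hz0
  have hne : ∀ x, 0 < ⟪D x, e⟫ → 1 + ⟪D x - e, e⟫ = ⟪D x, e⟫ := by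
    intro x hx
    rw [inner_sub_left, real_inner_self_eq_norm_sq, he]; ring
  have hcS : ContinuousOn T.symm (ball z0 r) := T.continuousOn_symm.mono hTt
  have hPS : ∀ z ∈ ball z0 r, Phi e v (T.symm z) = z := fun z hz => by
    rw [← hT]; exact T.right_inv (hTt hz)
  have hcDS : ContinuousOn (fun z => D (T.symm z)) (ball z0 r) :=
    h.c1.cont.comp hcS fun z hz => (hprop z hz).2.1
  refine ⟨r, hr, T.symm, fun z hz => ⟨(hprop z hz).1, (hprop z hz).2.1, hPS z hz,
    (hprop z hz).2.2⟩, hcS, ?_, ?_, ?_⟩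
  · intro z hz
    obtain ⟨-, hO, hpe⟩ := hprop z hz
    obtain ⟨L, hL, hLs, -⟩ := shear_equiv (D (T.symm z) - e) e
      (by rw [hne _ hpe]; exact hpe.ne')
    have d1 := T.hasFDerivAt_symm (hTt hz) (f' := L)
      ((Phi_fderiv (h.c1.grad _ hO) hL).congr_of_eventuallyEq (Filter.Eventually.of_forall hT))
    have d2 : HasFDerivAt (fun z => ⟪T.symm z, e⟫)
        ((innerSL ℝ e).comp (L.symm : Eu N →L[ℝ] Eu N)) z := by
      have := (innerSL ℝ e).hasFDerivAt.comp z d1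
      refine this.congr_of_eventuallyEq (Filter.Eventually.of_forall fun y => ?_)
      exact real_inner_comm _ _
    rw [hgr_fd]
    have h2 : innerSL ℝ ((⟪D (T.symm z), e⟫)⁻¹ • ((1 + ⟪D (T.symm z), e⟫) • e - D (T.symm z))) =
        (innerSL ℝ e).comp (L.symm : Eu N →L[ℝ] Eu N) := by
      ext1 y
      simp only [innerSL_apply_apply, ContinuousLinearMap.comp_apply, ContinuousLinearEquiv.coe_coe,
        hLs, hne _ hpe, inner_sub_right, real_inner_smul_right, real_inner_smul_left, inner_sub_left,
        real_inner_self_eq_norm_sq, he]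
      have hpe' := hpe.ne'
      generalize ⟪D (T.symm z), e⟫ = a at hpe' ⊢
      have ha : a * a⁻¹ = 1 := mul_inv_cancel₀ hpe'
      rw [div_eq_mul_inv]
      linear_combination ⟪e, y⟫ * ha
    rw [h2]; exact d2
  · filter_upwards [T.open_source.mem_nhds hTs] with x hx
    rw [← hT]; exact T.left_inv hx
  · intro κ X hκ hκ0
    obtain ⟨K, hK, hKO, hk0, hk1⟩ := hκ.supp
    set A := T.symm '' ball z0 r with hA
    have hAeq : A = T.source ∩ T ⁻¹' ball z0 r :=
      T.symm_image_eq_source_inter_preimage hTt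
    have hAo : IsOpen A := by
      rw [hAeq]; exact T.isOpen_inter_preimage isOpen_ball
    have hAO : A ⊆ O := by rintro _ ⟨z, hz, rfl⟩; exact (hprop z hz).2.1
    have hAp : ∀ x ∈ A, 0 < ⟪D x, e⟫ := by rintro _ ⟨z, hz, rfl⟩; exact (hprop z hz).2.2
    have hAz : ∀ x ∈ A, Phi e v x ∈ ball z0 r := by
      rintro _ ⟨z, hz, rfl⟩; rw [hPS z hz]; exact hz
    have hAs : ∀ x ∈ A, T.symm (Phi e v x) = x := by
      rintro _ ⟨z, hz, rfl⟩; rw [hPS z hz]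
    have hAK : IsCompact (T.symm '' K) := hK.image_of_continuousOn (hcS.mono hKO)
    have hAKA : T.symm '' K ⊆ A := image_mono hKO
    have hΦc := Phi_cont (e := e) h.c1.uc
    -- the test function upstairs
    let κ' : Eu N → ℝ := fun x => if x ∈ A then κ (Phi e v x) else 0
    have hκ'0 : ∀ x ∉ T.symm '' K, κ' x = 0 := by
      intro x hx
      simp only [κ']
      split_ifs with hxA
      · apply hk0
        intro hk
        exact hx ⟨_, hk, hAs x hxA⟩
      · rfl
    have hgr : ∀ x ∈ A, HasGradientAt κ'
        (X (Phi e v x) + ⟪X (Phi e v x), e⟫ • (D x - e)) x := by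
      intro x hx
      obtain ⟨L, hL, -, -⟩ := shear_equiv (D x - e) e (by rw [hne _ (hAp x hx)]; exact (hAp x hx).ne')
      have d1 := hgr_fcomp (Phi_fderiv (h.c1.grad _ (hAO hx)) hL) (hκ.grad (Phi e v x))
      have e1 : (L : Eu N →L[ℝ] Eu N).adjoint (X (Phi e v x)) =
          X (Phi e v x) + ⟪X (Phi e v x), e⟫ • (D x - e) := by
        apply ext_inner_right ℝ
        intro y
        rw [ContinuousLinearMap.adjoint_inner_left]
        simp only [ContinuousLinearEquiv.coe_coe, hL, inner_add_right, inner_add_left,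
          real_inner_smul_left, real_inner_smul_right]
        ring
      rw [e1] at d1
      refine d1.congr_of_eventuallyEq ?_
      filter_upwards [hAo.mem_nhds hx] with y hy
      simp only [κ', if_pos hy]
    have cX : ContinuousOn (fun x => X (Phi e v x)) A := (hκ.cont.comp hΦc).continuousOn
    have cD : ContinuousOn D A := h.c1.cont.mono hAO
    have hcont : ContinuousOn (fun x => X (Phi e v x) + ⟪X (Phi e v x), e⟫ • (D x - e)) A := by
      have c1 : ContinuousOn (fun x => ⟪X (Phi e v x), e⟫) A := cX.inner continuousOn_const
      have c2 : ContinuousOn (fun x => D x - e) A := cD.sub continuousOn_const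
      have c3 : ContinuousOn (fun x => ⟪X (Phi e v x), e⟫ • (D x - e)) A := c1.smul c2
      exact cX.add c3
    have htst := (tst_mk hAo hAK hAKA hκ'0 hgr hcont).mono hAO
    have hκ'p : ∀ x, 0 ≤ κ' x := fun x => by
      simp only [κ']; split_ifs
      · exact hκ0 _
      · exact le_rfl
    have hnoe := noether hg hf h htst hκ'p e
    let H : Eu N → ℝ := fun z => ⟪gvec g (D (T.symm z)), X z - ⟪X z, e⟫ • e⟫ +
      Hv g (D (T.symm z)) * ⟪X z, e⟫
    let H2 : Eu N → ℝ := fun z => f ⟪z, e⟫ * κ z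
    have iH : Integrable H := by
      apply int_of_supp isOpen_ball hK hKO
      · intro z hz; simp [H, hk1 z hz]
      · have cXX := hκ.cont.continuousOn (s := ball z0 r)
        have c1 : ContinuousOn (fun z => gvec g (D (T.symm z))) (ball z0 r) :=
          (gvec_cont hg).comp_continuousOn hcDS
        have c2 : ContinuousOn (fun z => ⟪X z, e⟫) (ball z0 r) := cXX.inner continuousOn_const
        have c3 : ContinuousOn (fun z => ⟪X z, e⟫ • e) (ball z0 r) := c2.smul continuousOn_const
        have c4 : ContinuousOn (fun z => X z - ⟪X z, e⟫ • e) (ball z0 r) := cXX.sub c3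
        have c5 : ContinuousOn (fun z => Hv g (D (T.symm z))) (ball z0 r) :=
          (Hv_cont hg).comp_continuousOn hcDS
        exact (c1.inner c4).add (c5.mul c2)
    have iH2 : Integrable H2 := by
      apply int_of_supp isOpen_ball hK hKO
      · intro z hz; simp [H2, hk0 z hz]
      · exact ((hf.comp (continuous_id.inner continuous_const)).mul hκ.ucont).continuousOn
    refine ⟨iH, ?_⟩
    suffices hs : ∫ z, (H z - H2 z) = 0 by
      rw [integral_sub iH iH2] at hs
      exact sub_eq_zero.1 hs
    have e1 : ∫ z, (H z - H2 z) = ∫ z in ball z0 r, (H z - H2 z) := by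
      rw [setIntegral_eq_integral_of_forall_compl_eq_zero]
      intro z hz
      have hzK : z ∉ K := fun hk => hz (hKO hk)
      simp [H, H2, hk0 z hzK, hk1 z hzK]
    have e2 : ball z0 r = Phi e v '' A := by
      rw [hA, image_image]
      ext z
      constructor
      · intro hz; exact ⟨z, hz, hPS z hz⟩
      · rintro ⟨y, hy, rfl⟩
        have := hPS y hy
        simp only [this]; exact hy
    rw [e1, e2]
    have hLx : ∀ x ∈ A, ∃ L : Eu N →L[ℝ] Eu N, HasFDerivWithinAt (Phi e v) L A x ∧
        L.det = ⟪D x, e⟫ := by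
      intro x hx
      obtain ⟨L, hL, -, hd⟩ := shear_equiv (D x - e) e (by rw [hne _ (hAp x hx)]; exact (hAp x hx).ne')
      exact ⟨L, (Phi_fderiv (h.c1.grad _ (hAO hx)) hL).hasFDerivWithinAt, by
        rw [hd, hne _ (hAp x hx)]⟩
    choose! L hL1 hL2 using hLx
    rw [integral_image_eq_integral_abs_det_fderiv_smul volume hAo.measurableSet hL1
      (fun x hx y hy hxy => by rw [← hAs x hx, ← hAs y hy, hxy])]
    rw [← hnoe]
    have e3 : ∀ (F : Eu N → ℝ), (∀ x ∉ A, F x = 0) → ∫ x, F x = ∫ x in A, F x := fun F hF =>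
      (setIntegral_eq_integral_of_forall_compl_eq_zero hF).symm
    rw [e3]
    · apply setIntegral_congr_fun hAo.measurableSet
      intro x hx
      simp only [hL2 x hx, abs_of_pos (hAp x hx), smul_eq_mul, H, H2, hAs x hx, Phi_inner he,
        κ', if_pos hx, Hv, inner_add_left, inner_add_right, inner_sub_right, real_inner_smul_right,
        real_inner_smul_left, inner_sub_left, real_inner_self_eq_norm_sq, he]
      ring
    · intro x hx
      simp [κ', hx]

end hodo
end

open Set Metric MeasureTheory Bornology
open scoped RealInnerProductSpace Classical Topology

noncomputable section

section luc
variable {N : ℕ}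

theorem hodo_ell {g : ℝ → ℝ} (hg : Gd g) {d Mb : ℝ} (hd : 0 < d) (hdM : d ≤ Mb) :
    ∃ A > 0, ∀ e p q : Eu N, ‖e‖ = 1 → ‖p‖ ∈ Icc d Mb → ‖q‖ ∈ Icc d Mb → d ≤ ⟪p, e⟫ → d ≤ ⟪q, e⟫ →
      ∀ B S : Eu N, B = (gvec g q - gvec g p) - ⟪gvec g q - gvec g p, e⟫ • e +
          (Hv g q - Hv g p) • e →
        S = (⟪p, e⟫)⁻¹ • ((1 + ⟪p, e⟫) • e - p) - (⟪q, e⟫)⁻¹ • ((1 + ⟪q, e⟫) • e - q) →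
        ‖B‖ ^ 2 ≤ A * ⟪B, S⟫ ∧ ‖S‖ ^ 2 ≤ A * ⟪B, S⟫ := by
  obtain ⟨c, C, hc, hC, hb⟩ := annulus_bounds (N := N) hg hd hdM
  have hM : 0 < Mb := hd.trans_le hdM
  set K := 3 * C + (1 / d + (1 + Mb) / d ^ 2) with hK
  have hKp : 0 < K := by positivity
  refine ⟨K ^ 2 * Mb / c, by positivity, ?_⟩
  intro e p q he hp hq hpe hqe B S hB hS
  obtain ⟨b1, b2, b3⟩ := hb p q hp hq
  have hpe0 : 0 < ⟪p, e⟫ := hd.trans_le hpe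
  have hqe0 : 0 < ⟪q, e⟫ := hd.trans_le hqe
  have hpM : ⟪p, e⟫ ≤ Mb := by
    have := real_inner_le_norm p e; rw [he, mul_one] at this; exact this.trans hp.2
  have hqM : ⟪q, e⟫ ≤ Mb := by
    have := real_inner_le_norm q e; rw [he, mul_one] at this; exact this.trans hq.2
  have hnB : ‖B‖ ≤ 3 * C * ‖q - p‖ := by
    have h1 : |⟪gvec g q - gvec g p, e⟫| ≤ C * ‖q - p‖ := by
      have := abs_real_inner_le_norm (gvec g q - gvec g p) e
      rw [he, mul_one] at this; exact this.trans b2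
    calc ‖B‖ ≤ ‖gvec g q - gvec g p‖ + ‖⟪gvec g q - gvec g p, e⟫ • e‖ + ‖(Hv g q - Hv g p) • e‖ := by
          rw [hB]; exact (norm_add_le _ _).trans (add_le_add_left (norm_sub_le _ _) _)
      _ ≤ C * ‖q - p‖ + C * ‖q - p‖ + C * ‖q - p‖ := by
          rw [norm_smul, norm_smul, he, mul_one, mul_one, Real.norm_eq_abs, Real.norm_eq_abs]
          gcongr
      _ = _ := by ring
  have e3 : ∀ (a : ℝ) (y : Eu N), a ≠ 0 → a⁻¹ • ((1 + a) • e - y) = a⁻¹ • e + e - a⁻¹ • y := by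
    intro a y ha
    rw [smul_sub, smul_smul]
    have : a⁻¹ * (1 + a) = a⁻¹ + 1 := by field_simp
    rw [this, add_smul, one_smul]
  have hnS : ‖S‖ ≤ (1 / d + (1 + Mb) / d ^ 2) * ‖q - p‖ := by
    have e1 : S = (⟪q, e⟫)⁻¹ • (q - p) + ((⟪p, e⟫)⁻¹ * (⟪q, e⟫)⁻¹ * ⟪q - p, e⟫) • (e - p) := by
      have e2 : (⟪p, e⟫)⁻¹ * (⟪q, e⟫)⁻¹ * ⟪q - p, e⟫ = (⟪p, e⟫)⁻¹ - (⟪q, e⟫)⁻¹ := by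
        rw [inner_sub_left]
        have ha := hpe0.ne'
        have hb := hqe0.ne'
        generalize ⟪p, e⟫ = a at ha ⊢
        generalize ⟪q, e⟫ = b at hb ⊢
        field_simp
      rw [e2, hS, e3 _ _ hpe0.ne', e3 _ _ hqe0.ne']
      module
    have h2 : |⟪q - p, e⟫| ≤ ‖q - p‖ := by
      have := abs_real_inner_le_norm (q - p) e
      rwa [he, mul_one] at this
    have h3 : ‖e - p‖ ≤ 1 + Mb := (norm_sub_le _ _).trans (by rw [he]; linarith [hp.2])
    have h4 : (⟪p, e⟫)⁻¹ ≤ d⁻¹ := inv_anti₀ hd hpe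
    have h5 : (⟪q, e⟫)⁻¹ ≤ d⁻¹ := inv_anti₀ hd hqe
    have h6 : 0 < (⟪p, e⟫)⁻¹ := inv_pos.2 hpe0
    have h7 : 0 < (⟪q, e⟫)⁻¹ := inv_pos.2 hqe0
    calc ‖S‖ ≤ (⟪q, e⟫)⁻¹ * ‖q - p‖ + ((⟪p, e⟫)⁻¹ * (⟪q, e⟫)⁻¹ * |⟪q - p, e⟫|) * ‖e - p‖ := by
          rw [e1]
          refine (norm_add_le _ _).trans (le_of_eq ?_)
          rw [norm_smul, norm_smul, Real.norm_eq_abs, Real.norm_eq_abs, abs_mul, abs_mul,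
            abs_of_pos h6, abs_of_pos h7]
      _ ≤ d⁻¹ * ‖q - p‖ + (d⁻¹ * d⁻¹ * ‖q - p‖) * (1 + Mb) := by gcongr
      _ = _ := by field_simp
  have hBS : c / Mb * ‖q - p‖ ^ 2 ≤ ⟪B, S⟫ := by
    have c1 := gvec_convex hg p q
    have c2 := gvec_convex hg q p
    have e1 : ⟪B, S⟫ = (⟪q, e⟫)⁻¹ * (Gfun g ‖q‖ - Gfun g ‖p‖ - ⟪gvec g p, q - p⟫) +
        (⟪p, e⟫)⁻¹ * (Gfun g ‖p‖ - Gfun g ‖q‖ - ⟪gvec g q, p - q⟫) := by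
      have e4 : S = ((⟪p, e⟫)⁻¹ - (⟪q, e⟫)⁻¹) • e - (⟪p, e⟫)⁻¹ • p + (⟪q, e⟫)⁻¹ • q := by
        rw [hS, e3 _ _ hpe0.ne', e3 _ _ hqe0.ne']
        module
      have ha1 : ⟪p, e⟫ * ⟪p, e⟫⁻¹ = 1 := mul_inv_cancel₀ hpe0.ne'
      have hb1 : ⟪q, e⟫ * ⟪q, e⟫⁻¹ = 1 := mul_inv_cancel₀ hqe0.ne'
      rw [hB, e4]
      simp only [Hv, inner_add_left, inner_add_right, inner_sub_left, inner_sub_right,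
        real_inner_smul_left, real_inner_smul_right, real_inner_self_eq_norm_sq, he,
        real_inner_comm p e, real_inner_comm q e]
      generalize ⟪p, e⟫⁻¹ = a' at *
      generalize ⟪q, e⟫⁻¹ = b' at *
      generalize ⟪p, e⟫ = a at *
      generalize ⟪q, e⟫ = b at *
      linear_combination (-(⟪gvec g p, e⟫ - ⟪gvec g q, e⟫ + ⟪gvec g q, q⟫ - ⟪gvec g p, p⟫ - Gfun g ‖q‖ + Gfun g ‖p‖)) * ha1 + (⟪gvec g p, e⟫ - ⟪gvec g q, e⟫ + ⟪gvec g q, q⟫ - ⟪gvec g p, p⟫ - Gfun g ‖q‖ + Gfun g ‖p‖) * hb1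
    have h4 : Mb⁻¹ ≤ (⟪p, e⟫)⁻¹ := inv_anti₀ hpe0 hpM
    have h5 : Mb⁻¹ ≤ (⟪q, e⟫)⁻¹ := inv_anti₀ hqe0 hqM
    have k1 := mul_le_mul_of_nonneg_right h5 (sub_nonneg.2 c1)
    have k2 := mul_le_mul_of_nonneg_right h4 (sub_nonneg.2 c2)
    have e2 : ⟪gvec g q - gvec g p, q - p⟫ = (Gfun g ‖q‖ - Gfun g ‖p‖ - ⟪gvec g p, q - p⟫) +
      (Gfun g ‖p‖ - Gfun g ‖q‖ - ⟪gvec g q, p - q⟫) := by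
      simp only [inner_sub_left, inner_sub_right]; ring
    have k3 := mul_le_mul_of_nonneg_left b1 (inv_pos.2 hM).le
    rw [e2, mul_add] at k3
    rw [e1]
    have e3 : c / Mb * ‖q - p‖ ^ 2 = Mb⁻¹ * (c * ‖q - p‖ ^ 2) := by ring
    rw [e3]
    linarith
  have hfin : K ^ 2 * ‖q - p‖ ^ 2 ≤ K ^ 2 * Mb / c * ⟪B, S⟫ := by
    calc _ = K ^ 2 * Mb / c * (c / Mb * ‖q - p‖ ^ 2) := by field_simp
      _ ≤ _ := by gcongr
  constructor
  · refine le_trans ?_ hfin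
    rw [← mul_pow]
    refine pow_le_pow_left₀ (norm_nonneg _) (hnB.trans ?_) 2
    gcongr
    rw [hK]; have : 0 < 1 / d + (1 + Mb) / d ^ 2 := by positivity
    linarith
  · refine le_trans ?_ hfin
    rw [← mul_pow]
    refine pow_le_pow_left₀ (norm_nonneg _) (hnS.trans ?_) 2
    gcongr
    rw [hK]; linarith

end luc
end

open Set Metric MeasureTheory Bornology
open scoped RealInnerProductSpace Classical Topology

noncomputable section

section luc2
variable {N : ℕ}

theorem grad_eq_of_le {u m : Eu N → ℝ} {p q x : Eu N} (hu : HasGradientAt u p x)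
    (hm : HasGradientAt m q x) (hle : ∀ᶠ y in 𝓝 x, u y ≤ m y) (hx : m x = u x) : q = p := by
  have h1 : IsLocalMin (fun y => m y - u y) x := by
    filter_upwards [hle] with y hy
    rw [hx, sub_self]; linarith
  have h2 := h1.hasFDerivAt_eq_zero (hgr_fd.1 (hgr_sub hm hu))
  have h3 : innerSL ℝ (q - p) (q - p) = 0 := by rw [h2]; rfl
  rw [innerSL_apply_apply, inner_self_eq_zero, sub_eq_zero] at h3
  exact h3

theorem luc {O : Set (Eu N)} {g f : ℝ → ℝ} {u m : Eu N → ℝ} {D M : Eu N → Eu N} (hg : Gd g)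
    (hf : Continuous f) (hu : Sol O g f u D) (hm : Sol O g f m M) (hle : ∀ x ∈ O, u x ≤ m x)
    {x0 : Eu N} (hx0 : x0 ∈ O) (hD : D x0 ≠ 0) (hcl : x0 ∈ closure (interior {x | m x = u x})) :
    ∀ᶠ x in 𝓝 x0, m x = u x := by
  have hclosed : IsClosed {x | m x = u x} := isClosed_eq hm.c1.uc hu.c1.uc
  have hmx0 : m x0 = u x0 := (closure_minimal interior_subset hclosed) hcl
  have hOn := hu.c1.op.mem_nhds hx0
  have hMx0 : M x0 = D x0 := grad_eq_of_le (hu.c1.grad x0 hx0) (hm.c1.grad x0 hx0)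
    (Filter.mem_of_superset hOn hle) hmx0
  have hDp : 0 < ‖D x0‖ := norm_pos_iff.2 hD
  set e := ‖D x0‖⁻¹ • D x0 with he_def
  have he : ‖e‖ = 1 := by rw [he_def, norm_smul, norm_inv, norm_norm, inv_mul_cancel₀ hDp.ne']
  have hDe : ⟪D x0, e⟫ = ‖D x0‖ := by
    rw [he_def, real_inner_smul_right, real_inner_self_eq_norm_sq]; field_simp
  set d := ‖D x0‖ / 2 with hd
  have hdp : 0 < d := half_pos hDp
  obtain ⟨A, hA, hell⟩ := hodo_ell (N := N) hg hdp (show d ≤ 2 * ‖D x0‖ by linarith)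
  -- the good neighbourhood
  have hgood : ∀ (V : Eu N → Eu N), ContinuousAt V x0 → V x0 = D x0 →
      ∀ᶠ x in 𝓝 x0, ‖V x‖ ∈ Icc d (2 * ‖D x0‖) ∧ d ≤ ⟪V x, e⟫ := by
    intro V hV hV0
    have c1 : ContinuousAt (fun x => ‖V x‖) x0 := hV.norm
    have c2 : ContinuousAt (fun x => ⟪V x, e⟫) x0 := hV.inner continuousAt_const
    have a1 : d < ‖V x0‖ := by rw [hV0]; linarith
    have a2 : ‖V x0‖ < 2 * ‖D x0‖ := by rw [hV0]; linarith
    have a3 : d < ⟪V x0, e⟫ := by rw [hV0, hDe]; linarith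
    filter_upwards [c1.eventually (lt_mem_nhds a1), c1.eventually (gt_mem_nhds a2),
      c2.eventually (lt_mem_nhds a3)] with x h1 h2 h3
    exact ⟨⟨h1.le, h2.le⟩, h3.le⟩
  have hW := (hgood D (hu.c1.cont.continuousAt hOn) rfl).and
    ((hgood M (hm.c1.cont.continuousAt hOn) hMx0).and hOn)
  obtain ⟨w, hw, hwW⟩ := Metric.mem_nhds_iff.1 hW
  have hWn : ball x0 w ∈ 𝓝 x0 := ball_mem_nhds x0 hw
  obtain ⟨r1, hr1, S, a1, a2, a3, a4, a5⟩ := hodo hg hf hu he hx0 (by rw [hDe]; exact hDp) hWn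
  obtain ⟨r2, hr2, T, b1, b2, b3, b4, b5⟩ := hodo hg hf hm he hx0 (by rw [hMx0, hDe]; exact hDp) hWn
  have hz0 : Phi e m x0 = Phi e u x0 := by unfold Phi; rw [hmx0]
  rw [hz0] at b1 b2 b3 b5
  set z0 := Phi e u x0 with hz0def
  set r := min r1 r2 with hr
  have hrp : 0 < r := lt_min hr1 hr2
  have hs1 : ball z0 r ⊆ ball z0 r1 := ball_subset_ball (min_le_left _ _)
  have hs2 : ball z0 r ⊆ ball z0 r2 := ball_subset_ball (min_le_right _ _)
  let σ : Eu N → ℝ := fun z => ⟪S z, e⟫ - ⟪T z, e⟫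
  have hdiff : ∀ z ∈ ball z0 r, S z = T z + σ z • e := by
    intro z hz
    have k1 := (a1 z (hs1 hz)).2.2.1
    have k2 := (b1 z (hs2 hz)).2.2.1
    unfold Phi at k1 k2
    have k3 : S z = T z + ((m (T z) - ⟪e, T z⟫) - (u (S z) - ⟪e, S z⟫)) • e := by
      have : S z + (u (S z) - ⟪e, S z⟫) • e = T z + (m (T z) - ⟪e, T z⟫) • e := k1.trans k2.symm
      rw [sub_smul, ← add_sub_assoc, ← this]; abel
    have k4 : σ z = (m (T z) - ⟪e, T z⟫) - (u (S z) - ⟪e, S z⟫) := by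
      simp only [σ]
      have : ⟪S z, e⟫ = ⟪T z, e⟫ + ((m (T z) - ⟪e, T z⟫) - (u (S z) - ⟪e, S z⟫)) := by
        conv_lhs => rw [k3]
        rw [inner_add_left, real_inner_smul_left, real_inner_self_eq_norm_sq, he]; ring
      linarith
    rw [k4]; exact k3
  have huS : ∀ z ∈ ball z0 r, u (S z) = ⟪z, e⟫ := by
    intro z hz
    rw [← Phi_inner he u (S z), (a1 z (hs1 hz)).2.2.1]
  have hmT : ∀ z ∈ ball z0 r, m (T z) = ⟪z, e⟫ := by
    intro z hz
    rw [← Phi_inner he m (T z), (b1 z (hs2 hz)).2.2.1]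
  have hσ0 : ∀ z ∈ ball z0 r, 0 ≤ σ z := by
    intro z hz
    by_contra! hneg
    have hSW := (a1 z (hs1 hz)).1
    have hTW := (b1 z (hs2 hz)).1
    -- u (T z) ≤ m (T z) = u (S z) but u is increasing from S z to T z
    have hle' : u (T z) ≤ u (S z) := by
      rw [huS z hz, ← hmT z hz]; exact hle _ (b1 z (hs2 hz)).2.1
    let φ : ℝ → ℝ := fun t => u (S z + t • (T z - S z))
    have hseg : ∀ t ∈ Icc (0:ℝ) 1, S z + t • (T z - S z) ∈ ball x0 w := fun t ht =>
      (convex_ball x0 w).add_smul_sub_mem hSW hTW ht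
    have hTS : T z - S z = (-σ z) • e := by rw [hdiff z hz]; module
    have hder : ∀ t ∈ Icc (0:ℝ) 1, HasDerivAt φ ⟪D (S z + t • (T z - S z)), T z - S z⟫ t := fun t ht =>
      hgr_line (T z - S z) t (hu.c1.grad _ (hwW (hseg t ht)).2.2)
    have hmono : StrictMonoOn φ (Icc 0 1) := by
      apply strictMonoOn_of_deriv_pos (convex_Icc 0 1)
      · intro t ht; exact (hder t ht).continuousAt.continuousWithinAt
      · intro t ht
        rw [interior_Icc] at ht
        have ht' := Ioo_subset_Icc_self ht
        rw [(hder t ht').deriv]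
        have hpos := (hwW (hseg t ht')).1.2
        generalize D (S z + t • (T z - S z)) = V at *
        rw [hTS, real_inner_smul_right]
        exact mul_pos (by linarith) (hdp.trans_le hpos)
    have := hmono (left_mem_Icc.2 zero_le_one) (right_mem_Icc.2 zero_le_one) zero_lt_one
    simp only [φ, zero_smul, add_zero, one_smul, add_sub_cancel] at this
    linarith
  let B : Eu N → Eu N := fun z => (gvec g (M (T z)) - gvec g (D (S z))) -
    ⟪gvec g (M (T z)) - gvec g (D (S z)), e⟫ • e + (Hv g (M (T z)) - Hv g (D (S z))) • e
  let Sg : Eu N → Eu N := fun z => (⟪D (S z), e⟫)⁻¹ • ((1 + ⟪D (S z), e⟫) • e - D (S z)) -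
    (⟪M (T z), e⟫)⁻¹ • ((1 + ⟪M (T z), e⟫) • e - M (T z))
  have hest : ∀ z ∈ ball z0 r, ‖B z‖ ^ 2 ≤ A * ⟪B z, Sg z⟫ ∧ ‖Sg z‖ ^ 2 ≤ A * ⟪B z, Sg z⟫ := by
    intro z hz
    have k1 := hwW (a1 z (hs1 hz)).1
    have k2 := hwW (b1 z (hs2 hz)).1
    exact hell e (D (S z)) (M (T z)) he k1.1.1 k2.2.1.1 k1.1.2 k2.2.1.2 _ _ rfl rfl
  have hσg : ∀ z ∈ ball z0 r, HasGradientAt σ (Sg z) z := fun z hz =>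
    hgr_sub (a3 z (hs1 hz)) (b3 z (hs2 hz))
  have cDS : ContinuousOn (fun z => D (S z)) (ball z0 r) :=
    hu.c1.cont.comp (a2.mono hs1) fun z hz => (a1 z (hs1 hz)).2.1
  have cMT : ContinuousOn (fun z => M (T z)) (ball z0 r) :=
    hm.c1.cont.comp (b2.mono hs2) fun z hz => (b1 z (hs2 hz)).2.1
  have cSg : ContinuousOn Sg (ball z0 r) := by
    have aux : ∀ V : Eu N → Eu N, ContinuousOn V (ball z0 r) → (∀ z ∈ ball z0 r, 0 < ⟪V z, e⟫) →
        ContinuousOn (fun z => (⟪V z, e⟫)⁻¹ • ((1 + ⟪V z, e⟫) • e - V z)) (ball z0 r) := by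
      intro V hV hp
      have c1 : ContinuousOn (fun z => ⟪V z, e⟫) (ball z0 r) := hV.inner continuousOn_const
      have c2 : ContinuousOn (fun z => (⟪V z, e⟫)⁻¹) (ball z0 r) := c1.inv₀ fun z hz => (hp z hz).ne'
      have c3 : ContinuousOn (fun z => 1 + ⟪V z, e⟫) (ball z0 r) := continuousOn_const.add c1
      have c4 : ContinuousOn (fun z => (1 + ⟪V z, e⟫) • e) (ball z0 r) := c3.smul continuousOn_const
      have c5 : ContinuousOn (fun z => (1 + ⟪V z, e⟫) • e - V z) (ball z0 r) := c4.sub hV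
      exact c2.smul c5
    have k1 := aux _ cDS fun z hz => (a1 z (hs1 hz)).2.2.2
    have k2 := aux _ cMT fun z hz => (b1 z (hs2 hz)).2.2.2
    exact k1.sub k2
  have cB : ContinuousOn B (ball z0 r) := by
    have c1 : ContinuousOn (fun z => gvec g (M (T z)) - gvec g (D (S z))) (ball z0 r) :=
      ((gvec_cont hg).comp_continuousOn cMT).sub ((gvec_cont hg).comp_continuousOn cDS)
    have c2 : ContinuousOn (fun z => Hv g (M (T z)) - Hv g (D (S z))) (ball z0 r) :=
      ((Hv_cont hg).comp_continuousOn cMT).sub ((Hv_cont hg).comp_continuousOn cDS)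
    have c3 : ContinuousOn (fun z => ⟪gvec g (M (T z)) - gvec g (D (S z)), e⟫) (ball z0 r) :=
      c1.inner continuousOn_const
    have c4 : ContinuousOn (fun z => ⟪gvec g (M (T z)) - gvec g (D (S z)), e⟫ • e) (ball z0 r) :=
      c3.smul continuousOn_const
    have c5 : ContinuousOn (fun z => (Hv g (M (T z)) - Hv g (D (S z))) • e) (ball z0 r) :=
      c2.smul continuousOn_const
    exact (c1.sub c4).add c5
  have hweak : ∀ κ X, Tst (ball z0 r) κ X → (∀ x, 0 ≤ κ x) → ∫ x, ⟪B x, X x⟫ = 0 := by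
    intro κ X hκ hκ0
    obtain ⟨i1, e1⟩ := a5 κ X (hκ.mono hs1) hκ0
    obtain ⟨i2, e2⟩ := b5 κ X (hκ.mono hs2) hκ0
    have := integral_sub i2 i1
    rw [e1, e2, sub_self] at this
    rw [← this]
    congr 1; ext z
    simp only [B, inner_add_left, inner_sub_left, inner_sub_right, real_inner_smul_left,
      real_inner_smul_right, real_inner_comm e (X z)]
    ring
  obtain ⟨C, hC⟩ := energy_est hrp hA hσg cSg cB hσ0 (fun z hz => (hest z hz).1)
    (fun z hz => (hest z hz).2) hweak
  have hhalf : ball z0 (r / 2) ⊆ ball z0 r := ball_subset_ball (by linarith)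
  -- start point
  have hΦu := Phi_cont (e := e) hu.c1.uc
  have hnear : ∀ᶠ x in 𝓝 x0, S (Phi e u x) = x ∧ T (Phi e m x) = x ∧ Phi e u x ∈ ball z0 (r / 2) := by
    filter_upwards [a4, b4, hΦu.continuousAt.preimage_mem_nhds (ball_mem_nhds z0 (half_pos hrp))]
      with x h1 h2 h3 using ⟨h1, h2, h3⟩
  obtain ⟨V, hVsub, hVo, hxV⟩ := _root_.mem_nhds_iff.1 hnear
  obtain ⟨x1, hx1V, hx1I⟩ := mem_closure_iff.1 hcl V hVo hxV
  have hx1 := hVsub hx1V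
  have hSz1 : S (Phi e u x1) = x1 := hx1.1
  have hev : ∀ᶠ z in 𝓝 (Phi e u x1), z ∈ ball z0 (r / 2) ∧ S z ∈ V ∩ interior {x | m x = u x} := by
    have cS : ContinuousAt S (Phi e u x1) :=
      a2.continuousAt (isOpen_ball.mem_nhds (hs1 (hhalf hx1.2.2)))
    have : V ∩ interior {x | m x = u x} ∈ 𝓝 (S (Phi e u x1)) := by
      rw [hSz1]; exact (hVo.inter isOpen_interior).mem_nhds ⟨hx1V, hx1I⟩
    filter_upwards [isOpen_ball.mem_nhds hx1.2.2, cS.preimage_mem_nhds this] with z h1 h2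
      using ⟨h1, h2⟩
  obtain ⟨ρ, hρ, hρsub⟩ := Metric.mem_nhds_iff.1 hev
  have hzero := log_uc (fun z hz => hσg z (hhalf hz)) (cSg.mono hhalf) (fun z hz => hσ0 z (hhalf hz))
    hC hρ (fun z hz => (hρsub hz).1) (by
      intro z hz
      obtain ⟨hzb, hzV, hzI⟩ := hρsub hz
      have h1 : Phi e u (S z) = z := (a1 z (hs1 (hhalf hzb))).2.2.1
      have h2 : m (S z) = u (S z) := by have := interior_subset hzI; exact this
      have h3 : Phi e m (S z) = z := by 
        have h5 : Phi e m (S z) = Phi e u (S z) := by unfold Phi; rw [h2]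
        rw [h5, h1]
      have h4 : T z = S z := by
        have := (hVsub hzV).2.1
        rwa [h3] at this
      simp only [σ, h4, sub_self])
  filter_upwards [hnear] with x hx
  have hz := hhalf hx.2.2
  have h1 : S (Phi e u x) = T (Phi e u x) := by
    rw [hdiff _ hz, hzero _ hx.2.2, zero_smul, add_zero]
  have h2 : T (Phi e u x) = x := h1.symm.trans hx.1
  have h3 := hmT _ hz
  rw [h2, Phi_inner he] at h3
  exact h3

end luc2
end

open Set Metric MeasureTheory Bornology
open scoped RealInnerProductSpace Classical Topology

noncomputable section

section base
variable {N : ℕ}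

/-- admissible competitors, with explicit gradient -/
structure Adm (R : ℝ) (v : Eu N → ℝ) (V : Eu N → Eu N) : Prop where
  c1 : ContDiffOn ℝ 1 v (closedBall 0 R)
  zero : ∀ x ∈ sphere (0 : Eu N) R, v x = 0
  nonneg : ∀ x ∈ ball (0 : Eu N) R, 0 ≤ v x
  grad : ∀ x ∈ ball (0 : Eu N) R, HasGradientAt v (V x) x

/-- explicit functional -/
def JJ (R : ℝ) (g f : ℝ → ℝ) (v : Eu N → ℝ) (V : Eu N → Eu N) : ℝ :=
  ∫ x in ball (0 : Eu N) R, (Gfun g ‖V x‖ - Gfun f (v x))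

/-- the data of the problem after normalisation -/
structure Base (R ε : ℝ) (g f : ℝ → ℝ) (u : Eu N → ℝ) (D : Eu N → Eu N) : Prop where
  Rpos : 0 < R
  epos : 0 < ε
  gd : Gd g
  fc : Continuous f
  uc : Continuous u
  dc : Continuous D
  adm : Adm R u D
  nonneg : ∀ x, 0 ≤ u x
  zero : ∀ x, R ≤ ‖x‖ → u x = 0
  mini : ∀ v V, Adm R v V → (∀ x ∈ ball (0 : Eu N) R, |v x - u x| + ‖V x - D x‖ < ε) →
    JJ R g f u D ≤ JJ R g f v V

theorem bdd_of_cont {h : ℝ → ℝ} (hh : Continuous h) (C : ℝ) : ∃ B, 0 ≤ B ∧ ∀ t, |t| ≤ C → |h t| ≤ B := by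
  obtain ⟨B, hB⟩ := (isCompact_Icc (a := -C) (b := C)).exists_bound_of_continuousOn hh.continuousOn
  refine ⟨max B 0, le_max_right _ _, fun t ht => ?_⟩
  exact (hB t (abs_le.1 ht)).trans (le_max_left _ _)

theorem dct_J {R : ℝ} {g f : ℝ → ℝ} (hg : Continuous g) (hf : Continuous f) {v : Eu N → ℝ} {V : Eu N → Eu N}
    {vn : ℕ → Eu N → ℝ} {Vn : ℕ → Eu N → Eu N} (hv : ∀ n, Measurable (vn n))
    (hV : ∀ n, Measurable (Vn n)) {C : ℝ} (hvC : ∀ n, ∀ x ∈ ball (0 : Eu N) R, |vn n x| ≤ C)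
    (hVC : ∀ n, ∀ x ∈ ball (0 : Eu N) R, ‖Vn n x‖ ≤ C)
    (lv : ∀ x ∈ ball (0 : Eu N) R, Filter.Tendsto (fun n => vn n x) Filter.atTop (𝓝 (v x)))
    (lV : ∀ x ∈ ball (0 : Eu N) R, Filter.Tendsto (fun n => Vn n x) Filter.atTop (𝓝 (V x))) :
    Filter.Tendsto (fun n => JJ R g f (vn n) (Vn n)) Filter.atTop (𝓝 (JJ R g f v V)) := by
  have cG := Gfun_cont hg
  have cF := Gfun_cont hf
  obtain ⟨B1, -, hB1⟩ := bdd_of_cont cG C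
  obtain ⟨B2, -, hB2⟩ := bdd_of_cont cF C
  unfold JJ
  apply tendsto_integral_of_dominated_convergence (fun _ => B1 + B2)
  · intro n
    apply Measurable.aestronglyMeasurable
    exact (cG.measurable.comp (hV n).norm).sub (cF.measurable.comp (hv n))
  · exact integrableOn_const (by finiteness)
  · intro n
    filter_upwards [ae_restrict_mem measurableSet_ball] with x hx
    refine (norm_sub_le _ _).trans (add_le_add ?_ ?_)
    · exact hB1 _ (by rw [abs_of_nonneg (norm_nonneg _)]; exact hVC n x hx)
    · exact hB2 _ (hvC n x hx)
  · filter_upwards [ae_restrict_mem measurableSet_ball] with x hx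
    exact ((cG.tendsto _).comp (lV x hx).norm).sub ((cF.tendsto _).comp (lv x hx))

/-- the integrand of the functional is integrable for bounded measurable data -/
theorem int_J {R : ℝ} {g f : ℝ → ℝ} (hg : Continuous g) (hf : Continuous f) {v : Eu N → ℝ} {V : Eu N → Eu N}
    (hv : Measurable v) (hV : Measurable V) {C : ℝ} (hvC : ∀ x ∈ ball (0 : Eu N) R, |v x| ≤ C)
    (hVC : ∀ x ∈ ball (0 : Eu N) R, ‖V x‖ ≤ C) :
    IntegrableOn (fun x => Gfun g ‖V x‖ - Gfun f (v x)) (ball (0 : Eu N) R) := by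
  have cG := Gfun_cont hg
  have cF := Gfun_cont hf
  obtain ⟨B1, -, hB1⟩ := bdd_of_cont cG C
  obtain ⟨B2, -, hB2⟩ := bdd_of_cont cF C
  refine Measure.integrableOn_of_bounded (M := B1 + B2) measure_ball_lt_top.ne
    ((cG.measurable.comp hV.norm).sub (cF.measurable.comp hv)).aestronglyMeasurable ?_
  filter_upwards [ae_restrict_mem measurableSet_ball] with x hx
  refine (norm_sub_le _ _).trans (add_le_add ?_ ?_)
  · exact hB1 _ (by rw [abs_of_nonneg (norm_nonneg _)]; exact hVC x hx)
  · exact hB2 _ (hvC x hx)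

/-- mean value bound for a primitive -/
theorem Gfun_lip {f : ℝ → ℝ} (hf : Continuous f) {C B : ℝ} (hB : ∀ t, |t| ≤ C → |f t| ≤ B) {a b : ℝ}
    (ha : |a| ≤ C) (hb : |b| ≤ C) : |Gfun f b - Gfun f a| ≤ B * |b - a| := by
  have := Convex.norm_image_sub_le_of_norm_hasDerivWithin_le (f := Gfun f) (f' := f)
    (s := Icc (-C) C) (C := B) (x := a) (y := b)
    (fun t _ => (Gfun_hasDerivAt hf t).hasDerivWithinAt) (fun t ht => hB t (abs_le.2 ht))
    (convex_Icc _ _) (abs_le.1 ha) (abs_le.1 hb)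
  exact this

/-- first variation -/
theorem first_var {R : ℝ} {g f : ℝ → ℝ} (hg : Gd g) (hf : Continuous f) {m ψ : Eu N → ℝ}
    {M P : Eu N → Eu N} (hm : Measurable m) (hM : Measurable M) (hψ : Continuous ψ) (hP : Continuous P)
    {C : ℝ} (hmC : ∀ x ∈ ball (0 : Eu N) R, |m x| ≤ C) (hMC : ∀ x ∈ ball (0 : Eu N) R, ‖M x‖ ≤ C)
    (hψC : ∀ x ∈ ball (0 : Eu N) R, |ψ x| ≤ C) (hPC : ∀ x ∈ ball (0 : Eu N) R, ‖P x‖ ≤ C)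
    {t0 : ℝ} (ht0 : 0 < t0)
    (hmin : ∀ t ∈ Ioo 0 t0, JJ R g f m M ≤ JJ R g f (fun x => m x + t * ψ x) (fun x => M x + t • P x)) :
    0 ≤ ∫ x in ball (0 : Eu N) R, (⟪gvec g (M x), P x⟫ - f (m x) * ψ x) := by
  let tn : ℕ → ℝ := fun n => min t0 1 / (n + 2)
  have htp : ∀ n, 0 < tn n := fun n => div_pos (lt_min ht0 one_pos) (by positivity)
  have htl : ∀ n, tn n < min t0 1 := fun n => by
    have h1 := lt_min ht0 one_pos
    apply div_lt_self h1
    have : (0:ℝ) ≤ n := Nat.cast_nonneg n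
    linarith
  have htt : Filter.Tendsto tn Filter.atTop (𝓝 0) := by
    apply Filter.Tendsto.div_atTop tendsto_const_nhds
    exact Filter.tendsto_atTop_add_const_right _ _ tendsto_natCast_atTop_atTop
  have ht1 : ∀ n, tn n < 1 := fun n => (htl n).trans_le (min_le_right _ _)
  have htt0 : ∀ n, tn n < t0 := fun n => (htl n).trans_le (min_le_left _ _)
  obtain ⟨B1, -, hB1⟩ := bdd_of_cont hg.cont (2 * C)
  obtain ⟨B2, hB20, hB2⟩ := bdd_of_cont hf (2 * C)
  have hC0 : ∀ x ∈ ball (0 : Eu N) R, 0 ≤ C := fun x hx => (abs_nonneg _).trans (hmC x hx)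
  have bM : ∀ n, ∀ x ∈ ball (0 : Eu N) R, ‖M x + tn n • P x‖ ≤ 2 * C := by
    intro n x hx
    have := hC0 x hx
    calc _ ≤ ‖M x‖ + ‖tn n • P x‖ := norm_add_le _ _
      _ ≤ C + 1 * C := by
        rw [norm_smul, Real.norm_eq_abs, abs_of_pos (htp n)]
        exact add_le_add (hMC x hx) (mul_le_mul (ht1 n).le (hPC x hx) (norm_nonneg _) zero_le_one)
      _ = _ := by ring
  have bm : ∀ n, ∀ x ∈ ball (0 : Eu N) R, |m x + tn n * ψ x| ≤ 2 * C := by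
    intro n x hx
    have := hC0 x hx
    calc _ ≤ |m x| + |tn n * ψ x| := abs_add_le _ _
      _ ≤ C + 1 * C := by
        rw [abs_mul, abs_of_pos (htp n)]
        exact add_le_add (hmC x hx) (mul_le_mul (ht1 n).le (hψC x hx) (abs_nonneg _) zero_le_one)
      _ = _ := by ring
  have bm0 : ∀ x ∈ ball (0 : Eu N) R, |m x| ≤ 2 * C := fun x hx => by
    have := hC0 x hx; have := hmC x hx; linarith
  have bM0 : ∀ x ∈ ball (0 : Eu N) R, ‖M x‖ ≤ 2 * C := fun x hx => by
    have := hC0 x hx; have := hMC x hx; linarith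
  let q : ℕ → Eu N → ℝ := fun n x => ⟪gvec g (M x + tn n • P x), P x⟫ -
    (Gfun f (m x + tn n * ψ x) - Gfun f (m x)) / tn n
  have mA : ∀ n, Measurable (fun x => M x + tn n • P x) := fun n =>
    hM.add (hP.measurable.const_smul (tn n))
  have ma : ∀ n, Measurable (fun x => m x + tn n * ψ x) := fun n =>
    hm.add (hψ.measurable.const_mul (tn n))
  have cF := Gfun_cont hf
  have mq : ∀ n, Measurable (q n) := fun n =>
    (((gvec_cont hg).measurable.comp (mA n)).inner hP.measurable).sub
      (((cF.measurable.comp (ma n)).sub (cF.measurable.comp hm)).div_const _)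
  have bq : ∀ n, ∀ x ∈ ball (0 : Eu N) R, ‖q n x‖ ≤ B1 * C + B2 * C := by
    intro n x hx
    have hC := hC0 x hx
    refine (norm_sub_le _ _).trans (add_le_add ?_ ?_)
    · refine (abs_real_inner_le_norm _ _).trans ?_
      rw [gvec_norm hg]
      have h1 := hB1 ‖M x + tn n • P x‖ (by rw [abs_of_nonneg (norm_nonneg _)]; exact bM n x hx)
      exact mul_le_mul ((le_abs_self _).trans h1) (hPC x hx) (norm_nonneg _) ((abs_nonneg _).trans h1)
    · rw [norm_div, Real.norm_eq_abs, Real.norm_eq_abs, abs_of_pos (htp n), div_le_iff₀ (htp n)]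
      have h1 := Gfun_lip hf hB2 (bm0 x hx) (bm n x hx)
      rw [add_sub_cancel_left, abs_mul, abs_of_pos (htp n)] at h1
      refine h1.trans ?_
      have h2 := mul_le_mul_of_nonneg_left (hψC x hx) (mul_nonneg hB20 (htp n).le)
      linarith
  have hpos : ∀ n, 0 ≤ ∫ x in ball (0 : Eu N) R, q n x := by
    intro n
    have i1 := int_J hg.cont hf (ma n) (mA n) (bm n) (bM n)
    have i0 := int_J hg.cont hf hm hM bm0 bM0
    have h1 := hmin (tn n) ⟨htp n, htt0 n⟩
    unfold JJ at h1
    have iq : IntegrableOn (q n) (ball (0 : Eu N) R) :=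
      Measure.integrableOn_of_bounded measure_ball_lt_top.ne (mq n).aestronglyMeasurable
        (by filter_upwards [ae_restrict_mem measurableSet_ball] with x hx using bq n x hx)
    have h2 : ∫ x in ball (0 : Eu N) R, ((Gfun g ‖M x + tn n • P x‖ - Gfun f (m x + tn n * ψ x)) -
        (Gfun g ‖M x‖ - Gfun f (m x))) ≤ ∫ x in ball (0 : Eu N) R, tn n * q n x := by
      apply integral_mono (i1.sub i0) (iq.const_mul _)
      intro x
      have h3 := gvec_convex hg (M x + tn n • P x) (M x)
      have e1 : M x - (M x + tn n • P x) = -(tn n • P x) := by abel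
      rw [e1, inner_neg_right, real_inner_smul_right] at h3
      show Gfun g ‖M x + tn n • P x‖ - Gfun f (m x + tn n * ψ x) -
        (Gfun g ‖M x‖ - Gfun f (m x)) ≤ tn n * (⟪gvec g (M x + tn n • P x), P x⟫ -
          (Gfun f (m x + tn n * ψ x) - Gfun f (m x)) / tn n)
      rw [mul_sub, mul_div_cancel₀ _ (htp n).ne']
      linarith
    rw [integral_sub i1 i0, integral_const_mul] at h2
    exact nonneg_of_mul_nonneg_right (by linarith) (htp n)
  have hlim : Filter.Tendsto (fun n => ∫ x in ball (0 : Eu N) R, q n x) Filter.atTop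
      (𝓝 (∫ x in ball (0 : Eu N) R, (⟪gvec g (M x), P x⟫ - f (m x) * ψ x))) := by
    apply tendsto_integral_of_dominated_convergence (fun _ => B1 * C + B2 * C)
    · exact fun n => (mq n).aestronglyMeasurable
    · exact integrableOn_const (by finiteness)
    · intro n
      filter_upwards [ae_restrict_mem measurableSet_ball] with x hx using bq n x hx
    · refine Filter.Eventually.of_forall fun x => ?_
      apply Filter.Tendsto.sub
      · have l1 : Filter.Tendsto (fun n => M x + tn n • P x) Filter.atTop (𝓝 (M x + (0:ℝ) • P x)) :=
          tendsto_const_nhds.add (htt.smul_const (P x))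
        rw [zero_smul, add_zero] at l1
        exact (((gvec_cont hg).tendsto _).comp l1).inner tendsto_const_nhds
      · have d1 : HasDerivAt (fun t => Gfun f (m x + t * ψ x)) (f (m x) * ψ x) 0 := by
          have h1 : HasDerivAt (fun t : ℝ => m x + t * ψ x) (ψ x) 0 := by
            simpa using ((hasDerivAt_id (0:ℝ)).mul_const (ψ x)).const_add (m x)
          have h2 : HasDerivAt (Gfun f) (f (m x)) (m x + 0 * ψ x) := by
            have := Gfun_hasDerivAt hf (m x + 0 * ψ x)
            rw [zero_mul, add_zero] at this ⊢
            exact this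
          exact HasDerivAt.comp (0:ℝ) h2 h1
        have l2 := d1.tendsto_slope_zero_right
        have l3 : Filter.Tendsto tn Filter.atTop (𝓝[>] 0) :=
          tendsto_nhdsWithin_iff.2 ⟨htt, Filter.Eventually.of_forall htp⟩
        have l4 := l2.comp l3
        refine l4.congr fun n => ?_
        simp [div_eq_inv_mul]
  exact ge_of_tendsto' hlim hpos

end base
end

open Set Metric MeasureTheory Bornology
open scoped RealInnerProductSpace Classical Topology

noncomputable section

/-- ramp function -/
def qq (η s : ℝ) : ℝ := min 1 (max 0 (s / η))

theorem qq_cont (η : ℝ) : Continuous (qq η) := by unfold qq; fun_prop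
theorem qq_nonneg (η s : ℝ) : 0 ≤ qq η s := le_min zero_le_one (le_max_left _ _)
theorem qq_le (η s : ℝ) : qq η s ≤ 1 := min_le_left _ _
theorem qq_neg {η s : ℝ} (hη : 0 < η) (hs : s ≤ 0) : qq η s = 0 := by
  unfold qq
  rw [max_eq_left (div_nonpos_of_nonpos_of_nonneg hs hη.le), min_eq_right zero_le_one]
theorem qq_big {η s : ℝ} (hη : 0 < η) (hs : η ≤ s) : qq η s = 1 := by
  unfold qq
  have h1 : 1 ≤ s / η := (one_le_div hη).2 hs
  rw [max_eq_right (by linarith), min_eq_left h1]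

theorem PP_neg {η t : ℝ} (hη : 0 < η) (ht : t ≤ 0) : Gfun (qq η) t = 0 := by
  unfold Gfun
  rw [intervalIntegral.integral_congr (g := fun _ => (0:ℝ)), intervalIntegral.integral_zero]
  intro s hs
  rw [uIcc_of_ge ht] at hs
  exact qq_neg hη hs.2

theorem PP_nonneg {η : ℝ} (hη : 0 < η) (t : ℝ) : 0 ≤ Gfun (qq η) t := by
  rcases le_total t 0 with h | h
  · rw [PP_neg hη h]
  · exact intervalIntegral.integral_nonneg h (fun s _ => qq_nonneg η s)

theorem PP_le {η : ℝ} (hη : 0 < η) (t : ℝ) : Gfun (qq η) t ≤ max t 0 := by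
  rcases le_total t 0 with h | h
  · rw [PP_neg hη h]; exact le_max_right _ _
  · rw [max_eq_left h]
    have := intervalIntegral.integral_mono_on (μ := volume) (f := qq η) (g := fun _ => (1:ℝ)) h
      ((qq_cont η).intervalIntegrable _ _) (by simp) (fun s _ => qq_le η s)
    simpa [Gfun] using this

theorem PP_ge {η : ℝ} (hη : 0 < η) (t : ℝ) : max t 0 - η ≤ Gfun (qq η) t := by
  rcases le_total t η with h | h
  · have : max t 0 ≤ η := max_le h hη.le
    have := PP_nonneg hη t
    linarith
  · have h1 : Gfun (qq η) t - Gfun (qq η) η = t - η := by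
      unfold Gfun
      rw [intervalIntegral.integral_interval_sub_left ((qq_cont η).intervalIntegrable _ _)
        ((qq_cont η).intervalIntegrable _ _),
        intervalIntegral.integral_congr (g := fun _ => (1:ℝ))]
      · simp
      · intro s hs
        rw [uIcc_of_le h] at hs
        exact qq_big hη hs.1
    have := PP_nonneg hη η
    rw [max_eq_left (hη.le.trans h)]
    linarith

theorem PP_lim (t : ℝ) : Filter.Tendsto (fun n : ℕ => Gfun (qq (1 / ((n:ℝ) + 1))) t) Filter.atTop
    (𝓝 (max t 0)) := by
  have h1 : Filter.Tendsto (fun n : ℕ => max t 0 - 1 / ((n:ℝ) + 1)) Filter.atTop (𝓝 (max t 0 - 0)) :=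
    tendsto_const_nhds.sub tendsto_one_div_add_atTop_nhds_zero_nat
  rw [sub_zero] at h1
  exact tendsto_of_tendsto_of_tendsto_of_le_of_le h1 tendsto_const_nhds
    (fun n => PP_ge Nat.one_div_pos_of_nat t) (fun n => PP_le Nat.one_div_pos_of_nat t)

theorem qq_lim (t : ℝ) : Filter.Tendsto (fun n : ℕ => qq (1 / ((n:ℝ) + 1)) t) Filter.atTop
    (𝓝 (if 0 < t then 1 else 0)) := by
  split_ifs with h
  · apply tendsto_const_nhds.congr'
    have h1 := (tendsto_one_div_add_atTop_nhds_zero_nat (𝕜 := ℝ)).eventually (ge_mem_nhds h)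
    filter_upwards [h1] with n hn
    exact (qq_big Nat.one_div_pos_of_nat hn).symm
  · apply tendsto_const_nhds.congr
    intro n
    exact (qq_neg Nat.one_div_pos_of_nat (not_lt.1 h)).symm

theorem PP_contDiff (η : ℝ) : ContDiff ℝ 1 (Gfun (qq η)) := by
  rw [contDiff_one_iff_deriv]
  refine ⟨fun t => (Gfun_hasDerivAt (qq_cont η) t).differentiableAt, ?_⟩
  have : deriv (Gfun (qq η)) = qq η := funext fun t => (Gfun_hasDerivAt (qq_cont η) t).deriv
  rw [this]; exact qq_cont η

section stepB
variable {N : ℕ} {R ε : ℝ} {g f : ℝ → ℝ} {u : Eu N → ℝ} {D : Eu N → Eu N}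

/-- rotated gradient -/
def rotD (ρ : Eu N ≃ₗᵢ[ℝ] Eu N) (D : Eu N → Eu N) (x : Eu N) : Eu N := ρ.symm (D (ρ x))

theorem rotD_cont (ρ : Eu N ≃ₗᵢ[ℝ] Eu N) (hD : Continuous D) : Continuous (rotD ρ D) :=
  ρ.symm.continuous.comp (hD.comp ρ.continuous)

theorem hgr_rot (ρ : Eu N ≃ₗᵢ[ℝ] Eu N) {x : Eu N} (h : HasGradientAt u (D (ρ x)) (ρ x)) :
    HasGradientAt (fun y => u (ρ y)) (rotD ρ D x) x := by
  have h1 : HasFDerivAt (fun y => ρ y) ((ρ : Eu N ≃L[ℝ] Eu N) : Eu N →L[ℝ] Eu N) x :=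
    ((ρ : Eu N ≃L[ℝ] Eu N) : Eu N →L[ℝ] Eu N).hasFDerivAt
  have h2 := hgr_fcomp (u := u) h1 h
  have h3 : ContinuousLinearMap.adjoint ((ρ : Eu N ≃L[ℝ] Eu N) : Eu N →L[ℝ] Eu N) (D (ρ x)) = rotD ρ D x := by
    rw [LinearIsometryEquiv.adjoint_eq_symm]; rfl
  rw [h3] at h2
  exact h2

theorem rot_ball (ρ : Eu N ≃ₗᵢ[ℝ] Eu N) {x : Eu N} : ρ x ∈ ball (0 : Eu N) R ↔ x ∈ ball (0 : Eu N) R := by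
  simp

theorem adm_rot (h : Adm R u D) (ρ : Eu N ≃ₗᵢ[ℝ] Eu N) : Adm R (fun x => u (ρ x)) (rotD ρ D) where
  c1 := by
    apply h.c1.comp (ρ.contDiff.contDiffOn)
    intro x hx
    simpa using hx
  zero := fun x hx => h.zero _ (by simpa using hx)
  nonneg := fun x hx => h.nonneg _ (by simpa using hx)
  grad := fun x hx => hgr_rot ρ (h.grad _ (by simpa using hx))

theorem JJ_rot (ρ : Eu N ≃ₗᵢ[ℝ] Eu N) : JJ R g f (fun x => u (ρ x)) (rotD ρ D) = JJ R g f u D := by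
  unfold JJ
  have h1 := (ρ.measurePreserving).setIntegral_preimage_emb ρ.toHomeomorph.measurableEmbedding
    (fun x => Gfun g ‖D x‖ - Gfun f (u x)) (ball (0 : Eu N) R)
  have h2 : ρ ⁻¹' ball (0 : Eu N) R = ball (0 : Eu N) R := by ext x; simp
  rw [h2] at h1
  rw [← h1]
  congr 1
  ext x
  simp [rotD]

/-- the gradient of the maximum -/
def mD (ρ : Eu N ≃ₗᵢ[ℝ] Eu N) (u : Eu N → ℝ) (D : Eu N → Eu N) (x : Eu N) : Eu N :=
  if 0 < u (ρ x) - u x then rotD ρ D x else D x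

/-- the maximum -/
def mU (ρ : Eu N ≃ₗᵢ[ℝ] Eu N) (u : Eu N → ℝ) (x : Eu N) : ℝ := u x + max (u (ρ x) - u x) 0

/-- the smallness condition on a rotation -/
def SmallR (R ε : ℝ) (u : Eu N → ℝ) (D : Eu N → Eu N) (ρ : Eu N ≃ₗᵢ[ℝ] Eu N) : Prop :=
  ∀ x ∈ ball (0 : Eu N) R, |u (ρ x) - u x| + ‖rotD ρ D x - D x‖ ≤ ε / 2

/-- the positivity set -/
def OO (R : ℝ) (u : Eu N → ℝ) : Set (Eu N) := ball 0 R ∩ {x | 0 < u x}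

theorem OO_open (hu : Continuous u) : IsOpen (OO R u) :=
  isOpen_ball.inter (isOpen_lt continuous_const hu)

theorem exists_bd {E : Type*} [NormedAddCommGroup E] {F : Eu N → E} (hF : Continuous F) (R : ℝ) :
    ∃ C, 0 ≤ C ∧ ∀ x ∈ ball (0 : Eu N) R, ‖F x‖ ≤ C := by
  obtain ⟨C, hC⟩ := (isCompact_closedBall (0 : Eu N) R).exists_bound_of_continuousOn hF.continuousOn
  exact ⟨max C 0, le_max_right _ _, fun x hx => (hC x (ball_subset_closedBall hx)).trans (le_max_left _ _)⟩

theorem Base.up (hb : Base R ε g f u D) {ρ : Eu N ≃ₗᵢ[ℝ] Eu N} (hρ : SmallR R ε u D ρ)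
    {ψ : Eu N → ℝ} {P : Eu N → Eu N} (hψ : Tst (OO R u) ψ P) :
    ∃ t0 > 0, ∀ t, |t| < t0 → JJ R g f u D ≤ JJ R g f (fun x => mU ρ u x + t * ψ x) (fun x => mD ρ u D x + t • P x) := by
  obtain ⟨K, hK, hKO, h0⟩ := hψ.supp
  obtain ⟨c, hc, huc⟩ : ∃ c > 0, ∀ x ∈ K, c ≤ u x := by
    rcases K.eq_empty_or_nonempty with rfl | hne
    · exact ⟨1, one_pos, fun x hx => hx.elim⟩
    · obtain ⟨x, hx, hmin⟩ := hK.exists_isMinOn hne hb.uc.continuousOn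
      exact ⟨u x, (hKO hx).2, fun y hy => hmin hy⟩
  have cψ : Continuous ψ := hψ.ucont
  have cP : Continuous P := hψ.cont
  obtain ⟨C1, hC1, b1⟩ := exists_bd cψ R
  obtain ⟨C2, hC2, b2⟩ := exists_bd cP R
  obtain ⟨C3, hC3, b3⟩ := exists_bd hb.uc R
  obtain ⟨C4, hC4, b4⟩ := exists_bd hb.dc R
  have crD : Continuous (rotD ρ D) := rotD_cont ρ hb.dc
  have cru : Continuous (fun x => u (ρ x)) := hb.uc.comp ρ.continuous
  have cw : Continuous (fun x => u (ρ x) - u x) := cru.sub hb.uc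
  have cB : Continuous (fun x => rotD ρ D x - D x) := crD.sub hb.dc
  have ep := hb.epos
  refine ⟨min (c / (C1 + 1)) (min ((ε / 2) / (C1 + C2 + 1)) 1),
    lt_min (by positivity) (lt_min (by positivity) one_pos), fun t ht => ?_⟩
  have ht1 : |t| * C1 ≤ c := by
    have h1 := (lt_min_iff.1 ht).1
    rw [lt_div_iff₀ (by positivity)] at h1
    nlinarith [abs_nonneg t]
  have ht2 : |t| * (C1 + C2) < ε / 2 := by
    have h1 := (lt_min_iff.1 (lt_min_iff.1 ht).2).1
    rw [lt_div_iff₀ (by positivity)] at h1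
    nlinarith [abs_nonneg t]
  have ht3 : |t| ≤ 1 := (lt_min_iff.1 (lt_min_iff.1 ht).2).2.le
  let e : ℕ → ℝ := fun n => 1 / ((n:ℝ) + 1)
  have he : ∀ n, 0 < e n := fun n => Nat.one_div_pos_of_nat
  let vn : ℕ → Eu N → ℝ := fun n x => (u x + Gfun (qq (e n)) (u (ρ x) - u x)) + t * ψ x
  let Vn : ℕ → Eu N → Eu N := fun n x => (D x + qq (e n) (u (ρ x) - u x) • (rotD ρ D x - D x)) + t • P x
  have abs1 : ∀ n x, |Gfun (qq (e n)) (u (ρ x) - u x)| ≤ |u (ρ x) - u x| := fun n x => by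
    rw [abs_of_nonneg (PP_nonneg (he n) _)]
    exact (PP_le (he n) _).trans (max_le (le_abs_self _) (abs_nonneg _))
  have abs2 : ∀ n x, ‖qq (e n) (u (ρ x) - u x) • (rotD ρ D x - D x)‖ ≤ ‖rotD ρ D x - D x‖ := fun n x => by
    rw [norm_smul, Real.norm_eq_abs, abs_of_nonneg (qq_nonneg _ _)]
    exact mul_le_of_le_one_left (norm_nonneg _) (qq_le _ _)
  have abs3 : ∀ x ∈ ball (0 : Eu N) R, |t * ψ x| ≤ |t| * C1 := fun x hx => by
    rw [abs_mul]; exact mul_le_mul_of_nonneg_left (b1 x hx) (abs_nonneg _)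
  have abs4 : ∀ x ∈ ball (0 : Eu N) R, ‖t • P x‖ ≤ |t| * C2 := fun x hx => by
    rw [norm_smul]; exact mul_le_mul_of_nonneg_left (b2 x hx) (abs_nonneg _)
  have hadm : ∀ n, Adm R (vn n) (Vn n) := by
    intro n
    have ar := adm_rot hb.adm ρ
    have cc1 : ContDiff ℝ 1 ψ := by
      rw [contDiff_one_iff_fderiv]
      refine ⟨fun x => (hgr_fd.1 (hψ.grad x)).differentiableAt, ?_⟩
      have : fderiv ℝ ψ = fun x => innerSL ℝ (P x) := funext fun x => (hgr_fd.1 (hψ.grad x)).fderiv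
      rw [this]; exact (innerSL ℝ).continuous.comp cP
    refine ⟨?_, ?_, ?_, ?_⟩
    · have h1 : ContDiffOn ℝ 1 (fun x => u (ρ x) - u x) (closedBall 0 R) := ar.c1.sub hb.adm.c1
      have h2 : ContDiffOn ℝ 1 (fun x => Gfun (qq (e n)) (u (ρ x) - u x)) (closedBall 0 R) :=
        (PP_contDiff (e n)).comp_contDiffOn h1
      exact (hb.adm.c1.add h2).add (contDiffOn_const.mul cc1.contDiffOn)
    · intro x hx
      have h1 : ψ x = 0 := h0.1 x (fun hxK => by
        have := (hKO hxK).1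
        rw [mem_sphere] at hx; rw [mem_ball] at this; linarith) 
      show u x + Gfun (qq (e n)) (u (ρ x) - u x) + t * ψ x = 0
      rw [h1, ar.zero x hx, hb.adm.zero x hx, sub_zero, PP_neg (he n) le_rfl]; ring
    · intro x hx
      show 0 ≤ u x + Gfun (qq (e n)) (u (ρ x) - u x) + t * ψ x
      have h1 := PP_nonneg (he n) (u (ρ x) - u x)
      by_cases hxK : x ∈ K
      · have h2 := huc x hxK
        have h3 := (abs_le.1 ((abs3 x hx).trans ht1)).1
        linarith
      · rw [h0.1 x hxK]
        have := hb.nonneg x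
        linarith
    · intro x hx
      have h1 : HasGradientAt (fun x => u (ρ x) - u x) (rotD ρ D x - D x) x :=
        hgr_sub (ar.grad x hx) (hb.adm.grad x hx)
      have h2 := hgr_comp (φ := Gfun (qq (e n))) (Gfun_hasDerivAt (qq_cont (e n)) (u (ρ x) - u x)) h1
      exact hgr_add (hgr_add (hb.adm.grad x hx) h2) (hgr_cmul t (hψ.grad x))
  have hJ : ∀ n, JJ R g f u D ≤ JJ R g f (vn n) (Vn n) := by
    intro n
    apply hb.mini _ _ (hadm n)
    intro x hx
    have e1 : vn n x - u x = Gfun (qq (e n)) (u (ρ x) - u x) + t * ψ x := by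
      show u x + Gfun (qq (e n)) (u (ρ x) - u x) + t * ψ x - u x = _
      ring
    have e2 : Vn n x - D x = qq (e n) (u (ρ x) - u x) • (rotD ρ D x - D x) + t • P x := by
      show D x + qq (e n) (u (ρ x) - u x) • (rotD ρ D x - D x) + t • P x - D x = _
      abel
    rw [e1, e2]
    have i1 := abs_add_le (Gfun (qq (e n)) (u (ρ x) - u x)) (t * ψ x)
    have i2 := norm_add_le (qq (e n) (u (ρ x) - u x) • (rotD ρ D x - D x)) (t • P x)
    have i3 := hρ x hx
    have := abs1 n x
    have := abs2 n x
    have := abs3 x hx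
    have := abs4 x hx
    linarith
  have cq : ∀ n, Continuous (fun x => qq (e n) (u (ρ x) - u x)) := fun n => (qq_cont (e n)).comp cw
  have cp : ∀ n, Continuous (fun x => Gfun (qq (e n)) (u (ρ x) - u x)) := fun n =>
    (Gfun_cont (qq_cont (e n))).comp cw
  have cvn : ∀ n, Continuous (vn n) := fun n => (hb.uc.add (cp n)).add (continuous_const.mul cψ)
  have cVn : ∀ n, Continuous (Vn n) := fun n => (hb.dc.add ((cq n).smul cB)).add (cP.const_smul t)
  have lim := dct_J (R := R) (g := g) (f := f) hb.gd.cont hb.fc (v := fun x => mU ρ u x + t * ψ x)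
    (V := fun x => mD ρ u D x + t • P x) (vn := vn) (Vn := Vn) (fun n => (cvn n).measurable)
    (fun n => (cVn n).measurable) (C := C3 + C4 + ε / 2 + |t| * (C1 + C2)) ?_ ?_ ?_ ?_
  · exact ge_of_tendsto' lim hJ
  · intro n x hx
    have i1 := abs_add_le (u x + Gfun (qq (e n)) (u (ρ x) - u x)) (t * ψ x)
    have i2 := abs_add_le (u x) (Gfun (qq (e n)) (u (ρ x) - u x))
    have i3 := hρ x hx
    have := abs1 n x
    have := abs3 x hx
    have i4 : |u x| ≤ C3 := b3 x hx
    have := norm_nonneg (rotD ρ D x - D x)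
    have := mul_nonneg (abs_nonneg t) hC2
    show |u x + Gfun (qq (e n)) (u (ρ x) - u x) + t * ψ x| ≤ _
    linarith
  · intro n x hx
    have i1 := norm_add_le (D x + qq (e n) (u (ρ x) - u x) • (rotD ρ D x - D x)) (t • P x)
    have i2 := norm_add_le (D x) (qq (e n) (u (ρ x) - u x) • (rotD ρ D x - D x))
    have i3 := hρ x hx
    have := abs2 n x
    have := abs4 x hx
    have i4 : ‖D x‖ ≤ C4 := b4 x hx
    have := abs_nonneg (u (ρ x) - u x)
    have := mul_nonneg (abs_nonneg t) hC1
    show ‖D x + qq (e n) (u (ρ x) - u x) • (rotD ρ D x - D x) + t • P x‖ ≤ _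
    linarith
  · intro x hx
    exact (tendsto_const_nhds.add (PP_lim _)).add tendsto_const_nhds
  · intro x hx
    have l1 := ((qq_lim (u (ρ x) - u x)).smul_const (rotD ρ D x - D x)).const_add (D x)
    have l2 := l1.add_const (t • P x)
    have e1 : D x + (if 0 < u (ρ x) - u x then (1:ℝ) else 0) • (rotD ρ D x - D x) = mD ρ u D x := by
      unfold mD; split_ifs <;> simp
    rw [e1] at l2
    exact l2

theorem Base.down (hb : Base R ε g f u D) {ρ : Eu N ≃ₗᵢ[ℝ] Eu N} (hρ : SmallR R ε u D ρ) :
    JJ R g f u D ≤ JJ R g f (fun x => u (ρ x) - max (u (ρ x) - u x) 0)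
      (fun x => if 0 < u (ρ x) - u x then D x else rotD ρ D x) := by
  obtain ⟨C3, hC3, b3⟩ := exists_bd hb.uc R
  obtain ⟨C4, hC4, b4⟩ := exists_bd hb.dc R
  have crD : Continuous (rotD ρ D) := rotD_cont ρ hb.dc
  have cru : Continuous (fun x => u (ρ x)) := hb.uc.comp ρ.continuous
  have cw : Continuous (fun x => u (ρ x) - u x) := cru.sub hb.uc
  have cB : Continuous (fun x => rotD ρ D x - D x) := crD.sub hb.dc
  have ep := hb.epos
  let e : ℕ → ℝ := fun n => 1 / ((n:ℝ) + 1)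
  have he : ∀ n, 0 < e n := fun n => Nat.one_div_pos_of_nat
  let vn : ℕ → Eu N → ℝ := fun n x => u (ρ x) - Gfun (qq (e n)) (u (ρ x) - u x)
  let Vn : ℕ → Eu N → Eu N := fun n x => rotD ρ D x - qq (e n) (u (ρ x) - u x) • (rotD ρ D x - D x)
  have abs1 : ∀ n x, |vn n x - u x| ≤ |u (ρ x) - u x| := fun n x => by
    have h1 := PP_nonneg (he n) (u (ρ x) - u x)
    have h2 := PP_le (he n) (u (ρ x) - u x)
    show |u (ρ x) - Gfun (qq (e n)) (u (ρ x) - u x) - u x| ≤ _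
    rcases le_total (u (ρ x) - u x) 0 with h | h
    · rw [PP_neg (he n) h, sub_zero]
    · rw [max_eq_left h] at h2
      rw [abs_of_nonneg h, abs_of_nonneg (by linarith)]
      linarith
  have e2 : ∀ n x, Vn n x - D x = (1 - qq (e n) (u (ρ x) - u x)) • (rotD ρ D x - D x) := fun n x => by
    show rotD ρ D x - qq (e n) (u (ρ x) - u x) • (rotD ρ D x - D x) - D x = _
    rw [sub_smul, one_smul]; abel
  have abs2 : ∀ n x, ‖Vn n x - D x‖ ≤ ‖rotD ρ D x - D x‖ := fun n x => by
    rw [e2, norm_smul, Real.norm_eq_abs, abs_of_nonneg (sub_nonneg.2 (qq_le _ _))]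
    exact mul_le_of_le_one_left (norm_nonneg _) (by linarith [qq_nonneg (e n) (u (ρ x) - u x)])
  have hadm : ∀ n, Adm R (vn n) (Vn n) := by
    intro n
    have ar := adm_rot hb.adm ρ
    refine ⟨?_, ?_, ?_, ?_⟩
    · have h1 : ContDiffOn ℝ 1 (fun x => u (ρ x) - u x) (closedBall 0 R) := ar.c1.sub hb.adm.c1
      have h2 : ContDiffOn ℝ 1 (fun x => Gfun (qq (e n)) (u (ρ x) - u x)) (closedBall 0 R) :=
        (PP_contDiff (e n)).comp_contDiffOn h1
      exact ar.c1.sub h2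
    · intro x hx
      show u (ρ x) - Gfun (qq (e n)) (u (ρ x) - u x) = 0
      rw [ar.zero x hx, hb.adm.zero x hx, sub_zero, PP_neg (he n) le_rfl, sub_zero]
    · intro x hx
      show 0 ≤ u (ρ x) - Gfun (qq (e n)) (u (ρ x) - u x)
      have h1 := PP_le (he n) (u (ρ x) - u x)
      have h2 := hb.nonneg x
      have h3 := hb.nonneg (ρ x)
      rcases le_total (u (ρ x) - u x) 0 with h | h
      · rw [max_eq_right h] at h1; linarith
      · rw [max_eq_left h] at h1; linarith
    · intro x hx
      have h1 : HasGradientAt (fun x => u (ρ x) - u x) (rotD ρ D x - D x) x :=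
        hgr_sub (ar.grad x hx) (hb.adm.grad x hx)
      have h2 := hgr_comp (φ := Gfun (qq (e n))) (Gfun_hasDerivAt (qq_cont (e n)) (u (ρ x) - u x)) h1
      exact hgr_sub (ar.grad x hx) h2
  have hJ : ∀ n, JJ R g f u D ≤ JJ R g f (vn n) (Vn n) := by
    intro n
    apply hb.mini _ _ (hadm n)
    intro x hx
    have i3 := hρ x hx
    have := abs1 n x
    have := abs2 n x
    linarith
  have cq : ∀ n, Continuous (fun x => qq (e n) (u (ρ x) - u x)) := fun n => (qq_cont (e n)).comp cw
  have cp : ∀ n, Continuous (fun x => Gfun (qq (e n)) (u (ρ x) - u x)) := fun n =>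
    (Gfun_cont (qq_cont (e n))).comp cw
  have cvn : ∀ n, Continuous (vn n) := fun n => cru.sub (cp n)
  have cVn : ∀ n, Continuous (Vn n) := fun n => crD.sub ((cq n).smul cB)
  have lim := dct_J (R := R) (g := g) (f := f) hb.gd.cont hb.fc (v := fun x => u (ρ x) - max (u (ρ x) - u x) 0)
    (V := fun x => if 0 < u (ρ x) - u x then D x else rotD ρ D x) (vn := vn) (Vn := Vn) (fun n => (cvn n).measurable)
    (fun n => (cVn n).measurable) (C := C3 + C4 + ε / 2) ?_ ?_ ?_ ?_
  · exact ge_of_tendsto' lim hJ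
  · intro n x hx
    have i3 := hρ x hx
    have := abs1 n x
    have i4 : |u x| ≤ C3 := b3 x hx
    have := norm_nonneg (rotD ρ D x - D x)
    have i1 := abs_add_le (vn n x - u x) (u x)
    rw [sub_add_cancel] at i1
    linarith
  · intro n x hx
    have i3 := hρ x hx
    have := abs2 n x
    have i4 : ‖D x‖ ≤ C4 := b4 x hx
    have := abs_nonneg (u (ρ x) - u x)
    have i1 := norm_add_le (Vn n x - D x) (D x)
    rw [sub_add_cancel] at i1
    linarith
  · intro x hx
    exact tendsto_const_nhds.sub (PP_lim _)
  · intro x hx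
    have l1 := ((qq_lim (u (ρ x) - u x)).smul_const (rotD ρ D x - D x)).const_sub (rotD ρ D x)
    have e1 : rotD ρ D x - (if 0 < u (ρ x) - u x then (1:ℝ) else 0) • (rotD ρ D x - D x) = 
        if 0 < u (ρ x) - u x then D x else rotD ρ D x := by
      split_ifs <;> simp
    rw [e1] at l1
    exact l1

theorem mU_cont (hu : Continuous u) (ρ : Eu N ≃ₗᵢ[ℝ] Eu N) : Continuous (mU ρ u) := by
  have cru : Continuous (fun x => u (ρ x)) := hu.comp ρ.continuous
  exact hu.add ((cru.sub hu).max continuous_const)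

theorem mD_meas (hu : Continuous u) (hD : Continuous D) (ρ : Eu N ≃ₗᵢ[ℝ] Eu N) : Measurable (mD ρ u D) := by
  have cru : Continuous (fun x => u (ρ x)) := hu.comp ρ.continuous
  exact Measurable.ite (isOpen_lt continuous_const (cru.sub hu)).measurableSet
    (rotD_cont ρ hD).measurable hD.measurable

theorem mU_eq (ρ : Eu N ≃ₗᵢ[ℝ] Eu N) (u : Eu N → ℝ) (x : Eu N) :
    mU ρ u x = if 0 < u (ρ x) - u x then u (ρ x) else u x := by
  unfold mU
  split_ifs with h
  · rw [max_eq_left h.le]; ring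
  · rw [max_eq_right (not_lt.1 h), add_zero]

theorem JJ_m (hb : Base R ε g f u D) {ρ : Eu N ≃ₗᵢ[ℝ] Eu N} (hρ : SmallR R ε u D ρ) :
    JJ R g f (mU ρ u) (mD ρ u D) ≤ JJ R g f u D := by
  have h1 := hb.down hρ
  have h2 := JJ_rot (R := R) (g := g) (f := f) (u := u) (D := D) ρ
  have crD : Continuous (rotD ρ D) := rotD_cont ρ hb.dc
  have cru : Continuous (fun x => u (ρ x)) := hb.uc.comp ρ.continuous
  have cw : Continuous (fun x => u (ρ x) - u x) := cru.sub hb.uc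
  obtain ⟨C3, hC3, b3⟩ := exists_bd hb.uc R
  obtain ⟨C4, hC4, b4⟩ := exists_bd hb.dc R
  have b5 : ∀ x ∈ ball (0 : Eu N) R, ‖rotD ρ D x‖ ≤ C4 := fun x hx => by
    unfold rotD; rw [LinearIsometryEquiv.norm_map]; exact b4 _ ((rot_ball ρ).2 hx)
  have b6 : ∀ x ∈ ball (0 : Eu N) R, |u (ρ x)| ≤ C3 := fun x hx => b3 _ ((rot_ball ρ).2 hx)
  have m2 : Measurable (fun x => if 0 < u (ρ x) - u x then D x else rotD ρ D x) :=
    Measurable.ite (isOpen_lt continuous_const cw).measurableSet hb.dc.measurable crD.measurable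
  have c3 : Continuous (fun x => u (ρ x) - max (u (ρ x) - u x) 0) := cru.sub (cw.max continuous_const)
  have emin : ∀ x, u (ρ x) - max (u (ρ x) - u x) 0 = if 0 < u (ρ x) - u x then u x else u (ρ x) := by
    intro x
    split_ifs with h
    · rw [max_eq_left h.le]; ring
    · rw [max_eq_right (not_lt.1 h), sub_zero]
  have j1 := int_J (R := R) hb.gd.cont hb.fc hb.uc.measurable hb.dc.measurable (C := C3 + C4)
    (fun x hx => by have := b3 x hx; rw [Real.norm_eq_abs] at this; linarith) (fun x hx => by linarith [b4 x hx])
  have j2 := int_J (R := R) hb.gd.cont hb.fc cru.measurable crD.measurable (C := C3 + C4)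
    (fun x hx => by linarith [b6 x hx]) (fun x hx => by linarith [b5 x hx])
  have j3 := int_J (R := R) hb.gd.cont hb.fc (mU_cont hb.uc ρ).measurable (mD_meas hb.uc hb.dc ρ) (C := C3 + C4)
    (fun x hx => by
      have := b3 x hx; rw [Real.norm_eq_abs] at this
      rw [mU_eq]; split_ifs <;> linarith [b6 x hx]) 
    (fun x hx => by unfold mD; split_ifs <;> linarith [b4 x hx, b5 x hx])
  have j4 := int_J (R := R) hb.gd.cont hb.fc c3.measurable m2 (C := C3 + C4)
    (fun x hx => by
      have := b3 x hx; rw [Real.norm_eq_abs] at this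
      rw [emin]; split_ifs <;> linarith [b6 x hx]) 
    (fun x hx => by split_ifs <;> linarith [b4 x hx, b5 x hx])
  have key : JJ R g f (mU ρ u) (mD ρ u D) + JJ R g f (fun x => u (ρ x) - max (u (ρ x) - u x) 0)
      (fun x => if 0 < u (ρ x) - u x then D x else rotD ρ D x) =
      JJ R g f u D + JJ R g f (fun x => u (ρ x)) (rotD ρ D) := by
    unfold JJ
    rw [← integral_add j3 j4, ← integral_add j1 j2]
    congr 1
    ext x
    simp only [mU_eq, emin]
    unfold mD
    split_ifs <;> ring
  linarith

theorem Base.weak_m (hb : Base R ε g f u D) {ρ : Eu N ≃ₗᵢ[ℝ] Eu N} (hρ : SmallR R ε u D ρ) :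
    WeakEq (OO R u) g f (mU ρ u) (mD ρ u D) := by
  have hle := JJ_m hb hρ
  obtain ⟨C3, hC3, b3⟩ := exists_bd hb.uc R
  obtain ⟨C4, hC4, b4⟩ := exists_bd hb.dc R
  have b5 : ∀ x ∈ ball (0 : Eu N) R, ‖rotD ρ D x‖ ≤ C4 := fun x hx => by
    unfold rotD; rw [LinearIsometryEquiv.norm_map]; exact b4 _ ((rot_ball ρ).2 hx)
  have b6 : ∀ x ∈ ball (0 : Eu N) R, |u (ρ x)| ≤ C3 := fun x hx => b3 _ ((rot_ball ρ).2 hx)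
  have half : ∀ ψ P, Tst (OO R u) ψ P →
      0 ≤ ∫ x in ball (0 : Eu N) R, (⟪gvec g (mD ρ u D x), P x⟫ - f (mU ρ u x) * ψ x) := by
    intro ψ P hψ
    obtain ⟨C1, hC1, b1⟩ := exists_bd hψ.ucont R
    obtain ⟨C2, hC2, b2⟩ := exists_bd hψ.cont R
    obtain ⟨t0, ht0, ht⟩ := hb.up hρ hψ
    apply first_var hb.gd hb.fc (mU_cont hb.uc ρ).measurable (mD_meas hb.uc hb.dc ρ) hψ.ucont hψ.cont
      (C := C1 + C2 + C3 + C4) _ _ _ _ ht0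
    · intro t htt
      exact hle.trans (ht t (by rw [abs_of_pos htt.1]; exact htt.2))
    · intro x hx
      have := b3 x hx; rw [Real.norm_eq_abs] at this
      rw [mU_eq]; split_ifs <;> linarith [b6 x hx]
    · intro x hx
      unfold mD; split_ifs <;> linarith [b4 x hx, b5 x hx]
    · intro x hx; have := b1 x hx; rw [Real.norm_eq_abs] at this; linarith
    · intro x hx; linarith [b2 x hx]
  intro ψ P hψ
  have hneg : Tst (OO R u) (fun x => -ψ x) (fun x => -P x) := by
    obtain ⟨K, hK, hKO, h0⟩ := hψ.supp
    refine ⟨fun x => ?_, hψ.cont.neg, K, hK, hKO, fun x hx => ?_, fun x hx => ?_⟩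
    · have := hgr_cmul (-1) (hψ.grad x)
      simpa using this
    · simp [h0.1 x hx]
    · simp [h0.2 x hx]
  have h1 := half ψ P hψ
  have h2 := half _ _ hneg
  have e1 : ∫ x in ball (0 : Eu N) R, (⟪gvec g (mD ρ u D x), -P x⟫ - f (mU ρ u x) * -ψ x) =
      - ∫ x in ball (0 : Eu N) R, (⟪gvec g (mD ρ u D x), P x⟫ - f (mU ρ u x) * ψ x) := by
    rw [← integral_neg]; congr 1; ext x; rw [inner_neg_right]; ring
  rw [e1] at h2
  have h3 : ∫ x in ball (0 : Eu N) R, (⟪gvec g (mD ρ u D x), P x⟫ - f (mU ρ u x) * ψ x) = 0 := by linarith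
  obtain ⟨K, hK, hKO, h0⟩ := hψ.supp
  rw [setIntegral_eq_integral_of_forall_compl_eq_zero (by
    intro x hx
    have hxK : x ∉ K := fun h => hx (hKO h).1
    rw [h0.1 x hxK, h0.2 x hxK]; simp)] at h3
  have mgv : Measurable (fun x => gvec g (mD ρ u D x)) :=
    (gvec_cont hb.gd).measurable.comp (mD_meas hb.uc hb.dc ρ)
  obtain ⟨B1, hB10, hB1⟩ := bdd_of_cont hb.gd.cont C4
  have cP := hψ.cont
  have iP : Integrable (fun x => ‖P x‖) :=
    (cP.norm).integrable_of_hasCompactSupport (HasCompactSupport.intro hK (fun x hx => by simp [h0.2 x hx]))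
  have i1 : Integrable (fun x => ⟪gvec g (mD ρ u D x), P x⟫) := by
    apply (iP.const_mul B1).mono' (mgv.inner cP.measurable).aestronglyMeasurable
    refine Filter.Eventually.of_forall fun x => ?_
    by_cases hx : x ∈ K
    · refine (abs_real_inner_le_norm _ _).trans ?_
      apply mul_le_mul_of_nonneg_right _ (norm_nonneg _)
      rw [gvec_norm hb.gd]
      refine (le_abs_self _).trans (hB1 _ ?_)
      rw [abs_of_nonneg (norm_nonneg _)]
      have hxb := (hKO hx).1
      unfold mD; split_ifs
      · exact b5 x hxb
      · exact b4 x hxb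
    · rw [h0.2 x hx]; simp
  have i2 : Integrable (fun x => f (mU ρ u x) * ψ x) := by
    apply Continuous.integrable_of_hasCompactSupport
    · exact (hb.fc.comp (mU_cont hb.uc ρ)).mul hψ.ucont
    · exact HasCompactSupport.intro hK (fun x hx => by simp [h0.1 x hx])
  rw [integral_sub i1 i2] at h3
  linarith

theorem Base.c1s (hb : Base R ε g f u D) : C1S (OO R u) u D :=
  ⟨OO_open hb.uc, hb.uc, fun x hx => hb.adm.grad x hx.1, hb.dc.continuousOn⟩

theorem Base.sol (hb : Base R ε g f u D) : Sol (OO R u) g f u D := by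
  refine ⟨hb.c1s, ?_⟩
  have h1 : SmallR R ε u D (LinearIsometryEquiv.refl ℝ (Eu N)) := by
    intro x hx
    have : rotD (LinearIsometryEquiv.refl ℝ (Eu N)) D x = D x := rfl
    rw [this]
    have e0 : u (LinearIsometryEquiv.refl ℝ (Eu N) x) = u x := rfl
    rw [e0, sub_self, sub_self, abs_zero, norm_zero]
    linarith [hb.epos]
  have h2 := hb.weak_m h1
  have e1 : mU (LinearIsometryEquiv.refl ℝ (Eu N)) u = u := by
    ext x; simp [mU]
  have e2 : mD (LinearIsometryEquiv.refl ℝ (Eu N)) u D = D := by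
    ext x; simp [mD]
  rwa [e1, e2] at h2

end stepB
end

open Set Metric MeasureTheory Bornology
open scoped RealInnerProductSpace Classical Topology

noncomputable section

section nokink
variable {N : ℕ}

theorem gvec_smono {g : ℝ → ℝ} (hg : Gd g) {p q : Eu N} (h : q ≠ p) :
    0 < ⟪gvec g q - gvec g p, q - p⟫ := by
  rw [inner_sub_left, inner_sub_right, inner_sub_right, gvec_inner_self hg, gvec_inner_self hg]
  have h1 := gvec_inner_le hg q p
  have h2 := gvec_inner_le hg p q
  rcases lt_trichotomy ‖q‖ ‖p‖ with h3 | h3 | h3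
  · have := hg.smono (norm_nonneg q) (norm_nonneg p) h3
    nlinarith
  · have hp : 0 < ‖p‖ := by
      rcases (norm_nonneg p).eq_or_lt with h4 | h4
      · exfalso
        have e1 := norm_eq_zero.1 h4.symm
        rw [← h4] at h3
        exact h ((norm_eq_zero.1 h3).trans e1.symm)
      · exact h4
    have gp := hg.pos hp
    rw [gvec_inner, gvec_inner, h3, real_inner_comm q p]
    have h5 : ⟪q, p⟫ < ‖p‖ * ‖p‖ := by
      have h6 : 0 < ‖q - p‖ ^ 2 := by
        have := norm_pos_iff.2 (sub_ne_zero.2 h)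
        positivity
      rw [norm_sub_sq_real, h3] at h6
      nlinarith
    have h7 : g ‖p‖ / ‖p‖ * ⟪q, p⟫ < g ‖p‖ / ‖p‖ * (‖p‖ * ‖p‖) :=
      mul_lt_mul_of_pos_left h5 (by positivity)
    have h8 : g ‖p‖ / ‖p‖ * (‖p‖ * ‖p‖) = g ‖p‖ * ‖p‖ := by field_simp
    rw [real_inner_comm p q] at *
    linarith
  · have := hg.smono (norm_nonneg p) (norm_nonneg q) h3
    nlinarith

/-- profile -/
def bmp (t : ℝ) : ℝ := max t 0
theorem bmp_cont : Continuous bmp := continuous_id.max continuous_const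

theorem bmp_tst {x0 : Eu N} {r lam : ℝ} (hl : 0 < lam) (hlr : lam < r) :
    Tst (ball x0 r) (fun x => Gfun bmp (1 - (lam⁻¹) ^ 2 * ‖x - x0‖ ^ 2))
      (fun x => bmp (1 - (lam⁻¹) ^ 2 * ‖x - x0‖ ^ 2) • (-((lam⁻¹) ^ 2 • ((2:ℝ) • (x - x0))))) := by
  have off : ∀ x ∉ closedBall x0 lam, 1 - (lam⁻¹) ^ 2 * ‖x - x0‖ ^ 2 ≤ 0 := by
    intro x hx
    rw [mem_closedBall, dist_eq_norm, not_le] at hx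
    rw [← mul_pow]
    have h1 : 1 ≤ lam⁻¹ * ‖x - x0‖ := by
      rw [inv_mul_eq_div, one_le_div hl]; exact hx.le
    nlinarith
  refine ⟨fun x => ?_, ?_, closedBall x0 lam, isCompact_closedBall _ _, closedBall_subset_ball hlr, ?_, ?_⟩
  · have h1 : HasGradientAt (fun x => 1 - (lam⁻¹) ^ 2 * ‖x - x0‖ ^ 2) (0 - (lam⁻¹) ^ 2 • ((2:ℝ) • (x - x0))) x :=
      hgr_sub (hasGradientAt_const x (1:ℝ)) (hgr_cmul _ (hgr_norm_sq x0))
    rw [zero_sub] at h1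
    exact hgr_comp (φ := Gfun bmp) (Gfun_hasDerivAt bmp_cont _) h1
  · have c1 : Continuous (fun x : Eu N => x - x0) := continuous_id.sub continuous_const
    have c2 : Continuous (fun x : Eu N => 1 - (lam⁻¹) ^ 2 * ‖x - x0‖ ^ 2) :=
      continuous_const.sub (continuous_const.mul (c1.norm.pow 2))
    have c3 : Continuous (fun x : Eu N => -((lam⁻¹) ^ 2 • ((2:ℝ) • (x - x0)))) :=
      ((c1.const_smul (2:ℝ)).const_smul ((lam⁻¹) ^ 2)).neg
    exact (bmp_cont.comp c2).smul c3
  · intro x hx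
    have h1 := off x hx
    have e1 : ∀ t ≤ 0, Gfun bmp t = 0 := by
      intro t ht
      unfold Gfun
      rw [intervalIntegral.integral_congr (g := fun _ => (0:ℝ)), intervalIntegral.integral_zero]
      intro s hs
      rw [uIcc_of_ge ht] at hs
      exact max_eq_right hs.2
    exact e1 _ h1
  · intro x hx
    have h1 := off x hx
    have e1 : bmp (1 - (lam⁻¹) ^ 2 * ‖x - x0‖ ^ 2) = 0 := max_eq_right h1
    show bmp (1 - (lam⁻¹) ^ 2 * ‖x - x0‖ ^ 2) • _ = (0 : Eu N)
    rw [e1, zero_smul]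

theorem chvar (F : Eu N → ℝ) (x0 : Eu N) {lam : ℝ} (hl : 0 < lam) :
    ∫ y, F (x0 + lam • y) = (lam ^ N)⁻¹ * ∫ x, F x := by
  have h1 := Measure.integral_comp_smul (μ := (volume : Measure (Eu N))) (fun x => F (x0 + x)) lam
  rw [h1, integral_add_left_eq_self F x0, abs_of_pos (by positivity)]
  simp

theorem blow {A : Eu N → Eu N} {h : Eu N → ℝ} {A0 : Eu N → Eu N} {x0 : Eu N} {r C : ℝ} (hr : 0 < r)
    (hA : Measurable A) (hAC : ∀ x ∈ ball x0 r, ‖A x‖ ≤ C)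
    (hhC : ∀ x ∈ ball x0 r, |h x| ≤ C)
    (heq : ∀ ψ P, Tst (ball x0 r) ψ P → ∫ x, ⟪A x, P x⟫ = ∫ x, h x * ψ x)
    (hlim : ∀ᵐ y, Filter.Tendsto (fun n : ℕ => A (x0 + (r / ((n:ℝ) + 2)) • y)) Filter.atTop (𝓝 (A0 y))) :
    ∫ y, bmp (1 - ‖y‖ ^ 2) * ⟪A0 y, y⟫ = 0 := by
  let l : ℕ → ℝ := fun n => r / ((n:ℝ) + 2)
  have lp : ∀ n, 0 < l n := fun n => by positivity
  have ll : ∀ n, l n < r := fun n => div_lt_self hr (by linarith [(Nat.cast_nonneg n : (0:ℝ) ≤ n)])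
  have lt : Filter.Tendsto l Filter.atTop (𝓝 0) := by
    apply Filter.Tendsto.div_atTop tendsto_const_nhds
    exact Filter.tendsto_atTop_add_const_right _ _ tendsto_natCast_atTop_atTop
  have hC : 0 ≤ C := (norm_nonneg _).trans (hAC x0 (mem_ball_self hr))
  have cb : Continuous (fun y : Eu N => bmp (1 - ‖y‖ ^ 2)) :=
    bmp_cont.comp (continuous_const.sub (continuous_norm.pow 2))
  have bnn : ∀ t, 0 ≤ bmp t := fun t => le_max_right _ _
  have bz : ∀ y : Eu N, y ∉ closedBall (0 : Eu N) 1 → bmp (1 - ‖y‖ ^ 2) = 0 := fun y hy => by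
    rw [mem_closedBall_zero_iff, not_le] at hy
    exact max_eq_right (by nlinarith)
  have hin : ∀ n, ∀ y ∈ closedBall (0 : Eu N) 1, x0 + l n • y ∈ ball x0 r := fun n y hy => by
    rw [mem_closedBall_zero_iff] at hy
    rw [mem_ball, dist_eq_norm, add_sub_cancel_left, norm_smul, Real.norm_eq_abs, abs_of_pos (lp n)]
    nlinarith [lp n, ll n, norm_nonneg y]
  have ib : Integrable (fun y : Eu N => bmp (1 - ‖y‖ ^ 2)) :=
    cb.integrable_of_hasCompactSupport (HasCompactSupport.intro (isCompact_closedBall 0 1) bz)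
  have cG : Continuous (fun y : Eu N => Gfun bmp (1 - ‖y‖ ^ 2)) :=
    (Gfun_cont bmp_cont).comp (continuous_const.sub (continuous_norm.pow 2))
  have Gz : ∀ y : Eu N, y ∉ closedBall (0 : Eu N) 1 → Gfun bmp (1 - ‖y‖ ^ 2) = 0 := fun y hy => by
    have h1 : 1 - ‖y‖ ^ 2 ≤ 0 := by
      rw [mem_closedBall_zero_iff, not_le] at hy; nlinarith
    unfold Gfun
    rw [intervalIntegral.integral_congr (g := fun _ => (0:ℝ)), intervalIntegral.integral_zero]
    intro s hs
    rw [uIcc_of_ge h1] at hs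
    exact max_eq_right hs.2
  have iG : Integrable (fun y : Eu N => Gfun bmp (1 - ‖y‖ ^ 2)) :=
    cG.integrable_of_hasCompactSupport (HasCompactSupport.intro (isCompact_closedBall 0 1) Gz)
  have key : ∀ n, ∫ y, bmp (1 - ‖y‖ ^ 2) * ⟪A (x0 + l n • y), y⟫ =
      -(l n / 2) * ∫ y, h (x0 + l n • y) * Gfun bmp (1 - ‖y‖ ^ 2) := by
    intro n
    have h1 := heq _ _ (bmp_tst (x0 := x0) (lp n) (ll n))
    have l0 := (lp n).ne'
    have nrm : ∀ y : Eu N, (l n)⁻¹ ^ 2 * ‖l n • y‖ ^ 2 = ‖y‖ ^ 2 := fun y => by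
      rw [norm_smul, Real.norm_eq_abs, abs_of_pos (lp n)]; field_simp
    have h2 := chvar (fun x => ⟪A x, bmp (1 - (l n)⁻¹ ^ 2 * ‖x - x0‖ ^ 2) • -((l n)⁻¹ ^ 2 • (2:ℝ) • (x - x0))⟫) x0 (lp n)
    have h3 := chvar (fun x => h x * Gfun bmp (1 - (l n)⁻¹ ^ 2 * ‖x - x0‖ ^ 2)) x0 (lp n)
    rw [← h1, ← h2] at h3
    simp only [add_sub_cancel_left, nrm] at h3
    have h4 : ∀ y : Eu N, ⟪A (x0 + l n • y), bmp (1 - ‖y‖ ^ 2) • -((l n)⁻¹ ^ 2 • (2:ℝ) • (l n • y))⟫ =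
        (-(2 * (l n)⁻¹)) * (bmp (1 - ‖y‖ ^ 2) * ⟪A (x0 + l n • y), y⟫) := by
      intro y
      rw [real_inner_smul_right, inner_neg_right, real_inner_smul_right, real_inner_smul_right,
        real_inner_smul_right]
      generalize ⟪A (x0 + l n • y), y⟫ = a
      field_simp
    simp only [h4] at h3
    rw [integral_const_mul] at h3
    rw [h3]
    generalize ∫ y, bmp (1 - ‖y‖ ^ 2) * ⟪A (x0 + l n • y), y⟫ = a
    field_simp
  have lim1 : Filter.Tendsto (fun n => ∫ y, bmp (1 - ‖y‖ ^ 2) * ⟪A (x0 + l n • y), y⟫) Filter.atTop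
      (𝓝 (∫ y, bmp (1 - ‖y‖ ^ 2) * ⟪A0 y, y⟫)) := by
    apply tendsto_integral_of_dominated_convergence (fun y => bmp (1 - ‖y‖ ^ 2) * C)
    · intro n
      have c1 : Continuous (fun y : Eu N => x0 + l n • y) := continuous_const.add (continuous_id.const_smul (l n))
      exact (cb.measurable.mul ((hA.comp c1.measurable).inner measurable_id)).aestronglyMeasurable
    · exact ib.mul_const C
    · intro n
      refine Filter.Eventually.of_forall fun y => ?_
      rw [norm_mul, Real.norm_eq_abs, abs_of_nonneg (bnn _)]
      by_cases hy : y ∈ closedBall (0 : Eu N) 1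
      · apply mul_le_mul_of_nonneg_left _ (bnn _)
        refine (abs_real_inner_le_norm _ _).trans ?_
        have h1 := hAC _ (hin n y hy)
        rw [mem_closedBall_zero_iff] at hy
        nlinarith [norm_nonneg y, norm_nonneg (A (x0 + l n • y))]
      · rw [bz y hy]; simp
    · filter_upwards [hlim] with y hy
      exact (hy.inner tendsto_const_nhds).const_mul _
  have lim2 : Filter.Tendsto (fun n => ∫ y, bmp (1 - ‖y‖ ^ 2) * ⟪A (x0 + l n • y), y⟫) Filter.atTop (𝓝 0) := by
    apply squeeze_zero_norm (a := fun n => l n / 2 * ∫ y : Eu N, C * |Gfun bmp (1 - ‖y‖ ^ 2)|)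
    · intro n
      rw [key, norm_mul, norm_neg, Real.norm_eq_abs (l n / 2), abs_of_pos (by linarith [lp n])]
      apply mul_le_mul_of_nonneg_left _ (by linarith [lp n])
      apply norm_integral_le_of_norm_le ((iG.abs).const_mul C)
      refine Filter.Eventually.of_forall fun y => ?_
      rw [norm_mul]
      by_cases hy : y ∈ closedBall (0 : Eu N) 1
      · exact mul_le_mul_of_nonneg_right (hhC _ (hin n y hy)) (abs_nonneg _)
      · rw [Gz y hy]; simp
    · have := (lt.div_const 2).mul_const (∫ y : Eu N, C * |Gfun bmp (1 - ‖y‖ ^ 2)|)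
      simpa using this
  exact tendsto_nhds_unique lim1 lim2

theorem half_int {b Y : Eu N} (hb : b ≠ 0) (hY : 0 < ⟪Y, b⟫) :
    ∫ y, bmp (1 - ‖y‖ ^ 2) * ⟪(if 0 < ⟪b, y⟫ then Y else 0), y⟫ ≠ 0 := by
  let T := (Submodule.span ℝ {b}).reflection
  have hbn : 0 < ‖b‖ := norm_pos_iff.2 hb
  have Tb : ∀ y, ⟪b, T y⟫ = ⟪b, y⟫ := fun y => by
    have h1 : T y = 2 • (⟪b, y⟫ / (‖b‖ ^ 2)) • b - y := Submodule.reflection_singleton_apply b y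
    rw [h1, inner_sub_right, two_smul, inner_add_right, real_inner_smul_right, real_inner_self_eq_norm_sq,
      div_mul_cancel₀ _ (by positivity)]
    ring
  have TY : ∀ y, ⟪Y, T y⟫ = 2 * (⟪b, y⟫ / (‖b‖ ^ 2)) * ⟪Y, b⟫ - ⟪Y, y⟫ := fun y => by
    have h1 : T y = 2 • (⟪b, y⟫ / (‖b‖ ^ 2)) • b - y := Submodule.reflection_singleton_apply b y
    rw [h1, inner_sub_right, two_smul, inner_add_right, real_inner_smul_right]
    ring
  let F : Eu N → ℝ := fun y => bmp (1 - ‖y‖ ^ 2) * ⟪(if 0 < ⟪b, y⟫ then Y else 0), y⟫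
  have inv : ∫ y, F (T y) = ∫ y, F y := (T.measurePreserving).integral_comp T.toHomeomorph.measurableEmbedding F
  have cb : Continuous (fun y : Eu N => bmp (1 - ‖y‖ ^ 2)) :=
    bmp_cont.comp (continuous_const.sub (continuous_norm.pow 2))
  have bz : ∀ y : Eu N, y ∉ closedBall (0 : Eu N) 1 → bmp (1 - ‖y‖ ^ 2) = 0 := fun y hy => by
    rw [mem_closedBall_zero_iff, not_le] at hy
    exact max_eq_right (by nlinarith)
  have ib : Integrable (fun y : Eu N => bmp (1 - ‖y‖ ^ 2)) :=
    cb.integrable_of_hasCompactSupport (HasCompactSupport.intro (isCompact_closedBall 0 1) bz)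
  have cby : Continuous (fun y : Eu N => ⟪b, y⟫) := continuous_const.inner continuous_id
  have mF : Measurable F := by
    apply cb.measurable.mul
    exact (Measurable.ite (isOpen_lt continuous_const cby).measurableSet measurable_const measurable_const).inner measurable_id
  have bnn : ∀ t, 0 ≤ bmp t := fun t => le_max_right _ _
  have iF : Integrable F := by
    apply (ib.mul_const ‖Y‖).mono' mF.aestronglyMeasurable
    refine Filter.Eventually.of_forall fun y => ?_
    show ‖bmp (1 - ‖y‖ ^ 2) * ⟪(if 0 < ⟪b, y⟫ then Y else 0), y⟫‖ ≤ _
    rw [norm_mul, Real.norm_eq_abs, abs_of_nonneg (bnn _)]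
    by_cases hy : y ∈ closedBall (0 : Eu N) 1
    · apply mul_le_mul_of_nonneg_left _ (bnn _)
      refine (abs_real_inner_le_norm _ _).trans ?_
      rw [mem_closedBall_zero_iff] at hy
      have : ‖(if 0 < ⟪b, y⟫ then Y else 0)‖ ≤ ‖Y‖ := by split_ifs <;> simp
      nlinarith [norm_nonneg y, norm_nonneg Y, norm_nonneg (if 0 < ⟪b, y⟫ then Y else 0)]
    · rw [bz y hy]; simp
  have iFT : Integrable (fun y => F (T y)) := 
    ((T.measurePreserving).integrable_comp_emb T.toHomeomorph.measurableEmbedding).2 iF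
  let k : Eu N → ℝ := fun y => bmp (1 - ‖y‖ ^ 2) * (2 * (bmp ⟪b, y⟫ / (‖b‖ ^ 2)) * ⟪Y, b⟫)
  have hs : ∀ y, F y + F (T y) = k y := by
    intro y
    show bmp (1 - ‖y‖ ^ 2) * ⟪(if 0 < ⟪b, y⟫ then Y else 0), y⟫ + bmp (1 - ‖T y‖ ^ 2) * ⟪(if 0 < ⟪b, T y⟫ then Y else 0), T y⟫
      = bmp (1 - ‖y‖ ^ 2) * (2 * (bmp ⟪b, y⟫ / (‖b‖ ^ 2)) * ⟪Y, b⟫)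
    rw [Tb, LinearIsometryEquiv.norm_map]
    split_ifs with h
    · have e1 : bmp ⟪b, y⟫ = ⟪b, y⟫ := max_eq_left h.le
      rw [TY, e1]; ring
    · have e1 : bmp ⟪b, y⟫ = 0 := max_eq_right (not_lt.1 h)
      rw [e1]; simp
  have ck : Continuous k :=
    cb.mul ((continuous_const.mul ((bmp_cont.comp cby).div_const _)).mul continuous_const)
  have kp : 0 < ∫ y, k y := by
    apply ck.integral_pos_of_hasCompactSupport_nonneg_nonzero (x := (1 / (2 * ‖b‖)) • b)
    · exact HasCompactSupport.intro (isCompact_closedBall 0 1) (fun y hy => by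
        show bmp (1 - ‖y‖ ^ 2) * _ = 0
        rw [bz y hy, zero_mul])
    · intro y
      have := bnn ⟪b, y⟫
      have := bnn (1 - ‖y‖ ^ 2)
      show 0 ≤ bmp (1 - ‖y‖ ^ 2) * (2 * (bmp ⟪b, y⟫ / (‖b‖ ^ 2)) * ⟪Y, b⟫)
      positivity
    · have e1 : ‖(1 / (2 * ‖b‖)) • b‖ = 1 / 2 := by
        rw [norm_smul, Real.norm_eq_abs, abs_of_pos (by positivity)]; field_simp
      have e2 : ⟪b, (1 / (2 * ‖b‖)) • b⟫ = ‖b‖ / 2 := by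
        rw [real_inner_smul_right, real_inner_self_eq_norm_sq]; field_simp
      show bmp (1 - ‖(1 / (2 * ‖b‖)) • b‖ ^ 2) * (2 * (bmp ⟪b, (1 / (2 * ‖b‖)) • b⟫ / (‖b‖ ^ 2)) * ⟪Y, b⟫) ≠ 0
      rw [e1, e2]
      have e3 : bmp (‖b‖ / 2) = ‖b‖ / 2 := max_eq_left (by positivity)
      have e4 : 0 < bmp (1 - (1/2:ℝ) ^ 2) := lt_max_of_lt_left (by norm_num)
      rw [e3]
      positivity
  have tot : ∫ y, F y + F (T y) = ∫ y, k y := by simp only [hs]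
  rw [integral_add iF iFT, inv] at tot
  intro h0
  have : ∫ y, F y = 0 := h0
  linarith

end nokink

section nk
variable {N : ℕ} {R ε : ℝ} {g f : ℝ → ℝ} {u : Eu N → ℝ} {D : Eu N → Eu N}

theorem hyper_null {b : Eu N} (hb : b ≠ 0) : ∀ᵐ y : Eu N, ⟪b, y⟫ ≠ 0 := by
  have h1 : (volume : Measure (Eu N)) ((innerSL ℝ b : Eu N →L[ℝ] ℝ).ker : Set (Eu N)) = 0 := by
    apply Measure.addHaar_submodule
    intro h
    have : b ∈ (innerSL ℝ b : Eu N →L[ℝ] ℝ).ker := by rw [h]; trivial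
    have h2 : ⟪b, b⟫ = 0 := this
    exact hb (inner_self_eq_zero.1 h2)
  rw [ae_iff]
  convert h1 using 2
  ext y
  simp

theorem Base.nokink (hb : Base R ε g f u D) {ρ : Eu N ≃ₗᵢ[ℝ] Eu N} (hρ : SmallR R ε u D ρ)
    {x0 : Eu N} (hx0 : x0 ∈ ball (0 : Eu N) R) (hw : u (ρ x0) = u x0) : rotD ρ D x0 = D x0 := by
  have gr := (adm_rot hb.adm ρ).grad x0 hx0
  have gu := hb.adm.grad x0 hx0
  rcases (hb.nonneg x0).eq_or_lt with h0 | h0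
  · have z1 : HasGradientAt (fun _ : Eu N => (0:ℝ)) 0 x0 := hasGradientAt_const x0 (0:ℝ)
    have e1 : D x0 = 0 := grad_eq_of_le z1 gu (Filter.Eventually.of_forall fun y => hb.nonneg y) h0.symm
    have e2 : rotD ρ D x0 = 0 := grad_eq_of_le z1 gr (Filter.Eventually.of_forall fun y => hb.nonneg _)
      (by rw [hw]; exact h0.symm)
    rw [e1, e2]
  by_contra hne
  have hxO : x0 ∈ OO R u := ⟨hx0, h0⟩
  obtain ⟨r, hr, hrO⟩ := Metric.isOpen_iff.1 (OO_open (R := R) hb.uc) x0 hxO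
  have wm := hb.weak_m hρ
  have wu := hb.sol.weak
  let b := rotD ρ D x0 - D x0
  have hb0 : b ≠ 0 := sub_ne_zero.2 hne
  let Y : Eu N → Eu N := fun x => gvec g (rotD ρ D x) - gvec g (D x)
  have cY : Continuous Y := ((gvec_cont hb.gd).comp (rotD_cont ρ hb.dc)).sub ((gvec_cont hb.gd).comp hb.dc)
  have hY : 0 < ⟪Y x0, b⟫ := gvec_smono hb.gd hne
  let A : Eu N → Eu N := fun x => gvec g (mD ρ u D x) - gvec g (D x)
  have hA : ∀ x, A x = if 0 < u (ρ x) - u x then Y x else 0 := by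
    intro x
    show gvec g (mD ρ u D x) - gvec g (D x) = _
    unfold mD
    split_ifs with h
    · rfl
    · exact sub_self _
  have mA : Measurable A := ((gvec_cont hb.gd).measurable.comp (mD_meas hb.uc hb.dc ρ)).sub
    ((gvec_cont hb.gd).measurable.comp hb.dc.measurable)
  let h : Eu N → ℝ := fun x => f (mU ρ u x) - f (u x)
  have ch : Continuous h := (hb.fc.comp (mU_cont hb.uc ρ)).sub (hb.fc.comp hb.uc)
  obtain ⟨C1, hC1, b1⟩ := exists_bd cY R
  obtain ⟨C2, hC2, b2⟩ := exists_bd ch R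
  have bA : ∀ x ∈ ball (0 : Eu N) R, ‖A x‖ ≤ C1 := fun x hx => by
    rw [hA]; split_ifs
    · exact b1 x hx
    · simpa using hC1
  refine half_int (Y := Y x0) hb0 hY (blow (A := A) (h := h) (x0 := x0) (C := C1 + C2) hr mA ?_ ?_ ?_ ?_)
  · intro x hx; linarith [bA x (hrO hx).1]
  · intro x hx; have := b2 x (hrO hx).1; rw [Real.norm_eq_abs] at this; linarith
  · intro ψ P hψ
    have hψO := hψ.mono hrO
    have h1 := wm ψ P hψO
    have h2 := wu ψ P hψO
    obtain ⟨K, hK, hKO, z0, z1⟩ := hψO.supp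
    have cP := hψ.cont
    have iP : Integrable (fun x => ‖P x‖) :=
      (cP.norm).integrable_of_hasCompactSupport (HasCompactSupport.intro hK (fun x hx => by simp [z1 x hx]))
    have i1 : Integrable (fun x => ⟪A x, P x⟫) := by
      apply (iP.const_mul C1).mono' (mA.inner cP.measurable).aestronglyMeasurable
      refine Filter.Eventually.of_forall fun x => ?_
      by_cases hx : x ∈ K
      · refine (abs_real_inner_le_norm _ _).trans ?_
        exact mul_le_mul_of_nonneg_right (bA x (hKO hx).1) (norm_nonneg _)
      · rw [z1 x hx]; simp
    have i2 : Integrable (fun x => ⟪gvec g (D x), P x⟫) := by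
      apply Continuous.integrable_of_hasCompactSupport
      · exact ((gvec_cont hb.gd).comp hb.dc).inner cP
      · exact HasCompactSupport.intro hK (fun x hx => by simp [z1 x hx])
    have i3 : Integrable (fun x => h x * ψ x) := by
      apply Continuous.integrable_of_hasCompactSupport
      · exact ch.mul hψ.ucont
      · exact HasCompactSupport.intro hK (fun x hx => by simp [z0 x hx])
    have i4 : Integrable (fun x => f (u x) * ψ x) := by
      apply Continuous.integrable_of_hasCompactSupport
      · exact (hb.fc.comp hb.uc).mul hψ.ucont
      · exact HasCompactSupport.intro hK (fun x hx => by simp [z0 x hx])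
    have e1 : ∫ x, ⟪gvec g (mD ρ u D x), P x⟫ = ∫ x, (⟪A x, P x⟫ + ⟪gvec g (D x), P x⟫) := by
      congr 1; ext x
      show _ = ⟪gvec g (mD ρ u D x) - gvec g (D x), P x⟫ + _
      rw [inner_sub_left]; ring
    have e2 : ∫ x, f (mU ρ u x) * ψ x = ∫ x, (h x * ψ x + f (u x) * ψ x) := by
      congr 1; ext x
      show _ = (f (mU ρ u x) - f (u x)) * ψ x + _
      ring
    rw [e1, e2, integral_add i1 i2, integral_add i3 i4] at h1
    linarith
  · filter_upwards [hyper_null hb0] with y hy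
    have gw : HasGradientAt (fun x => u (ρ x) - u x) b x0 := hgr_sub gr gu
    let l : ℕ → ℝ := fun n => r / ((n:ℝ) + 2)
    have lp : ∀ n, 0 < l n := fun n => by positivity
    have lt : Filter.Tendsto l Filter.atTop (𝓝 0) := by
      apply Filter.Tendsto.div_atTop tendsto_const_nhds
      exact Filter.tendsto_atTop_add_const_right _ _ tendsto_natCast_atTop_atTop
    have lx : Filter.Tendsto (fun n => x0 + l n • y) Filter.atTop (𝓝 x0) := by
      have := (lt.smul_const y).const_add x0
      simpa using this
    have lY : Filter.Tendsto (fun n => Y (x0 + l n • y)) Filter.atTop (𝓝 (Y x0)) := (cY.tendsto x0).comp lx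
    have gl := hgr_line (u := fun x => u (ρ x) - u x) (D := b) (x := x0) y 0 (by simpa using gw)
    have l2 := gl.tendsto_slope_zero_right
    have l3 : Filter.Tendsto l Filter.atTop (𝓝[>] 0) :=
      tendsto_nhdsWithin_iff.2 ⟨lt, Filter.Eventually.of_forall lp⟩
    have l4 := l2.comp l3
    have l5 : Filter.Tendsto (fun n => (l n)⁻¹ * (u (ρ (x0 + l n • y)) - u (x0 + l n • y))) Filter.atTop (𝓝 ⟪b, y⟫) := by
      refine l4.congr fun n => ?_
      simp [hw]
    split_ifs with hpos
    · apply lY.congr'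
      filter_upwards [l5.eventually (lt_mem_nhds hpos)] with n hn
      rw [hA, if_pos]
      exact pos_of_mul_pos_right hn (inv_pos.2 (lp n)).le
    · have hneg : ⟪b, y⟫ < 0 := lt_of_le_of_ne (not_lt.1 hpos) hy
      apply tendsto_const_nhds.congr'
      filter_upwards [l5.eventually (gt_mem_nhds hneg)] with n hn
      show 0 = A (x0 + l n • y)
      rw [hA, if_neg]
      intro hc
      have := mul_pos (inv_pos.2 (lp n)) hc
      linarith

end nk
end

open Set Metric MeasureTheory Bornology
open scoped RealInnerProductSpace Classical Topology

noncomputable section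

section solm
variable {N : ℕ} {R ε : ℝ} {g f : ℝ → ℝ} {u : Eu N → ℝ} {D : Eu N → Eu N}

theorem hgr_max0 {w : Eu N → ℝ} {x : Eu N} (hw : HasGradientAt w 0 x) (h0 : w x = 0) :
    HasGradientAt (fun y => max (w y) 0) 0 x := by
  rw [hgr_fd] at hw ⊢
  rw [hasFDerivAt_iff_isLittleO] at hw ⊢
  refine Asymptotics.IsLittleO.of_norm_left (Asymptotics.IsBigO.trans_isLittleO ?_ hw)
  apply Asymptotics.IsBigO.of_bound 1
  refine Filter.Eventually.of_forall fun y => ?_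
  rw [h0]
  simp only [map_zero, max_self, ContinuousLinearMap.zero_apply, sub_zero, norm_norm, one_mul]
  rw [Real.norm_eq_abs, Real.norm_eq_abs, abs_of_nonneg (le_max_right _ _)]
  exact max_le (le_abs_self _) (abs_nonneg _)

theorem Base.sol_m (hb : Base R ε g f u D) {ρ : Eu N ≃ₗᵢ[ℝ] Eu N} (hρ : SmallR R ε u D ρ) :
    Sol (OO R u) g f (mU ρ u) (mD ρ u D) := by
  have cru : Continuous (fun x => u (ρ x)) := hb.uc.comp ρ.continuous
  have cw : Continuous (fun x => u (ρ x) - u x) := cru.sub hb.uc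
  have crD := rotD_cont ρ hb.dc
  refine ⟨⟨OO_open hb.uc, mU_cont hb.uc ρ, ?_, ?_⟩, hb.weak_m hρ⟩
  · intro x hx
    have gr := (adm_rot hb.adm ρ).grad x hx.1
    have gu := hb.adm.grad x hx.1
    rcases lt_trichotomy (u (ρ x) - u x) 0 with h | h | h
    · have e1 : mD ρ u D x = D x := by unfold mD; rw [if_neg (by linarith)]
      rw [e1]
      apply gu.congr_of_eventuallyEq
      filter_upwards [cw.continuousAt.eventually (gt_mem_nhds h)] with y hy
      rw [mU_eq, if_neg (by linarith)]
    · have e1 : rotD ρ D x = D x := hb.nokink hρ hx.1 (by linarith)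
      have e2 : mD ρ u D x = D x + 0 := by unfold mD; rw [if_neg (by linarith), add_zero]
      rw [e2]
      have gw : HasGradientAt (fun y => u (ρ y) - u y) (rotD ρ D x - D x) x := hgr_sub gr gu
      rw [e1, sub_self] at gw
      exact hgr_add gu (hgr_max0 gw h)
    · have e1 : mD ρ u D x = rotD ρ D x := by unfold mD; rw [if_pos h]
      rw [e1]
      apply gr.congr_of_eventuallyEq
      filter_upwards [cw.continuousAt.eventually (lt_mem_nhds h)] with y hy
      rw [mU_eq, if_pos hy]
  · intro x hx
    apply ContinuousAt.continuousWithinAt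
    rcases lt_trichotomy (u (ρ x) - u x) 0 with h | h | h
    · apply hb.dc.continuousAt.congr
      filter_upwards [cw.continuousAt.eventually (gt_mem_nhds h)] with y hy
      unfold mD; rw [if_neg (by linarith)]
    · have e1 : rotD ρ D x = D x := hb.nokink hρ hx.1 (by linarith)
      have e2 : mD ρ u D x = D x := by unfold mD; rw [if_neg (by linarith)]
      unfold ContinuousAt
      rw [e2]
      have t1 : Filter.Tendsto (rotD ρ D) (𝓝 x) (𝓝 (D x)) := by rw [← e1]; exact crD.continuousAt
      exact Filter.Tendsto.if' t1 hb.dc.continuousAt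
    · apply crD.continuousAt.congr
      filter_upwards [cw.continuousAt.eventually (lt_mem_nhds h)] with y hy
      unfold mD; rw [if_pos hy]

end solm

section rots
variable {N : ℕ} {e1 e2 : Eu N}

/-- orthonormal pair -/
structure OP (e1 e2 : Eu N) : Prop where
  n1 : ⟪e1, e1⟫ = 1
  n2 : ⟪e2, e2⟫ = 1
  o : ⟪e1, e2⟫ = 0

theorem OP.o' (h : OP e1 e2) : ⟪e2, e1⟫ = 0 := by rw [real_inner_comm]; exact h.o

/-- plane rotation -/
def rotF (e1 e2 : Eu N) (s : ℝ) (x : Eu N) : Eu N :=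
  x + (((Real.cos s - 1) * ⟪e1, x⟫ - Real.sin s * ⟪e2, x⟫) • e1 +
    (Real.sin s * ⟪e1, x⟫ + (Real.cos s - 1) * ⟪e2, x⟫) • e2)

/-- generator -/
def genJ (e1 e2 : Eu N) (x : Eu N) : Eu N := (-⟪e2, x⟫) • e1 + ⟪e1, x⟫ • e2

theorem rotF_in1 (h : OP e1 e2) (s : ℝ) (x : Eu N) :
    ⟪e1, rotF e1 e2 s x⟫ = Real.cos s * ⟪e1, x⟫ - Real.sin s * ⟪e2, x⟫ := by
  unfold rotF
  rw [inner_add_right, inner_add_right, real_inner_smul_right, real_inner_smul_right, h.n1, h.o]; ring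

theorem rotF_in2 (h : OP e1 e2) (s : ℝ) (x : Eu N) :
    ⟪e2, rotF e1 e2 s x⟫ = Real.sin s * ⟪e1, x⟫ + Real.cos s * ⟪e2, x⟫ := by
  unfold rotF
  rw [inner_add_right, inner_add_right, real_inner_smul_right, real_inner_smul_right, h.n2, h.o']; ring

theorem rotF_zero (x : Eu N) : rotF e1 e2 0 x = x := by simp [rotF]

theorem rotF_add (h : OP e1 e2) (s t : ℝ) (x : Eu N) :
    rotF e1 e2 s (rotF e1 e2 t x) = rotF e1 e2 (s + t) x := by
  rw [rotF, rotF_in1 h, rotF_in2 h]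
  unfold rotF
  rw [Real.cos_add, Real.sin_add]
  generalize ⟪e1, x⟫ = a
  generalize ⟪e2, x⟫ = b
  module

theorem rotF_norm (h : OP e1 e2) (s : ℝ) (x : Eu N) : ‖rotF e1 e2 s x‖ = ‖x‖ := by
  have h1 : ‖rotF e1 e2 s x‖ ^ 2 = ‖x‖ ^ 2 := by
    rw [← real_inner_self_eq_norm_sq, ← real_inner_self_eq_norm_sq]
    unfold rotF
    simp only [inner_add_right, inner_add_left, real_inner_smul_left, real_inner_smul_right, h.n1, h.n2, h.o, h.o']
    rw [real_inner_comm e1 x, real_inner_comm e2 x]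
    generalize ⟪e1, x⟫ = a
    generalize ⟪e2, x⟫ = b
    have := Real.sin_sq_add_cos_sq s
    linear_combination (a ^ 2 + b ^ 2) * this
  exact (sq_eq_sq₀ (norm_nonneg _) (norm_nonneg _)).1 h1

/-- rotation as isometry -/
def rotE (h : OP e1 e2) (s : ℝ) : Eu N ≃ₗᵢ[ℝ] Eu N where
  toFun := rotF e1 e2 s
  invFun := rotF e1 e2 (-s)
  map_add' x y := by
    unfold rotF; simp only [inner_add_right]; module
  map_smul' c x := by
    unfold rotF; simp only [real_inner_smul_right, RingHom.id_apply]; module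
  left_inv x := by rw [rotF_add h, neg_add_cancel, rotF_zero]
  right_inv x := by rw [rotF_add h, add_neg_cancel, rotF_zero]
  norm_map' x := rotF_norm h s x

theorem rotE_apply (h : OP e1 e2) (s : ℝ) (x : Eu N) : rotE h s x = rotF e1 e2 s x := rfl
theorem rotE_symm (h : OP e1 e2) (s : ℝ) (x : Eu N) : (rotE h s).symm x = rotF e1 e2 (-s) x := rfl

theorem rotF_cont : Continuous (fun p : ℝ × Eu N => rotF e1 e2 p.1 p.2) := by
  unfold rotF
  have c1 : Continuous (fun p : ℝ × Eu N => ⟪e1, p.2⟫) := continuous_const.inner continuous_snd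
  have c2 : Continuous (fun p : ℝ × Eu N => ⟪e2, p.2⟫) := continuous_const.inner continuous_snd
  have c3 : Continuous (fun p : ℝ × Eu N => Real.cos p.1) := Real.continuous_cos.comp continuous_fst
  have c4 : Continuous (fun p : ℝ × Eu N => Real.sin p.1) := Real.continuous_sin.comp continuous_fst
  have c7 : Continuous (fun p : ℝ × Eu N => Real.cos p.1 - 1) := c3.sub continuous_const
  have c5 := ((c7.mul c1).sub (c4.mul c2)).smul (continuous_const (y := e1))
  have c6 := ((c4.mul c1).add (c7.mul c2)).smul (continuous_const (y := e2))
  exact continuous_snd.add (c5.add c6)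

theorem rotF_cont1 (x : Eu N) : Continuous (fun s => rotF e1 e2 s x) :=
  (rotF_cont (e1 := e1) (e2 := e2)).comp (continuous_id.prodMk continuous_const)

theorem rotF_deriv (h : OP e1 e2) (s : ℝ) (x : Eu N) :
    HasDerivAt (fun s => rotF e1 e2 s x) (genJ e1 e2 (rotF e1 e2 s x)) s := by
  have hc := Real.hasDerivAt_cos s
  have hs := Real.hasDerivAt_sin s
  have d1 : HasDerivAt (fun s => (Real.cos s - 1) * ⟪e1, x⟫ - Real.sin s * ⟪e2, x⟫)
      ((-Real.sin s) * ⟪e1, x⟫ - Real.cos s * ⟪e2, x⟫) s :=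
    ((hc.sub_const 1).mul_const _).sub (hs.mul_const _)
  have d2 : HasDerivAt (fun s => Real.sin s * ⟪e1, x⟫ + (Real.cos s - 1) * ⟪e2, x⟫)
      (Real.cos s * ⟪e1, x⟫ + (-Real.sin s) * ⟪e2, x⟫) s :=
    (hs.mul_const _).add ((hc.sub_const 1).mul_const _)
  have d3 := ((d1.smul_const e1).add (d2.smul_const e2)).const_add x
  have e : genJ e1 e2 (rotF e1 e2 s x) = ((-Real.sin s) * ⟪e1, x⟫ - Real.cos s * ⟪e2, x⟫) • e1 +
      (Real.cos s * ⟪e1, x⟫ + (-Real.sin s) * ⟪e2, x⟫) • e2 := by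
    unfold genJ
    rw [rotF_in1 h, rotF_in2 h]
    module
  rw [e]
  exact d3

theorem genJ_comm (h : OP e1 e2) (s : ℝ) (x : Eu N) :
    genJ e1 e2 (rotF e1 e2 s x) = rotF e1 e2 s (genJ e1 e2 x) := by
  unfold genJ
  rw [rotF_in1 h, rotF_in2 h]
  unfold rotF
  simp only [inner_add_right, real_inner_smul_right, h.n1, h.n2, h.o, h.o']
  generalize ⟪e1, x⟫ = a
  generalize ⟪e2, x⟫ = b
  module

theorem rotF_inner (h : OP e1 e2) (s : ℝ) (x y : Eu N) : ⟪rotF e1 e2 s x, rotF e1 e2 s y⟫ = ⟪x, y⟫ :=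
  (rotE h s).inner_map_map x y

theorem rotF_per (s : ℝ) (x : Eu N) : rotF e1 e2 (s + 2 * Real.pi) x = rotF e1 e2 s x := by
  unfold rotF; rw [Real.cos_add_two_pi, Real.sin_add_two_pi]

end rots

section circ
variable {N : ℕ} {R ε : ℝ} {g f : ℝ → ℝ} {u : Eu N → ℝ} {D : Eu N → Eu N} {e1 e2 : Eu N}

theorem Base.small (hb : Base R ε g f u D) (h : OP e1 e2) :
    ∃ δ > 0, ∀ s, |s| < δ → SmallR R ε u D (rotE h s) := by
  have c0 := rotF_cont (e1 := e1) (e2 := e2)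
  have cA : Continuous (fun p : ℝ × Eu N => |u (rotF e1 e2 p.1 p.2) - u p.2|) :=
    ((hb.uc.comp c0).sub (hb.uc.comp continuous_snd)).abs
  have cB1 : Continuous (fun p : ℝ × Eu N => rotF e1 e2 (-p.1) (D (rotF e1 e2 p.1 p.2))) :=
    c0.comp (continuous_fst.neg.prodMk (hb.dc.comp c0))
  have cB : Continuous (fun p : ℝ × Eu N => ‖rotF e1 e2 (-p.1) (D (rotF e1 e2 p.1 p.2)) - D p.2‖) :=
    (cB1.sub (hb.dc.comp continuous_snd)).norm
  have ep := hb.epos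
  have key : ∀ᶠ s in 𝓝 (0:ℝ), ∀ x ∈ closedBall (0 : Eu N) R, |u (rotF e1 e2 s x) - u x| +
      ‖rotF e1 e2 (-s) (D (rotF e1 e2 s x)) - D x‖ < ε / 2 := by
    apply (isCompact_closedBall (0 : Eu N) R).eventually_forall_of_forall_eventually
    intro y hy
    have := (cA.add cB).continuousAt (x := ((0:ℝ), y))
    apply this.eventually (gt_mem_nhds _)
    show |u (rotF e1 e2 0 y) - u y| + ‖rotF e1 e2 (-0) (D (rotF e1 e2 0 y)) - D y‖ < ε / 2
    simp only [neg_zero, rotF_zero, sub_self, abs_zero, norm_zero, add_zero]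
    linarith
  obtain ⟨δ, hδ, hh⟩ := Metric.eventually_nhds_iff.1 key
  refine ⟨δ, hδ, fun s hs x hx => ?_⟩
  exact (hh (by simpa using hs) x (ball_subset_closedBall hx)).le

theorem rotF_ball (h : OP e1 e2) {s : ℝ} {x : Eu N} (hx : x ∈ ball (0 : Eu N) R) :
    rotF e1 e2 s x ∈ ball (0 : Eu N) R := by
  rw [mem_ball_zero_iff] at hx ⊢; rwa [rotF_norm h]

theorem Base.circ_deriv (hb : Base R ε g f u D) (h : OP e1 e2) {x : Eu N} (hx : x ∈ ball (0 : Eu N) R) (s : ℝ) :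
    HasDerivAt (fun s => u (rotF e1 e2 s x)) ⟪D (rotF e1 e2 s x), genJ e1 e2 (rotF e1 e2 s x)⟫ s := by
  have h1 := hgr_fd.1 (hb.adm.grad _ (rotF_ball h (s := s) hx))
  exact h1.comp_hasDerivAt s (rotF_deriv h s x)

/-- no kink along circles -/
theorem Base.circ_nokink (hb : Base R ε g f u D) (h : OP e1 e2) {δ : ℝ}
    (hδ : ∀ s, |s| < δ → SmallR R ε u D (rotE h s)) {x : Eu N} (hx : x ∈ ball (0 : Eu N) R) {s t : ℝ}
    (hst : |t - s| < δ) (heq : u (rotF e1 e2 s x) = u (rotF e1 e2 t x)) :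
    D (rotF e1 e2 t x) = rotF e1 e2 (t - s) (D (rotF e1 e2 s x)) := by
  have e : rotF e1 e2 (t - s) (rotF e1 e2 s x) = rotF e1 e2 t x := by rw [rotF_add h, sub_add_cancel]
  have h1 := hb.nokink (hδ _ hst) (rotF_ball h (s := s) hx) (by rw [rotE_apply, e, heq])
  unfold rotD at h1
  rw [rotE_apply, e, rotE_symm] at h1
  rw [← h1, rotF_add h, add_neg_cancel, rotF_zero]

theorem Base.circ_nokink_d (hb : Base R ε g f u D) (h : OP e1 e2) {δ : ℝ}
    (hδ : ∀ s, |s| < δ → SmallR R ε u D (rotE h s)) {x : Eu N} (hx : x ∈ ball (0 : Eu N) R) {s t : ℝ}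
    (hst : |t - s| < δ) (heq : u (rotF e1 e2 s x) = u (rotF e1 e2 t x)) :
    ⟪D (rotF e1 e2 s x), genJ e1 e2 (rotF e1 e2 s x)⟫ = ⟪D (rotF e1 e2 t x), genJ e1 e2 (rotF e1 e2 t x)⟫ := by
  have e : rotF e1 e2 (t - s) (rotF e1 e2 s x) = rotF e1 e2 t x := by rw [rotF_add h, sub_add_cancel]
  rw [hb.circ_nokink h hδ hx hst heq, ← e, genJ_comm h (t - s), rotF_inner h]

theorem Base.circ_nokink_n (hb : Base R ε g f u D) (h : OP e1 e2) {δ : ℝ}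
    (hδ : ∀ s, |s| < δ → SmallR R ε u D (rotE h s)) {x : Eu N} (hx : x ∈ ball (0 : Eu N) R) {s t : ℝ}
    (hst : |t - s| < δ) (heq : u (rotF e1 e2 s x) = u (rotF e1 e2 t x)) :
    ‖D (rotF e1 e2 s x)‖ = ‖D (rotF e1 e2 t x)‖ := by
  rw [hb.circ_nokink h hδ hx hst heq, rotF_norm h]

end circ
end

open Set Metric MeasureTheory Bornology
open scoped RealInnerProductSpace Classical Topology

noncomputable section

theorem crit_null {h d : ℝ → ℝ} (hd : ∀ s, HasDerivAt h (d s) s) :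
    volume (h '' {s | d s = 0}) = 0 := by
  apply addHaar_image_eq_zero_of_det_fderivWithin_eq_zero (f' := fun _ => (0 : ℝ →L[ℝ] ℝ))
  · intro x hx
    have h1 := hd x
    rw [show d x = 0 from hx] at h1
    have h2 := h1.hasFDerivAt.hasFDerivWithinAt (s := {s | d s = 0})
    simpa using h2
  · intro x _
    show LinearMap.det (0 : ℝ →ₗ[ℝ] ℝ) = 0
    rw [LinearMap.det_zero]; simp

theorem cross_up {h d : ℝ → ℝ} (hd : ∀ s, HasDerivAt h (d s) s) {a b c : ℝ} (hab : a ≤ b)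
    (ha : h a ≤ c) (hb : c < h b) : ∃ s ∈ Ico a b, h s = c ∧ 0 ≤ d s := by
  have hc : Continuous h := continuous_iff_continuousAt.2 fun s => (hd s).continuousAt
  let S := Icc a b ∩ {s | h s ≤ c}
  have hS : IsCompact S := isCompact_Icc.inter_right (isClosed_le hc continuous_const)
  have hne : S.Nonempty := ⟨a, ⟨le_rfl, hab⟩, ha⟩
  have hm := hS.sSup_mem hne
  set s := sSup S with hs
  have hup : ∀ t ∈ Ioc s b, c < h t := by
    intro t ht
    by_contra hcon
    have : t ∈ S := ⟨⟨hm.1.1.trans ht.1.le, ht.2⟩, not_lt.1 hcon⟩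
    have := le_csSup hS.bddAbove this
    exact absurd ht.1 (not_lt.2 this)
  have hsb : s < b := by
    rcases hm.1.2.eq_or_lt with h1 | h1
    · exfalso
      have := hm.2
      rw [mem_setOf_eq, h1] at this
      linarith
    · exact h1
  have hev : ∀ᶠ t in 𝓝[>] s, c < h t := by
    filter_upwards [Ioc_mem_nhdsGT hsb] with t ht using hup t ht
  have heq : h s = c := by
    apply le_antisymm hm.2
    have h1 : Filter.Tendsto h (𝓝[>] s) (𝓝 (h s)) := hc.continuousAt.mono_left nhdsWithin_le_nhds
    exact ge_of_tendsto h1 (hev.mono fun t ht => ht.le)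
  refine ⟨s, ⟨hm.1.1, hsb⟩, heq, ?_⟩
  have h2 := (hd s).tendsto_slope_zero_right
  apply ge_of_tendsto h2
  have h3 : Filter.Tendsto (fun t => s + t) (𝓝[>] (0:ℝ)) (𝓝[>] s) := by
    apply tendsto_nhdsWithin_iff.2
    constructor
    · have : Filter.Tendsto (fun t => s + t) (𝓝 (0:ℝ)) (𝓝 (s + 0)) := (continuous_const.add continuous_id).tendsto 0
      rw [add_zero] at this
      exact this.mono_left nhdsWithin_le_nhds
    · filter_upwards [self_mem_nhdsWithin] with t ht
      have : 0 < t := ht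
      show s < s + t
      linarith
  filter_upwards [h3.eventually hev, self_mem_nhdsWithin] with t ht ht0
  have : 0 < t := ht0
  rw [heq, smul_eq_mul]
  exact mul_nonneg (inv_nonneg.2 this.le) (by linarith)

theorem cross_down {h d : ℝ → ℝ} (hd : ∀ s, HasDerivAt h (d s) s) {a b c : ℝ} (hab : a ≤ b)
    (ha : c < h a) (hb : h b ≤ c) : ∃ s ∈ Ioc a b, h s = c ∧ d s ≤ 0 := by
  have hd' : ∀ s, HasDerivAt (fun t => h (-t)) (-d (-s)) s := by
    intro s
    have h0 : HasDerivAt (fun t : ℝ => -t) (-1) s := hasDerivAt_neg s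
    have h1 := HasDerivAt.comp s (hd (-s)) h0
    rw [mul_neg_one] at h1
    exact h1
  obtain ⟨s, hs, h1, h2⟩ := cross_up hd' (a := -b) (b := -a) (c := c) (by linarith) (by simpa using hb) (by simpa using ha)
  exact ⟨-s, ⟨by linarith [hs.2], by linarith [hs.1]⟩, h1, by linarith⟩

theorem oneD {h d : ℝ → ℝ} {s1 s2 δ : ℝ} (hδ : 0 < δ) (hd : ∀ s, HasDerivAt h (d s) s)
    (nk : ∀ s t, |t - s| < δ → h s = h t → d s = d t)
    {c0 : ℝ} (hc0 : c0 ∈ Icc s1 s2) (h1 : h s1 < h c0) (h2 : h s2 < h c0) :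
    ∃ p, s1 < p ∧ p + δ ≤ s2 ∧ (∀ s ∈ Icc s1 s2, h s ≤ h p) ∧ (∀ s ∈ Ico s1 p, h s < h p) ∧
      ∀ s ∈ Icc p (p + δ), h s = h p := by
  have hc : Continuous h := continuous_iff_continuousAt.2 fun s => (hd s).continuousAt
  obtain ⟨z, hz, hmax⟩ := isCompact_Icc.exists_isMaxOn ⟨c0, hc0⟩ hc.continuousOn
  have hmax' : ∀ s ∈ Icc s1 s2, h s ≤ h z := fun s hs => hmax hs
  let S := Icc s1 s2 ∩ {s | h s = h z}
  have hS : IsCompact S := isCompact_Icc.inter_right (isClosed_eq hc continuous_const)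
  have hm := hS.sInf_mem ⟨z, hz, rfl⟩
  set p := sInf S with hp
  have hpz : h p = h z := hm.2
  have hM1 : h s1 < h p := by rw [hpz]; exact h1.trans_le (hmax' _ hc0)
  have hM2 : h s2 < h p := by rw [hpz]; exact h2.trans_le (hmax' _ hc0)
  have hlt : ∀ s ∈ Ico s1 p, h s < h p := by
    intro s hs
    have hsI : s ∈ Icc s1 s2 := ⟨hs.1, hs.2.le.trans hm.1.2⟩
    rw [hpz]
    apply lt_of_le_of_ne (hmax' s hsI)
    intro he
    have := csInf_le hS.bddBelow (show s ∈ S from ⟨hsI, he⟩)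
    exact absurd hs.2 (not_lt.2 this)
  have hs1p : s1 < p := by
    rcases hm.1.1.eq_or_lt with h3 | h3
    · rw [← h3] at hM1; exact absurd hM1 (lt_irrefl _)
    · exact h3
  have hps2 : p < s2 := by
    rcases hm.1.2.eq_or_lt with h3 | h3
    · rw [h3] at hM2; exact absurd hM2 (lt_irrefl _)
    · exact h3
  have noq : ∀ q, p < q → q < p + δ → q ≤ s2 → h q = h p := by
    intro q hq1 hq2 hq3
    by_contra hne
    have hql : h q < h p := lt_of_le_of_ne (by rw [hpz]; exact hmax' q ⟨hs1p.le.trans hq1.le, hq3⟩) hne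
    let s' := max s1 (p - (δ - (q - p)) / 2)
    have hs'1 : s1 ≤ s' := le_max_left _ _
    have hs'2 : s' < p := max_lt hs1p (by linarith)
    have hs'3 : q - s' < δ := by
      have : p - (δ - (q - p)) / 2 ≤ s' := le_max_right _ _
      linarith
    have hls' : h s' < h p := hlt s' ⟨hs'1, hs'2⟩
    have hsub : Ioo (max (h s') (h q)) (h p) ⊆ h '' {s | d s = 0} := by
      intro c hcI
      obtain ⟨a, ha, ha1, ha2⟩ := cross_up hd hs'2.le ((le_max_left _ _).trans hcI.1.le) hcI.2
      obtain ⟨b, hb, hb1, hb2⟩ := cross_down hd hq1.le hcI.2 ((le_max_right _ _).trans hcI.1.le)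
      have e1 := nk a b (by
        rw [abs_of_pos (by linarith [ha.2, hb.1])]
        linarith [ha.1, hb.2]) (by rw [ha1, hb1])
      refine ⟨a, ?_, ha1⟩
      show d a = 0
      linarith
    have h3 := measure_mono_null hsub (crit_null hd)
    rw [Real.volume_Ioo, ENNReal.ofReal_eq_zero] at h3
    have : max (h s') (h q) < h p := max_lt hls' hql
    linarith
  have hpd : p + δ ≤ s2 := by
    by_contra hcon
    have := noq s2 hps2 (not_le.1 hcon) le_rfl
    linarith
  refine ⟨p, hs1p, hpd, fun s hs => by rw [hpz]; exact hmax' s hs, hlt, ?_⟩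
  intro s hs
  have hcl : Icc p (p + δ) ⊆ {s | h s = h p} := by
    have h3 : Ioo p (p + δ) ⊆ {s | h s = h p} := fun q hq => noq q hq.1 hq.2 (hq.2.le.trans hpd)
    have h4 := closure_minimal h3 (isClosed_eq hc continuous_const)
    rwa [closure_Ioo (by linarith)] at h4
  exact hcl hs

end

open Set Metric MeasureTheory Bornology
open scoped RealInnerProductSpace Classical Topology

noncomputable section

section st3
variable {N : ℕ} {R ε : ℝ} {g f : ℝ → ℝ} {u : Eu N → ℝ} {D : Eu N → Eu N} {e1 e2 : Eu N}

theorem plateau {h n : ℝ → ℝ} {δ : ℝ} (hδ : 0 < δ) (hc : Continuous h) (nc : Continuous n)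
    (hmax : ∀ s, h s ≤ h 0) (hne : ∃ s, 0 ≤ s ∧ h s ≠ h 0) (n0 : n 0 ≠ 0)
    (nk : ∀ s t, |t - s| < δ → h s = h t → n s = n t) :
    ∃ s2, 0 < s2 ∧ h s2 < h 0 ∧ ∀ s ∈ Icc 0 s2, n s ≠ 0 := by
  obtain ⟨z, hz0, hz⟩ := hne
  let S := Ici (0 : ℝ) ∩ {s | ∀ t ∈ Icc 0 s, h t = h 0}
  have h0S : (0 : ℝ) ∈ S := ⟨mem_Ici.2 le_rfl, fun t ht => by rw [le_antisymm ht.2 ht.1]⟩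
  have hbd : ∀ s ∈ S, s ≤ z := by
    intro s hs
    by_contra hcon
    exact hz (hs.2 z ⟨hz0, (not_le.1 hcon).le⟩)
  have hBA : BddAbove S := ⟨z, hbd⟩
  set q := sSup S with hq
  have hq0 : 0 ≤ q := le_csSup hBA h0S
  have hlt : ∀ t, 0 ≤ t → t < q → h t = h 0 := by
    intro t ht htq
    obtain ⟨s, hs, hts⟩ := exists_lt_of_lt_csSup ⟨0, h0S⟩ htq
    exact hs.2 t ⟨ht, hts.le⟩
  have hle : ∀ t ∈ Icc 0 q, h t = h 0 := by
    intro t ht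
    rcases ht.2.eq_or_lt with e | e
    · rcases hq0.eq_or_lt with e0 | e0
      · rw [e, ← e0]
      · have h3 : Ioo 0 q ⊆ {s | h s = h 0} := fun s hs => hlt s hs.1.le hs.2
        have h4 := closure_minimal h3 (isClosed_eq hc continuous_const)
        rw [closure_Ioo e0.ne] at h4
        exact h4 ht
    · exact hlt t ht.1 e
  have hind : ∀ k : ℕ, ∀ s ∈ Icc 0 q, s ≤ k * (δ / 2) → n s = n 0 := by
    intro k
    induction k with
    | zero =>
      intro s hs h1
      have : s = 0 := le_antisymm (by simpa using h1) hs.1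
      rw [this]
    | succ k ih =>
      intro s hs h1
      push_cast at h1
      rcases le_or_gt s (δ / 2) with h2 | h2
      · apply nk
        · rw [abs_lt]; constructor <;> linarith [hs.1]
        · exact hle s hs
      · have hs' : s - δ / 2 ∈ Icc 0 q := ⟨by linarith, by linarith [hs.2]⟩
        rw [← ih (s - δ / 2) hs' (by linarith)]
        apply nk
        · rw [abs_lt]; constructor <;> linarith
        · rw [hle _ hs, hle _ hs']
  have hn : ∀ s ∈ Icc 0 q, n s ≠ 0 := by
    intro s hs
    obtain ⟨k, hk⟩ := exists_nat_ge (s / (δ / 2))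
    rw [hind k s hs ((div_le_iff₀ (by linarith)).1 hk)]; exact n0
  have hev : ∀ᶠ s in 𝓝 q, n s ≠ 0 := nc.continuousAt.eventually_ne (hn q ⟨hq0, le_rfl⟩)
  obtain ⟨η, hη, hev⟩ := Metric.eventually_nhds_iff.1 hev
  have hns : q + η / 2 ∉ S := by
    intro hcon
    have := le_csSup hBA hcon
    linarith
  have : ∃ t ∈ Icc 0 (q + η / 2), h t ≠ h 0 := by
    by_contra hcon
    push Not at hcon
    exact hns ⟨show (0:ℝ) ≤ q + η / 2 by linarith, hcon⟩
  obtain ⟨t, ht, hne⟩ := this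
  have hqt : q < t := by
    by_contra hcon
    exact hne (hle t ⟨ht.1, not_lt.1 hcon⟩)
  refine ⟨t, by linarith, lt_of_le_of_ne (hmax t) hne, fun s hs => ?_⟩
  rcases le_or_gt s q with h1 | h1
  · exact hn s ⟨hs.1, h1⟩
  · apply hev
    rw [Real.dist_eq, abs_lt]; constructor <;> linarith [hs.2, ht.2]

theorem Base.pos_of_D (hb : Base R ε g f u D) {x : Eu N} (hx : x ∈ ball (0 : Eu N) R) (hD : D x ≠ 0) :
    x ∈ OO R u := by
  refine ⟨hx, ?_⟩
  show 0 < u x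
  rcases (hb.nonneg x).eq_or_lt with h1 | h1
  · exfalso
    apply hD
    have hc : HasGradientAt (fun _ : Eu N => (0 : ℝ)) 0 x := hasGradientAt_const x 0
    exact grad_eq_of_le hc (hb.adm.grad x hx) (Filter.Eventually.of_forall fun y => hb.nonneg y) h1.symm
  · exact h1

theorem Base.arc_core (hb : Base R ε g f u D) (h : OP e1 e2) {α : ℝ} (hα : SmallR R ε u D (rotE h α))
    {x0 : Eu N} {s1 s2 : ℝ} {r : ℝ} (hr : 0 < r) (hV : ∀ x ∈ ball x0 r, x ∈ ball (0 : Eu N) R)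
    (hD : ∀ x ∈ ball x0 r, ∀ s ∈ Icc s1 s2, D (rotF e1 e2 s x) ≠ 0)
    (hq : ∀ x ∈ ball x0 r, ∃ q : ℚ, (q : ℝ) ∈ Icc s1 s2 ∧ u (rotF e1 e2 (q + α) x) ≤ u (rotF e1 e2 q x))
    (hs : ∀ x ∈ ball x0 r, ∃ s ∈ Icc s1 s2, u (rotF e1 e2 s x) < u (rotF e1 e2 (s + α) x)) : False := by
  have crot : ∀ s : ℝ, Continuous (fun x : Eu N => rotF e1 e2 s x) := fun s =>
    (rotF_cont (e1 := e1) (e2 := e2)).comp (continuous_const.prodMk continuous_id)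
  let F : Option {q : ℚ // (q : ℝ) ∈ Icc s1 s2} → Set (Eu N) := fun o =>
    match o with
    | none => (ball x0 r)ᶜ
    | some q => {x | u (rotF e1 e2 (q.1 + α) x) ≤ u (rotF e1 e2 q.1 x)}
  have hFc : ∀ o, IsClosed (F o) := by
    intro o
    cases o with
    | none => exact isOpen_ball.isClosed_compl
    | some q => exact isClosed_le (hb.uc.comp (crot _)) (hb.uc.comp (crot _))
  have hFU : ⋃ o, F o = univ := by
    apply eq_univ_of_forall
    intro x
    by_cases hx : x ∈ ball x0 r
    · obtain ⟨q, hq1, hq2⟩ := hq x hx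
      exact mem_iUnion.2 ⟨some ⟨q, hq1⟩, hq2⟩
    · exact mem_iUnion.2 ⟨none, hx⟩
  have hdense := dense_iUnion_interior_of_closed hFc hFU
  obtain ⟨x1, hx1, hx1b⟩ := hdense.exists_mem_open (isOpen_ball (x := x0) (ε := r)) ⟨x0, mem_ball_self hr⟩
  obtain ⟨o, ho⟩ := mem_iUnion.1 hx1
  cases o with
  | none => exact (interior_subset ho) hx1b
  | some q =>
    have hsolu := hb.sol
    have hsolm := hb.sol_m hα
    set m := mU (rotE h α) u with hm
    let Z : Set (Eu N) := {x | m x = u x}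
    have hZ : ∀ x, x ∈ Z ↔ u (rotF e1 e2 α x) ≤ u x := by
      intro x
      show u x + max (u (rotF e1 e2 α x) - u x) 0 = u x ↔ _
      constructor
      · intro h1
        have : max (u (rotF e1 e2 α x) - u x) 0 = 0 := by linarith
        have := le_max_left (u (rotF e1 e2 α x) - u x) 0
        linarith
      · intro h1
        rw [max_eq_right (by linarith), add_zero]
    have hlem : ∀ x ∈ OO R u, u x ≤ m x := by
      intro x _
      show u x ≤ u x + max (u (rotF e1 e2 α x) - u x) 0
      linarith [le_max_right (u (rotF e1 e2 α x) - u x) 0]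
    let A := (fun s => rotF e1 e2 s x1) '' Icc s1 s2
    have hA : IsPreconnected A := isPreconnected_Icc.image _ (rotF_cont1 x1).continuousOn
    have hAD : ∀ x ∈ A, x ∈ OO R u ∧ D x ≠ 0 := by
      rintro x ⟨s, hsI, rfl⟩
      have := hD x1 hx1b s hsI
      exact ⟨hb.pos_of_D (rotF_ball h (hV x1 hx1b)) this, this⟩
    have heqI : rotF e1 e2 q.1 x1 ∈ interior Z := by
      rw [mem_interior_iff_mem_nhds]
      have h1 : ∀ᶠ y in 𝓝 x1, u (rotF e1 e2 (q.1 + α) y) ≤ u (rotF e1 e2 q.1 y) :=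
        mem_interior_iff_mem_nhds.1 ho
      have h2 : Filter.Tendsto (fun z => rotF e1 e2 (-(q.1 : ℝ)) z) (𝓝 (rotF e1 e2 q.1 x1)) (𝓝 x1) := by
        have h3 := (crot (-(q.1 : ℝ))).tendsto (rotF e1 e2 q.1 x1)
        rwa [rotF_add h, neg_add_cancel, rotF_zero] at h3
      filter_upwards [h2.eventually h1] with z hz
      rw [rotF_add h, rotF_add h] at hz
      rw [hZ]
      rw [show (q.1 : ℝ) + α + -(q.1 : ℝ) = α by ring, add_neg_cancel, rotF_zero] at hz
      exact hz
    have hsub : A ⊆ interior Z := by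
      apply hA.subset_of_closure_inter_subset isOpen_interior
      · exact ⟨rotF e1 e2 q.1 x1, ⟨q.1, q.2, rfl⟩, heqI⟩
      · rintro x ⟨hx, hxA⟩
        rw [mem_interior_iff_mem_nhds]
        exact luc hb.gd hb.fc hsolu hsolm hlem (hAD x hxA).1 (hAD x hxA).2 hx
    obtain ⟨s, hsI, hlt⟩ := hs x1 hx1b
    have h5 := (hZ _).1 (interior_subset (hsub ⟨s, hsI, rfl⟩))
    simp only at h5
    rw [rotF_add h, add_comm] at h5
    linarith

theorem Base.nbhd (hb : Base R ε g f u D) {x0 : Eu N} (hx0 : x0 ∈ ball (0 : Eu N) R) {s1 s2 : ℝ}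
    (hD : ∀ s ∈ Icc s1 s2, D (rotF e1 e2 s x0) ≠ 0) :
    ∀ᶠ x in 𝓝 x0, x ∈ ball (0 : Eu N) R ∧ ∀ s ∈ Icc s1 s2, D (rotF e1 e2 s x) ≠ 0 := by
  have h1 : ∀ᶠ x in 𝓝 x0, x ∈ ball (0 : Eu N) R := isOpen_ball.mem_nhds hx0
  have h2 : ∀ᶠ x in 𝓝 x0, ∀ s ∈ Icc s1 s2, D (rotF e1 e2 s x) ≠ 0 := by
    apply (isCompact_Icc (a := s1) (b := s2)).eventually_forall_of_forall_eventually
    intro s hs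
    have hc : Continuous (fun p : Eu N × ℝ => D (rotF e1 e2 p.2 p.1)) :=
      hb.dc.comp ((rotF_cont (e1 := e1) (e2 := e2)).comp (continuous_snd.prodMk continuous_fst))
    exact hc.continuousAt.eventually_ne (hD s hs)
  exact h1.and h2

theorem Base.no_max (hb : Base R ε g f u D) (h : OP e1 e2) {x0 : Eu N} (hx0 : x0 ∈ ball (0 : Eu N) R)
    {s1 s2 : ℝ} (hs1 : s1 ≤ 0) (hs2 : 0 ≤ s2) (hD : ∀ s ∈ Icc s1 s2, D (rotF e1 e2 s x0) ≠ 0)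
    (h1 : u (rotF e1 e2 s1 x0) < u x0) (h2 : u (rotF e1 e2 s2 x0) < u x0) : False := by
  obtain ⟨δ, hδ, hsm⟩ := hb.small h
  have crot : ∀ s : ℝ, Continuous (fun x : Eu N => rotF e1 e2 s x) := fun s =>
    (rotF_cont (e1 := e1) (e2 := e2)).comp (continuous_const.prodMk continuous_id)
  have ev1 : ∀ᶠ x in 𝓝 x0, u (rotF e1 e2 s1 x) < u x :=
    (hb.uc.comp (crot s1)).continuousAt.eventually_lt hb.uc.continuousAt h1
  have ev2 : ∀ᶠ x in 𝓝 x0, u (rotF e1 e2 s2 x) < u x :=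
    (hb.uc.comp (crot s2)).continuousAt.eventually_lt hb.uc.continuousAt h2
  obtain ⟨r, hr, hev⟩ := Metric.eventually_nhds_iff.1 ((hb.nbhd hx0 hD).and (ev1.and ev2))
  have key : ∀ x ∈ ball x0 r, ∃ p, s1 < p ∧ p + δ ≤ s2 ∧
      (∀ s ∈ Icc s1 s2, u (rotF e1 e2 s x) ≤ u (rotF e1 e2 p x)) ∧
      (∀ s ∈ Ico s1 p, u (rotF e1 e2 s x) < u (rotF e1 e2 p x)) ∧
      ∀ s ∈ Icc p (p + δ), u (rotF e1 e2 s x) = u (rotF e1 e2 p x) := by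
    intro x hx
    obtain ⟨⟨k1, k2⟩, k3, k4⟩ := hev hx
    exact oneD (h := fun s => u (rotF e1 e2 s x)) hδ (hb.circ_deriv h k1)
      (fun s t hst heq => hb.circ_nokink_d h hsm k1 hst heq) (c0 := 0) ⟨hs1, hs2⟩
      (by show u (rotF e1 e2 s1 x) < u (rotF e1 e2 0 x); rw [rotF_zero]; exact k3)
      (by show u (rotF e1 e2 s2 x) < u (rotF e1 e2 0 x); rw [rotF_zero]; exact k4)
  apply hb.arc_core h (α := δ / 2) (hsm _ (by rw [abs_of_pos] <;> linarith)) hr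
    (fun x hx => (hev hx).1.1) (fun x hx => (hev hx).1.2)
  · intro x hx
    obtain ⟨p, p1, p2, p3, p4, p5⟩ := key x hx
    obtain ⟨q, q1, q2⟩ := exists_rat_btwn (show p < p + δ / 2 by linarith)
    refine ⟨q, ⟨by linarith, by linarith⟩, ?_⟩
    rw [p5 q ⟨by linarith, by linarith⟩, p5 (q + δ / 2) ⟨by linarith, by linarith⟩]
  · intro x hx
    obtain ⟨p, p1, p2, p3, p4, p5⟩ := key x hx
    have a1 : s1 ≤ max s1 (p - δ / 4) := le_max_left _ _
    have a2 : p - δ / 4 ≤ max s1 (p - δ / 4) := le_max_right _ _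
    have a3 : max s1 (p - δ / 4) < p := max_lt p1 (by linarith)
    refine ⟨max s1 (p - δ / 4), ⟨a1, by linarith⟩, ?_⟩
    rw [p5 (max s1 (p - δ / 4) + δ / 2) ⟨by linarith, by linarith⟩]
    exact p4 _ ⟨a1, a3⟩

theorem Base.no_min (hb : Base R ε g f u D) (h : OP e1 e2) {x0 : Eu N} (hx0 : x0 ∈ ball (0 : Eu N) R)
    {s1 s2 : ℝ} (hs1 : s1 ≤ 0) (hs2 : 0 ≤ s2) (hD : ∀ s ∈ Icc s1 s2, D (rotF e1 e2 s x0) ≠ 0)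
    (h1 : u x0 < u (rotF e1 e2 s1 x0)) (h2 : u x0 < u (rotF e1 e2 s2 x0)) : False := by
  obtain ⟨δ, hδ, hsm⟩ := hb.small h
  have crot : ∀ s : ℝ, Continuous (fun x : Eu N => rotF e1 e2 s x) := fun s =>
    (rotF_cont (e1 := e1) (e2 := e2)).comp (continuous_const.prodMk continuous_id)
  have ev1 : ∀ᶠ x in 𝓝 x0, u x < u (rotF e1 e2 s1 x) :=
    hb.uc.continuousAt.eventually_lt (hb.uc.comp (crot s1)).continuousAt h1
  have ev2 : ∀ᶠ x in 𝓝 x0, u x < u (rotF e1 e2 s2 x) :=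
    hb.uc.continuousAt.eventually_lt (hb.uc.comp (crot s2)).continuousAt h2
  obtain ⟨r, hr, hev⟩ := Metric.eventually_nhds_iff.1 ((hb.nbhd hx0 hD).and (ev1.and ev2))
  have key : ∀ x ∈ ball x0 r, ∃ p, p < s2 ∧ s1 ≤ p - δ ∧
      (∀ s ∈ Ioc p s2, u (rotF e1 e2 p x) < u (rotF e1 e2 s x)) ∧
      ∀ s ∈ Icc (p - δ) p, u (rotF e1 e2 s x) = u (rotF e1 e2 p x) := by
    intro x hx
    obtain ⟨⟨k1, k2⟩, k3, k4⟩ := hev hx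
    have hd : ∀ s, HasDerivAt (fun s => -u (rotF e1 e2 (-s) x))
        ⟪D (rotF e1 e2 (-s) x), genJ e1 e2 (rotF e1 e2 (-s) x)⟫ s := by
      intro s
      have h0 : HasDerivAt (fun t : ℝ => -t) (-1) s := hasDerivAt_neg s
      have h1 := (HasDerivAt.comp s (hb.circ_deriv h k1 (-s)) h0).neg
      rw [mul_neg_one, neg_neg] at h1
      exact h1
    obtain ⟨p, p1, p2, p3, p4, p5⟩ := oneD (h := fun s => -u (rotF e1 e2 (-s) x)) (s1 := -s2) (s2 := -s1) hδ hd
      (fun s t hst heq => hb.circ_nokink_d h hsm k1 (s := -s) (t := -t)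
        (by rw [show -t - -s = -(t - s) by ring, abs_neg]; exact hst) (neg_injective heq)) (c0 := 0) ⟨by linarith, by linarith⟩
      (by show -u (rotF e1 e2 (- -s2) x) < -u (rotF e1 e2 (-0) x); rw [neg_neg, neg_zero, rotF_zero]; linarith)
      (by show -u (rotF e1 e2 (- -s1) x) < -u (rotF e1 e2 (-0) x); rw [neg_neg, neg_zero, rotF_zero]; linarith)
    refine ⟨-p, by linarith, by linarith, ?_, ?_⟩
    · intro s hs
      have := p4 (-s) ⟨by linarith [hs.2], by linarith [hs.1]⟩
      simp only [neg_neg] at this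
      linarith
    · intro s hs
      have := p5 (-s) ⟨by linarith [hs.2], by linarith [hs.1]⟩
      simp only [neg_neg] at this
      linarith
  apply hb.arc_core h (α := δ / 2) (hsm _ (by rw [abs_of_pos] <;> linarith)) hr
    (fun x hx => (hev hx).1.1) (fun x hx => (hev hx).1.2)
  · intro x hx
    obtain ⟨p, p1, p2, p4, p5⟩ := key x hx
    obtain ⟨q, q1, q2⟩ := exists_rat_btwn (show p - δ < p - δ / 2 by linarith)
    refine ⟨q, ⟨by linarith, by linarith⟩, ?_⟩
    rw [p5 q ⟨by linarith, by linarith⟩, p5 (q + δ / 2) ⟨by linarith, by linarith⟩]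
  · intro x hx
    obtain ⟨p, p1, p2, p4, p5⟩ := key x hx
    have a1 : min s2 (p + δ / 4) ≤ s2 := min_le_left _ _
    have a2 : min s2 (p + δ / 4) ≤ p + δ / 4 := min_le_right _ _
    have a3 : p < min s2 (p + δ / 4) := lt_min p1 (by linarith)
    refine ⟨min s2 (p + δ / 4) - δ / 2, ⟨by linarith, by linarith⟩, ?_⟩
    rw [p5 (min s2 (p + δ / 4) - δ / 2) ⟨by linarith, by linarith⟩, sub_add_cancel]
    exact p4 _ ⟨a3, a1⟩

theorem rotF_per_n (n : ℕ) (s : ℝ) (x : Eu N) : rotF e1 e2 (s + n * (2 * Real.pi)) x = rotF e1 e2 s x := by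
  unfold rotF; rw [Real.cos_add_nat_mul_two_pi, Real.sin_add_nat_mul_two_pi]

theorem rotF_rep (s : ℝ) (x : Eu N) : (∃ t, 0 ≤ t ∧ rotF e1 e2 t x = rotF e1 e2 s x) ∧
    ∃ t, 0 ≤ t ∧ rotF e1 e2 (-t) x = rotF e1 e2 s x := by
  obtain ⟨n, hn⟩ := exists_nat_ge (|s| / (2 * Real.pi))
  have hn' := (div_le_iff₀ (by positivity)).1 hn
  constructor
  · exact ⟨s + n * (2 * Real.pi), by linarith [neg_abs_le s], rotF_per_n n s x⟩
  · refine ⟨-(s - n * (2 * Real.pi)), by linarith [le_abs_self s], ?_⟩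
    rw [neg_neg, ← rotF_per_n n, sub_add_cancel]

/-- (III): at a maximum point of `u` along a nonconstant circle the gradient vanishes -/
theorem Base.max_crit (hb : Base R ε g f u D) (h : OP e1 e2) {x0 : Eu N} (hx0 : x0 ∈ ball (0 : Eu N) R)
    (hmax : ∀ s, u (rotF e1 e2 s x0) ≤ u x0) (hne : ∃ s, u (rotF e1 e2 s x0) ≠ u x0) : D x0 = 0 := by
  by_contra hD
  obtain ⟨δ, hδ, hsm⟩ := hb.small h
  obtain ⟨s, hs⟩ := hne
  obtain ⟨⟨t1, ht1, e1'⟩, t2, ht2, e2'⟩ := rotF_rep (e1 := e1) (e2 := e2) s x0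
  have cr := rotF_cont1 (e1 := e1) (e2 := e2) x0
  have cr' : Continuous (fun s => rotF e1 e2 (-s) x0) := cr.comp continuous_neg
  obtain ⟨b, hb0, hb1, hb2⟩ := plateau (h := fun s => u (rotF e1 e2 s x0)) (n := fun s => ‖D (rotF e1 e2 s x0)‖) hδ
    (hb.uc.comp cr) (hb.dc.comp cr).norm (by intro s; simp only [rotF_zero]; exact hmax s)
    ⟨t1, ht1, by simp only [rotF_zero, e1']; exact hs⟩ (by simp only [rotF_zero]; exact norm_ne_zero_iff.2 hD)
    (fun s t hst heq => hb.circ_nokink_n h hsm hx0 hst heq)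
  obtain ⟨a, ha0, ha1, ha2⟩ := plateau (h := fun s => u (rotF e1 e2 (-s) x0)) (n := fun s => ‖D (rotF e1 e2 (-s) x0)‖) hδ
    (hb.uc.comp cr') (hb.dc.comp cr').norm (by intro s; simp only [neg_zero, rotF_zero]; exact hmax _)
    ⟨t2, ht2, by simp only [neg_zero, rotF_zero, e2']; exact hs⟩ (by simp only [neg_zero, rotF_zero]; exact norm_ne_zero_iff.2 hD)
    (fun s t hst heq => hb.circ_nokink_n h hsm hx0 (by rw [show -t - -s = -(t - s) by ring, abs_neg]; exact hst) heq)
  simp only [rotF_zero, neg_zero] at hb1 ha1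
  refine hb.no_max h hx0 (s1 := -a) (s2 := b) (by linarith) hb0.le (fun s hs => ?_) ha1 hb1
  rcases le_or_gt 0 s with h0 | h0
  · exact norm_ne_zero_iff.1 (hb2 s ⟨h0, hs.2⟩)
  · have := ha2 (-s) ⟨by linarith, by linarith [hs.1]⟩
    simp only [neg_neg] at this
    exact norm_ne_zero_iff.1 this

theorem Base.min_crit (hb : Base R ε g f u D) (h : OP e1 e2) {x0 : Eu N} (hx0 : x0 ∈ ball (0 : Eu N) R)
    (hmin : ∀ s, u x0 ≤ u (rotF e1 e2 s x0)) (hne : ∃ s, u (rotF e1 e2 s x0) ≠ u x0) : D x0 = 0 := by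
  by_contra hD
  obtain ⟨δ, hδ, hsm⟩ := hb.small h
  obtain ⟨s, hs⟩ := hne
  obtain ⟨⟨t1, ht1, e1'⟩, t2, ht2, e2'⟩ := rotF_rep (e1 := e1) (e2 := e2) s x0
  have cr := rotF_cont1 (e1 := e1) (e2 := e2) x0
  have cr' : Continuous (fun s => rotF e1 e2 (-s) x0) := cr.comp continuous_neg
  obtain ⟨b, hb0, hb1, hb2⟩ := plateau (h := fun s => -u (rotF e1 e2 s x0)) (n := fun s => ‖D (rotF e1 e2 s x0)‖) hδ
    (hb.uc.comp cr).neg (hb.dc.comp cr).norm (by intro s; simp only [rotF_zero]; exact neg_le_neg (hmin s))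
    ⟨t1, ht1, by simp only [rotF_zero, e1']; exact fun hh => hs (neg_injective hh)⟩ (by simp only [rotF_zero]; exact norm_ne_zero_iff.2 hD)
    (fun s t hst heq => hb.circ_nokink_n h hsm hx0 hst (neg_injective heq))
  obtain ⟨a, ha0, ha1, ha2⟩ := plateau (h := fun s => -u (rotF e1 e2 (-s) x0)) (n := fun s => ‖D (rotF e1 e2 (-s) x0)‖) hδ
    (hb.uc.comp cr').neg (hb.dc.comp cr').norm (by intro s; simp only [neg_zero, rotF_zero]; exact neg_le_neg (hmin _))
    ⟨t2, ht2, by simp only [neg_zero, rotF_zero, e2']; exact fun hh => hs (neg_injective hh)⟩ (by simp only [neg_zero, rotF_zero]; exact norm_ne_zero_iff.2 hD)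
    (fun s t hst heq => hb.circ_nokink_n h hsm hx0 (by rw [show -t - -s = -(t - s) by ring, abs_neg]; exact hst) (neg_injective heq))
  simp only [rotF_zero, neg_zero] at hb1 ha1
  refine hb.no_min h hx0 (s1 := -a) (s2 := b) (by linarith) hb0.le (fun s hs => ?_) (by linarith) (by linarith)
  rcases le_or_gt 0 s with h0 | h0
  · exact norm_ne_zero_iff.1 (hb2 s ⟨h0, hs.2⟩)
  · have := ha2 (-s) ⟨by linarith, by linarith [hs.1]⟩
    simp only [neg_neg] at this
    exact norm_ne_zero_iff.1 this

end st3
end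

open Set Metric MeasureTheory Bornology
open scoped RealInnerProductSpace Classical Topology

noncomputable section

section st4
variable {N : ℕ} {R ε : ℝ} {g f : ℝ → ℝ} {u : Eu N → ℝ} {D : Eu N → Eu N} {e1 e2 : Eu N}

/-- envelope lemma -/
theorem envelope {Φ : ℝ → ℝ → ℝ} (hΦ : Continuous (fun p : ℝ × ℝ => Φ p.1 p.2)) {K : Set ℝ} (hK : IsCompact K)
    (hne : K.Nonempty) {a b : ℝ} (hab : a ≤ b)
    (hd : ∀ r ∈ Ioc a b, ∀ θ ∈ K, (∀ t ∈ K, Φ r t ≤ Φ r θ) → HasDerivAt (fun r => Φ r θ) 0 r) :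
    ∀ θ ∈ K, ∃ t ∈ K, Φ b θ ≤ Φ a t := by
  let c : ℝ → ℝ := fun r => sSup (Φ r '' K)
  have hcc : Continuous c := hK.continuous_sSup hΦ
  have hcr : ∀ r, Continuous (Φ r) := fun r => hΦ.comp (continuous_const.prodMk continuous_id)
  have hle : ∀ r, ∀ θ ∈ K, Φ r θ ≤ c r := fun r θ hθ =>
    le_csSup (hK.image (hcr r)).bddAbove ⟨θ, hθ, rfl⟩
  have hatt : ∀ r, ∃ θ ∈ K, Φ r θ = c r := fun r => (hK.image (hcr r)).sSup_mem (hne.image _)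
  have hmain : ∀ ⦃x⦄, x ∈ Icc (-b) (-a) → -c (-x) ≤ -c b := by
    refine image_le_of_liminf_slope_right_le_deriv_boundary (f := fun x => -c (-x)) (B := fun _ => -c b) (B' := fun _ => 0)
      (hcc.comp continuous_neg).neg.continuousOn (by simp) continuousOn_const
      (fun x _ => hasDerivWithinAt_const _ _ _) ?_
    intro x hx r hr
    apply Filter.Eventually.frequently
    obtain ⟨θ, hθ, hθe⟩ := hatt (-x)
    have h1 := hd (-x) ⟨by linarith [hx.2], by linarith [hx.1]⟩ θ hθ (fun t ht => by rw [hθe]; exact hle _ t ht)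
    have h0 : HasDerivAt (fun t : ℝ => -t) (-1) x := hasDerivAt_neg x
    have h2 := (HasDerivAt.comp x h1 h0).neg
    rw [zero_mul, neg_zero] at h2
    have h3 := (hasDerivAt_iff_tendsto_slope.1 h2).mono_left (nhdsWithin_mono x (show Ioi x ⊆ {x}ᶜ from fun y hy => (ne_of_gt hy)))
    filter_upwards [h3.eventually_lt_const hr, self_mem_nhdsWithin] with z hz hzx
    have hzx' : x < z := hzx
    refine lt_of_le_of_lt ?_ hz
    rw [slope_def_field, slope_def_field]
    apply div_le_div_of_nonneg_right _ (by linarith)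
    show -c (-z) - -c (-x) ≤ -Φ (-z) θ - -Φ (-x) θ
    rw [hθe]
    linarith [hle (-z) θ hθ]
  intro θ hθ
  obtain ⟨t, ht, hte⟩ := hatt a
  refine ⟨t, ht, ?_⟩
  have := hmain (x := -a) ⟨by linarith, le_rfl⟩
  rw [neg_neg] at this
  rw [hte]
  linarith [hle b θ hθ]

theorem rotF_mod (s : ℝ) (x : Eu N) : ∃ t ∈ Icc 0 (2 * Real.pi), rotF e1 e2 t x = rotF e1 e2 s x := by
  have hp : (0 : ℝ) < 2 * Real.pi := by positivity
  refine ⟨toIcoMod hp 0 s, ?_, ?_⟩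
  · have := toIcoMod_mem_Ico hp 0 s
    rw [zero_add] at this
    exact ⟨this.1, this.2.le⟩
  · have h1 : s = toIcoMod hp 0 s + (toIcoDiv hp 0 s : ℤ) * (2 * Real.pi) := by
      rw [← zsmul_eq_mul]; exact (toIcoMod_add_toIcoDiv_zsmul hp 0 s).symm
    conv_rhs => rw [h1]
    unfold rotF; rw [Real.cos_add_int_mul_two_pi, Real.sin_add_int_mul_two_pi]

theorem rotF_smul (h : OP e1 e2) (s r : ℝ) (x : Eu N) : rotF e1 e2 s (r • x) = r • rotF e1 e2 s x := by
  have := (rotE h s).map_smul r x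
  exact this

theorem OP.norm1 (h : OP e1 e2) : ‖e1‖ = 1 := by
  have := h.n1
  rw [real_inner_self_eq_norm_sq] at this
  nlinarith [norm_nonneg e1]

theorem Base.great (hb : Base R ε g f u D) (h : OP e1 e2) {r1 : ℝ} (h0 : 0 ≤ r1) (hR : r1 < R) (θ : ℝ) :
    u (rotF e1 e2 θ (r1 • e1)) = u (r1 • e1) := by
  have cP : Continuous (fun p : ℝ × ℝ => rotF e1 e2 p.2 (p.1 • e1)) :=
    (rotF_cont (e1 := e1) (e2 := e2)).comp (continuous_snd.prodMk (continuous_fst.smul continuous_const))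
  have cU : Continuous (fun p : ℝ × ℝ => u (rotF e1 e2 p.2 (p.1 • e1))) := hb.uc.comp cP
  have hball : ∀ r, 0 ≤ r → r < R → ∀ s, rotF e1 e2 s (r • e1) ∈ ball (0 : Eu N) R := by
    intro r hr0 hrR s
    apply rotF_ball h
    rw [mem_ball_zero_iff, norm_smul, h.norm1, mul_one, Real.norm_of_nonneg hr0]
    exact hrR
  let A : Set ℝ := Icc 0 r1 ∩ {r : ℝ | ∀ θ, u (rotF e1 e2 θ (r • e1)) = u (r • e1)}
  have hAc : IsCompact A := by
    apply isCompact_Icc.inter_right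
    have : {r : ℝ | ∀ θ, u (rotF e1 e2 θ (r • e1)) = u (r • e1)} =
        ⋂ θ, {r : ℝ | u (rotF e1 e2 θ (r • e1)) = u (r • e1)} := by ext r; simp
    rw [this]
    apply isClosed_iInter
    intro t
    have c1 : Continuous (fun r : ℝ => u (rotF e1 e2 t (r • e1))) := cU.comp (continuous_id.prodMk continuous_const)
    have c2 : Continuous (fun r : ℝ => r • e1) := continuous_id.smul continuous_const
    exact isClosed_eq c1 (hb.uc.comp c2)
  have h0A : (0 : ℝ) ∈ A := by
    refine ⟨⟨le_rfl, h0⟩, fun t => ?_⟩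
    rw [zero_smul]
    congr 1
    exact (rotE h t).map_zero
  have hm := hAc.sSup_mem ⟨0, h0A⟩
  set a := sSup A with ha
  have hnc : ∀ r ∈ Ioc a r1, ∃ t, u (rotF e1 e2 t (r • e1)) ≠ u (r • e1) := by
    intro r hr
    by_contra hcon
    push Not at hcon
    have : r ∈ A := ⟨⟨hm.1.1.trans hr.1.le, hr.2⟩, hcon⟩
    have := le_csSup hAc.bddAbove this
    exact absurd hr.1 (not_lt.2 this)
  have hnc' : ∀ r ∈ Ioc a r1, ∀ t, ∃ s, u (rotF e1 e2 s (rotF e1 e2 t (r • e1))) ≠ u (rotF e1 e2 t (r • e1)) := by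
    intro r hr t
    by_contra hcon
    push Not at hcon
    obtain ⟨t', ht'⟩ := hnc r hr
    apply ht'
    have q1 := hcon (t' - t)
    have q2 := hcon (-t)
    rw [rotF_add h, sub_add_cancel] at q1
    rw [rotF_add h, neg_add_cancel, rotF_zero] at q2
    rw [q1, q2]
  have hder : ∀ r ∈ Ioc a r1, ∀ t, D (rotF e1 e2 t (r • e1)) = 0 →
      HasDerivAt (fun r : ℝ => u (rotF e1 e2 t (r • e1))) 0 r := by
    intro r hr t hD
    have k1 := hgr_fd.1 (hb.adm.grad _ (hball r (hm.1.1.trans hr.1.le) (hr.2.trans_lt hR) t))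
    rw [hD] at k1
    have k2 : HasDerivAt (fun r : ℝ => r • rotF e1 e2 t e1) ((1 : ℝ) • rotF e1 e2 t e1) r := (hasDerivAt_id r).smul_const _
    have k2' : HasDerivAt (fun r : ℝ => rotF e1 e2 t (r • e1)) ((1 : ℝ) • rotF e1 e2 t e1) r := by
      have : (fun r : ℝ => rotF e1 e2 t (r • e1)) = fun r => r • rotF e1 e2 t e1 := by
        funext r; exact rotF_smul h t r e1
      rw [this]; exact k2
    have k3 := k1.comp_hasDerivAt r k2'
    rw [innerSL_apply_apply, inner_zero_left] at k3
    exact k3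
  have ex : ∀ θ, ∃ t ∈ Icc 0 (2 * Real.pi), u (rotF e1 e2 t (r1 • e1)) = u (rotF e1 e2 θ (r1 • e1)) := by
    intro θ
    obtain ⟨t, ht, e⟩ := rotF_mod (e1 := e1) (e2 := e2) θ (r1 • e1)
    exact ⟨t, ht, by rw [e]⟩
  have hpi : (0 : ℝ) ≤ 2 * Real.pi := by positivity
  have up : ∀ θ, u (rotF e1 e2 θ (r1 • e1)) ≤ u (a • e1) := by
    intro θ
    obtain ⟨t, ht, e⟩ := ex θ
    obtain ⟨t', ht', e'⟩ := envelope (Φ := fun r t => u (rotF e1 e2 t (r • e1))) cU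
      (isCompact_Icc (a := (0:ℝ)) (b := 2 * Real.pi)) ⟨0, le_rfl, hpi⟩ hm.1.2
      (fun r hr t ht hmx => hder r hr t (hb.max_crit h (hball r (hm.1.1.trans hr.1.le) (hr.2.trans_lt hR) t)
        (fun s => by
          rw [rotF_add h]
          obtain ⟨s', hs', e''⟩ := rotF_mod (e1 := e1) (e2 := e2) (s + t) (r • e1)
          rw [← e'']
          exact hmx s' hs') (hnc' r hr t))) t ht
    rw [hm.2 t'] at e'
    rw [← e]; exact e'
  have down : ∀ θ, u (a • e1) ≤ u (rotF e1 e2 θ (r1 • e1)) := by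
    intro θ
    obtain ⟨t, ht, e⟩ := ex θ
    obtain ⟨t', ht', e'⟩ := envelope (Φ := fun r t => -u (rotF e1 e2 t (r • e1))) cU.neg
      (isCompact_Icc (a := (0:ℝ)) (b := 2 * Real.pi)) ⟨0, le_rfl, hpi⟩ hm.1.2
      (fun r hr t ht hmx => by
        have := (hder r hr t (hb.min_crit h (hball r (hm.1.1.trans hr.1.le) (hr.2.trans_lt hR) t)
          (fun s => by
            rw [rotF_add h]
            obtain ⟨s', hs', e''⟩ := rotF_mod (e1 := e1) (e2 := e2) (s + t) (r • e1)
            rw [← e'']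
            exact neg_le_neg_iff.1 (hmx s' hs')) (hnc' r hr t))).neg
        rw [neg_zero] at this
        exact this) t ht
    rw [hm.2 t'] at e'
    rw [← e]; linarith
  have q1 := up 0
  have q2 := down 0
  rw [rotF_zero] at q1 q2
  linarith [up θ, down θ]

theorem exists_orth (hN : 2 ≤ N) (e : Eu N) : ∃ e' : Eu N, ⟪e', e'⟫ = 1 ∧ ⟪e, e'⟫ = 0 := by
  have h1 : (ℝ ∙ e)ᗮ ≠ ⊥ := by
    intro hcon
    rw [Submodule.orthogonal_eq_bot_iff] at hcon
    have h2 := finrank_span_le_card (R := ℝ) ({e} : Set (Eu N))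
    rw [hcon, finrank_top, finrank_euclideanSpace_fin, Set.toFinset_singleton, Finset.card_singleton] at h2
    omega
  obtain ⟨v, hv, hv0⟩ := Submodule.exists_mem_ne_zero_of_ne_bot h1
  refine ⟨‖v‖⁻¹ • v, ?_, ?_⟩
  · rw [real_inner_smul_left, real_inner_smul_right, real_inner_self_eq_norm_sq]
    have := norm_ne_zero_iff.2 hv0
    field_simp
  · rw [real_inner_smul_right, Submodule.mem_orthogonal_singleton_iff_inner_right.1 hv, mul_zero]

theorem exists_rot (hN : 2 ≤ N) {e y : Eu N} (he : ‖e‖ = 1) (hy : ‖y‖ = 1) :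
    ∃ e2 θ, OP e e2 ∧ rotF e e2 θ e = y := by
  have he' : ⟪e, e⟫ = 1 := by rw [real_inner_self_eq_norm_sq, he]; norm_num
  have hy' : ⟪y, y⟫ = 1 := by rw [real_inner_self_eq_norm_sq, hy]; norm_num
  have main : ∃ e2, OP e e2 ∧ ∃ b : ℝ, y = ⟪e, y⟫ • e + b • e2 := by
    by_cases hz : y - ⟪e, y⟫ • e = 0
    · obtain ⟨e2, k1, k2⟩ := exists_orth hN e
      exact ⟨e2, ⟨he', k1, k2⟩, 0, by rw [zero_smul, add_zero]; exact sub_eq_zero.1 hz⟩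
    · have hn := norm_ne_zero_iff.2 hz
      refine ⟨‖y - ⟪e, y⟫ • e‖⁻¹ • (y - ⟪e, y⟫ • e), ⟨he', ?_, ?_⟩, ‖y - ⟪e, y⟫ • e‖, ?_⟩
      · rw [real_inner_smul_left, real_inner_smul_right, real_inner_self_eq_norm_sq]
        field_simp
      · rw [real_inner_smul_right, inner_sub_right, real_inner_smul_right, he']
        ring
      · rw [smul_smul, mul_inv_cancel₀ hn, one_smul]; abel
  obtain ⟨e2, hop, b, hyb⟩ := main
  generalize ⟪e, y⟫ = a at hyb
  have hab : a ^ 2 + b ^ 2 = 1 := by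
    rw [hyb] at hy'
    simp only [inner_add_right, inner_add_left, real_inner_smul_left, real_inner_smul_right, hop.n1, hop.n2, hop.o, hop.o'] at hy'
    linarith
  let z : ℂ := ⟨a, b⟩
  have hz : ‖z‖ = 1 := by
    rw [Complex.norm_def, Complex.normSq_apply]
    show Real.sqrt (a * a + b * b) = 1
    rw [show a * a + b * b = 1 by linarith, Real.sqrt_one]
  have hz0 : z ≠ 0 := by intro h; rw [h] at hz; simp at hz
  refine ⟨e2, z.arg, hop, ?_⟩
  have hc : Real.cos z.arg = a := by rw [Complex.cos_arg hz0, hz, div_one]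
  have hs : Real.sin z.arg = b := by rw [Complex.sin_arg, hz, div_one]
  unfold rotF
  rw [hc, hs, hop.n1, hop.o', hyb]
  module

/-- radial symmetry -/
theorem Base.radial (hb : Base R ε g f u D) (hN : 2 ≤ N) {e x : Eu N} (he : ‖e‖ = 1) (hx : ‖x‖ ≤ R) :
    u x = u (‖x‖ • e) := by
  rcases hx.eq_or_lt with h1 | h1
  · rw [hb.zero x h1.ge, hb.zero]
    rw [norm_smul, he, mul_one, norm_norm, h1]
  by_cases h0 : x = 0
  · rw [h0, norm_zero, zero_smul]
  have hn := norm_ne_zero_iff.2 h0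
  obtain ⟨e2, θ, hop, hr⟩ := exists_rot hN he (y := ‖x‖⁻¹ • x) (by rw [norm_smul, norm_inv, norm_norm, inv_mul_cancel₀ hn])
  have := hb.great hop (norm_nonneg x) h1 θ
  rw [rotF_smul hop, hr, smul_smul, mul_inv_cancel₀ hn, one_smul] at this
  exact this

end st4
end

open Set Metric MeasureTheory Bornology
open scoped RealInnerProductSpace Classical Topology

noncomputable section

section st5
variable {N : ℕ} {R ε : ℝ} {g f : ℝ → ℝ} {u : Eu N → ℝ} {D : Eu N → Eu N}

/-- quantitative form of the monotonicity hypothesis -/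
def GM (N : ℕ) (g : ℝ → ℝ) : Prop := ∀ p, 0 < p → ∀ t, 1 < t → g (t * p) < t ^ (N - 1) * g p

theorem GM_of (hN : 1 ≤ N) (hmon : StrictAntiOn (fun t => g t * t ^ (1 - (N:ℝ))) (Ioi 0)) : GM N g := by
  intro p hp t ht
  have htp : 0 < t * p := by positivity
  have h1 := hmon (mem_Ioi.2 hp) (mem_Ioi.2 htp) (by nlinarith)
  have e : (1 - (N:ℝ)) = -((N - 1 : ℕ) : ℝ) := by rw [Nat.cast_sub hN]; push_cast; ring
  simp only [e, Real.rpow_neg hp.le, Real.rpow_neg htp.le, Real.rpow_natCast] at h1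
  rw [← div_eq_mul_inv, ← div_eq_mul_inv, div_lt_div_iff₀ (by positivity) (by positivity), mul_pow] at h1
  have hpp : 0 < p ^ (N - 1) := by positivity
  nlinarith

theorem psi_deriv (hg : Gd g) (hN : 1 ≤ N) (p t : ℝ) :
    HasDerivAt (fun t => Gfun g (t * p) - Gfun g p + (1 - t ^ N) * (p * g p / N))
      (p * (g (t * p) - t ^ (N - 1) * g p)) t := by
  have h1 : HasDerivAt (fun t : ℝ => t * p) (1 * p) t := (hasDerivAt_id t).mul_const p
  have h2 : HasDerivAt (fun t => Gfun g (t * p)) (g (t * p) * (1 * p)) t := by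
    have h20 := HasDerivAt.comp t (Gfun_hasDerivAt hg.cont (t * p)) h1
    exact h20
  have h3 : HasDerivAt (fun t : ℝ => 1 - t ^ N) (-((N:ℝ) * t ^ (N - 1))) t := (hasDerivAt_pow N t).const_sub 1
  have h4 := (h2.sub_const (Gfun g p)).add (h3.mul_const (p * g p / N))
  have hN' : (N : ℝ) ≠ 0 := by positivity
  have e : g (t * p) * (1 * p) + -((N:ℝ) * t ^ (N - 1)) * (p * g p / N) = p * (g (t * p) - t ^ (N - 1) * g p) := by
    field_simp
    ring
  rw [e] at h4
  exact h4

theorem psi_lt (hg : Gd g) (hN : 1 ≤ N) (hm : GM N g) {p t : ℝ} (hp : 0 < p) (ht : 1 < t) :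
    Gfun g (t * p) - Gfun g p + (1 - t ^ N) * (p * g p / N) < 0 := by
  have h1 : StrictAntiOn (fun t => Gfun g (t * p) - Gfun g p + (1 - t ^ N) * (p * g p / N)) (Ici 1) := by
    apply strictAntiOn_of_deriv_neg (convex_Ici 1)
    · exact fun t _ => (psi_deriv hg hN p t).continuousAt.continuousWithinAt
    · intro s hs
      rw [interior_Ici] at hs
      rw [(psi_deriv hg hN p s).deriv]
      have := hm p hp s hs
      exact mul_neg_of_pos_of_neg hp (by linarith)
  have h2 := h1 (mem_Ici.2 le_rfl) (mem_Ici.2 ht.le) ht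
  simpa using h2

theorem psi_le (hg : Gd g) (hN : 1 ≤ N) (hm : GM N g) {p t : ℝ} (hp : 0 ≤ p) (ht : 0 < t) :
    Gfun g (t * p) - Gfun g p + (1 - t ^ N) * (p * g p / N) ≤ 0 := by
  rcases hp.eq_or_lt with h0 | h0
  · rw [← h0]; simp
  rcases lt_or_ge 1 t with h1 | h1
  · exact (psi_lt hg hN hm h0 h1).le
  have h2 : MonotoneOn (fun t => Gfun g (t * p) - Gfun g p + (1 - t ^ N) * (p * g p / N)) (Icc t 1) := by
    apply monotoneOn_of_deriv_nonneg (convex_Icc t 1)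
    · exact fun t _ => (psi_deriv hg hN p t).continuousAt.continuousWithinAt
    · exact fun t _ => (psi_deriv hg hN p t).differentiableAt.differentiableWithinAt
    · intro s hs
      rw [interior_Icc] at hs
      rw [(psi_deriv hg hN p s).deriv]
      have s0 : 0 < s := ht.trans hs.1
      have h3 := hm (s * p) (by positivity) s⁻¹ ((one_lt_inv₀ s0).2 hs.2)
      rw [inv_mul_cancel_left₀ s0.ne', inv_pow] at h3
      have h4 : s ^ (N - 1) * g p < g (s * p) := by
        have h5 : 0 < s ^ (N - 1) := by positivity
        have := mul_lt_mul_of_pos_left h3 h5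
        rwa [mul_inv_cancel_left₀ h5.ne'] at this
      exact mul_nonneg hp (by linarith)
  have h3 := h2 ⟨le_rfl, h1⟩ ⟨h1, le_rfl⟩ h1
  simpa using h3

/-- inner part of `u` -/
def uin (r0 c : ℝ) (u : Eu N → ℝ) (x : Eu N) : ℝ := if ‖x‖ < r0 then u x - c else 0
/-- gradient of the inner part -/
def Din (r0 : ℝ) (D : Eu N → Eu N) (x : Eu N) : Eu N := if ‖x‖ < r0 then D x else 0

theorem Din_cont {r0 : ℝ} (h0 : 0 < r0) (hD : Continuous D) (hz : ∀ x, ‖x‖ = r0 → D x = 0) : Continuous (Din r0 D) := by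
  unfold Din
  refine Continuous.if ?_ hD continuous_const
  intro a ha
  apply hz
  have : {x : Eu N | ‖x‖ < r0} = ball 0 r0 := by ext x; simp
  rw [this, frontier_ball _ h0.ne'] at ha
  simpa using ha

theorem uin_cont {r0 c : ℝ} (h0 : 0 < r0) (hu : Continuous u) (hz : ∀ x, ‖x‖ = r0 → u x = c) : Continuous (uin r0 c u) := by
  unfold uin
  refine Continuous.if ?_ (hu.sub continuous_const) continuous_const
  intro a ha
  have : {x : Eu N | ‖x‖ < r0} = ball 0 r0 := by ext x; simp
  rw [this, frontier_ball _ h0.ne'] at ha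
  rw [hz a (by simpa using ha), sub_self]

theorem Base.uin_grad (hb : Base R ε g f u D) {r0 c : ℝ} (hr : r0 < R)
    (hu : ∀ x, ‖x‖ = r0 → u x = c) (hz : ∀ x, ‖x‖ = r0 → D x = 0) (x : Eu N) :
    HasGradientAt (uin r0 c u) (Din r0 D x) x := by
  rcases lt_trichotomy ‖x‖ r0 with h | h | h
  · have h1 : HasGradientAt u (D x) x := hb.adm.grad x (by rw [mem_ball_zero_iff]; linarith)
    have h2 : HasGradientAt (fun y => u y - c) (D x) x := by
      have := hgr_sub h1 (hasGradientAt_const x c)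
      rwa [sub_zero] at this
    unfold Din
    rw [if_pos h]
    apply h2.congr_of_eventuallyEq
    filter_upwards [continuous_norm.continuousAt.eventually_lt continuousAt_const h] with y hy
    unfold uin; rw [if_pos hy]
  · have h1 : HasGradientAt u (D x) x := hb.adm.grad x (by rw [mem_ball_zero_iff]; linarith)
    rw [hz x h] at h1
    unfold Din
    rw [if_neg (by linarith)]
    rw [hgr_fd] at h1 ⊢
    rw [hasFDerivAt_iff_isLittleO] at h1 ⊢
    refine Asymptotics.IsLittleO.of_norm_left (Asymptotics.IsBigO.trans_isLittleO ?_ h1)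
    apply Asymptotics.IsBigO.of_bound 1
    refine Filter.Eventually.of_forall fun y => ?_
    rw [one_mul, norm_norm, map_zero, ContinuousLinearMap.zero_apply, sub_zero, sub_zero]
    have hx0 : uin r0 c u x = 0 := by unfold uin; rw [if_neg (by linarith)]
    rw [hx0, sub_zero, hu x h]
    unfold uin
    split_ifs
    · exact le_rfl
    · rw [norm_zero]; exact norm_nonneg _
  · unfold Din
    rw [if_neg (by linarith)]
    apply (hasGradientAt_const x (0 : ℝ)).congr_of_eventuallyEq
    filter_upwards [continuousAt_const.eventually_lt continuous_norm.continuousAt h] with y hy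
    unfold uin; rw [if_neg (by linarith)]

end st5
end

open Set Metric MeasureTheory Bornology
open scoped RealInnerProductSpace Classical Topology

noncomputable section

section st6
variable {N : ℕ} {R ε : ℝ} {g f : ℝ → ℝ} {u : Eu N → ℝ} {D : Eu N → Eu N}

/-- data of an inner part -/
structure Inn (r0 c : ℝ) (u : Eu N → ℝ) (D : Eu N → Eu N) (w : Eu N → ℝ) (E : Eu N → Eu N) : Prop where
  wc : Continuous w
  ec : Continuous E
  grad : ∀ x, HasGradientAt w (E x) x
  woff : ∀ x, r0 ≤ ‖x‖ → w x = 0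
  eoff : ∀ x, r0 ≤ ‖x‖ → E x = 0
  win : ∀ x, ‖x‖ < r0 → u x = w x + c
  ein : ∀ x, ‖x‖ < r0 → D x = E x
  usph : ∀ x, ‖x‖ = r0 → u x = c
  dsph : ∀ x, ‖x‖ = r0 → D x = 0

def kk (g f : ℝ → ℝ) (c : ℝ) (w : Eu N → ℝ) (E : Eu N → Eu N) (t : ℝ) (y : Eu N) : ℝ :=
  Gfun g (t * ‖E y‖) - (Gfun f (w y + c) - Gfun f c)

def jj (r0 t : ℝ) (x : Eu N) : ℝ := if t * ‖x‖ < r0 ∧ r0 ≤ ‖x‖ then 1 else 0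

theorem jj_meas (r0 t : ℝ) : Measurable (jj (N := N) r0 t) := by
  unfold jj
  refine Measurable.ite ?_ measurable_const measurable_const
  have c1 : Continuous (fun x : Eu N => t * ‖x‖) := continuous_const.mul continuous_norm
  exact (measurableSet_lt c1.measurable measurable_const).inter (measurableSet_le measurable_const continuous_norm.measurable)

theorem Base.v_nonneg (hb : Base R ε g f u D) {r0 c : ℝ} {w : Eu N → ℝ} {E : Eu N → Eu N}
    (hi : Inn r0 c u D w E) (hr0 : 0 < r0) :
    ∀ᶠ t in 𝓝 (1:ℝ), ∀ x ∈ closedBall (0 : Eu N) R, 0 ≤ u x - w x + w (t • x) := by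
  obtain ⟨y0, hy0⟩ : ∃ y : ℝ, True := ⟨0, trivial⟩
  have hcw : ∀ y, 0 ≤ w y + c ∨ r0 ≤ ‖y‖ := by
    intro y
    rcases lt_or_ge ‖y‖ r0 with h | h
    · left; rw [← hi.win y h]; exact hb.nonneg y
    · right; exact h
  by_cases hex : ∃ z : Eu N, ‖z‖ = r0
  swap
  · -- degenerate: no vectors of norm r0
    apply Filter.Eventually.of_forall
    intro t x _
    have hall : ∀ x : Eu N, x = 0 := by
      intro x
      by_contra hx
      apply hex
      refine ⟨(r0 / ‖x‖) • x, ?_⟩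
      rw [norm_smul, Real.norm_of_nonneg (by positivity), div_mul_cancel₀ _ (norm_ne_zero_iff.2 hx)]
    rw [hall (t • x), hall x]
    have := hb.nonneg 0
    linarith
  obtain ⟨z, hz⟩ := hex
  have hc0 : 0 ≤ c := by rw [← hi.usph z hz]; exact hb.nonneg z
  rcases hc0.eq_or_lt with hc | hc
  · apply Filter.Eventually.of_forall
    intro t x _
    have hw0 : ∀ y, 0 ≤ w y := by
      intro y
      rcases hcw y with h | h
      · linarith
      · rw [hi.woff y h]
    have : u x - w x ≥ 0 := by
      rcases lt_or_ge ‖x‖ r0 with h | h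
      · rw [hi.win x h]; linarith
      · rw [hi.woff x h, sub_zero]; exact hb.nonneg x
    linarith [hw0 (t • x)]
  · apply (isCompact_closedBall (0 : Eu N) R).eventually_forall_of_forall_eventually
    intro x0 _
    have ct : Continuous (fun p : ℝ × Eu N => p.1 • p.2) := continuous_fst.smul continuous_snd
    have cv : Continuous (fun p : ℝ × Eu N => u p.2 - w p.2 + w (p.1 • p.2)) :=
      ((hb.uc.comp continuous_snd).sub (hi.wc.comp continuous_snd)).add (hi.wc.comp ct)
    rcases lt_trichotomy ‖x0‖ r0 with h | h | h
    · have h1 : ∀ᶠ p : ℝ × Eu N in 𝓝 (1, x0), ‖p.2‖ < r0 :=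
        (continuous_norm.comp continuous_snd).continuousAt.eventually_lt continuousAt_const h
      filter_upwards [h1] with p hp
      rw [hi.win _ hp]
      rcases hcw (p.1 • p.2) with h2 | h2
      · linarith
      · rw [hi.woff _ h2]; linarith
    · have h1 : ∀ᶠ p : ℝ × Eu N in 𝓝 (1, x0), 0 < u p.2 - w p.2 + w (p.1 • p.2) := by
        apply continuousAt_const.eventually_lt cv.continuousAt
        show 0 < u x0 - w x0 + w ((1:ℝ) • x0)
        rw [one_smul, hi.usph x0 h]; linarith
      exact h1.mono fun p hp => hp.le
    · have h1 : ∀ᶠ p : ℝ × Eu N in 𝓝 (1, x0), r0 < ‖p.2‖ :=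
        continuousAt_const.eventually_lt (continuous_norm.comp continuous_snd).continuousAt h
      have h2 : ∀ᶠ p : ℝ × Eu N in 𝓝 (1, x0), r0 < ‖p.1 • p.2‖ := by
        apply continuousAt_const.eventually_lt (continuous_norm.comp ct).continuousAt
        show r0 < ‖(1:ℝ) • x0‖
        rw [one_smul]; exact h
      filter_upwards [h1, h2] with p hp1 hp2
      rw [hi.woff _ hp1.le, hi.woff _ hp2.le]
      linarith [hb.nonneg p.2]

theorem ev_small {F : ℝ × Eu N → ℝ} (hF : Continuous F) (h1 : ∀ x, F (1, x) = 0) {η : ℝ} (hη : 0 < η) (R : ℝ) :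
    ∀ᶠ t in 𝓝 (1:ℝ), ∀ x ∈ closedBall (0 : Eu N) R, F (t, x) < η := by
  apply (isCompact_closedBall (0 : Eu N) R).eventually_forall_of_forall_eventually
  intro x0 _
  apply hF.continuousAt.eventually_lt continuousAt_const
  rw [h1]; exact hη

theorem intOn_ball {F : Eu N → ℝ} (hF : Continuous F) (R : ℝ) : IntegrableOn F (ball (0 : Eu N) R) :=
  (hF.continuousOn.integrableOn_compact (isCompact_closedBall (0 : Eu N) R)).mono_set ball_subset_closedBall

theorem c1_of_grad {v : Eu N → ℝ} {V : Eu N → Eu N} (hv : ∀ x, HasGradientAt v (V x) x) (hV : Continuous V) :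
    ContDiff ℝ 1 v := by
  rw [contDiff_one_iff_fderiv]
  refine ⟨fun x => (hgr_fd.1 (hv x)).differentiableAt, ?_⟩
  have : fderiv ℝ v = fun x => innerSL ℝ (V x) := by funext x; exact (hgr_fd.1 (hv x)).fderiv
  rw [this]
  exact (innerSL ℝ).continuous.comp hV

theorem grad_dil {w : Eu N → ℝ} {E : Eu N → Eu N} (hw : ∀ x, HasGradientAt w (E x) x) (t : ℝ) (x : Eu N) :
    HasGradientAt (fun y => w (t • y)) (t • E (t • x)) x := by
  have h1 := hgr_fd.1 (hw (t • x))
  have h2 : HasFDerivAt (fun y : Eu N => t • y) (t • ContinuousLinearMap.id ℝ (Eu N)) x := (hasFDerivAt_id x).const_smul t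
  have h3 : HasFDerivAt (fun y => w (t • y)) ((innerSL ℝ (E (t • x))).comp (t • ContinuousLinearMap.id ℝ (Eu N))) x :=
    HasFDerivAt.comp x h1 h2
  rw [hgr_fd]
  have e : (innerSL ℝ (E (t • x))).comp (t • ContinuousLinearMap.id ℝ (Eu N)) = innerSL ℝ (t • E (t • x)) := by
    ext y
    show ⟪E (t • x), t • y⟫ = ⟪t • E (t • x), y⟫
    rw [real_inner_smul_left, real_inner_smul_right]
  rw [← e]; exact h3

theorem Base.adm_dil (hb : Base R ε g f u D) {r0 c : ℝ} {w : Eu N → ℝ} {E : Eu N → Eu N}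
    (hi : Inn r0 c u D w E) (hr : r0 < R) {t : ℝ}
    (h1 : ∀ x ∈ closedBall (0 : Eu N) R, 0 ≤ u x - w x + w (t • x))
    (hoffR : ∀ x : Eu N, R ≤ ‖x‖ → r0 ≤ ‖t • x‖) :
    Adm R (fun x => u x - w x + w (t • x)) (fun x => D x - E x + t • E (t • x)) := by
  have c0 : Continuous (fun x : Eu N => E (t • x)) := hi.ec.comp (continuous_const_smul t)
  have cEt1 : Continuous (fun x : Eu N => t • E (t • x)) := c0.const_smul t
  refine ⟨?_, ?_, ?_, ?_⟩
  · exact (hb.adm.c1.sub (c1_of_grad hi.grad hi.ec).contDiffOn).add (c1_of_grad (grad_dil hi.grad t) cEt1).contDiffOn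
  · intro x hx
    have hx' : ‖x‖ = R := by simpa using hx
    show u x - w x + w (t • x) = 0
    rw [hb.zero x hx'.ge, hi.woff x (by linarith), hi.woff _ (hoffR x hx'.ge)]; ring
  · intro x hx; exact h1 x (ball_subset_closedBall hx)
  · intro x hx
    exact hgr_add (hgr_sub (hb.adm.grad x hx) (hi.grad x)) (grad_dil hi.grad t x)

def WW (g f : ℝ → ℝ) (c : ℝ) (u : Eu N → ℝ) (D : Eu N → Eu N) (w : Eu N → ℝ) (E : Eu N → Eu N) (t : ℝ) (x : Eu N) : ℝ :=
  (Gfun g ‖D x - E x + t • E (t • x)‖ - Gfun f (u x - w x + w (t • x)))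
    - (Gfun g ‖D x‖ - Gfun f (u x)) - (kk g f c w E t (t • x) - kk g f c w E 1 x)

theorem WW_zero {r0 c : ℝ} {w : Eu N → ℝ} {E : Eu N → Eu N}
    (hi : Inn r0 c u D w E) {t : ℝ} (ht0 : 0 < t) {x : Eu N} (hj : ¬ (t * ‖x‖ < r0 ∧ r0 ≤ ‖x‖)) :
    WW g f c u D w E t x = 0 := by
  unfold WW kk
  rcases lt_or_ge ‖x‖ r0 with hlt | hge
  · rw [hi.win x hlt, hi.ein x hlt, sub_self, zero_add, norm_smul, Real.norm_of_nonneg ht0.le, one_mul,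
      show w x + c - w x + w (t • x) = w (t • x) + c by ring]
    ring
  · have hge' : r0 ≤ ‖t • x‖ := by
      rw [norm_smul, Real.norm_of_nonneg ht0.le]; by_contra hcon; exact hj ⟨not_le.1 hcon, hge⟩
    rw [hi.woff x hge, hi.eoff x hge, hi.woff _ hge', hi.eoff _ hge', smul_zero, sub_zero, add_zero, norm_zero, mul_zero, mul_zero,
      sub_zero, add_zero]
    ring

theorem kk_cont (hg : Continuous g) (hf : Continuous f) (c : ℝ) {w : Eu N → ℝ} {E : Eu N → Eu N} (hw : Continuous w) (hE : Continuous E) :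
    Continuous (fun p : ℝ × Eu N => kk g f c w E p.1 p.2) := by
  have a1 : Continuous (fun p : ℝ × Eu N => Gfun g (p.1 * ‖E p.2‖)) :=
    (Gfun_cont hg).comp (continuous_fst.mul (hE.comp continuous_snd).norm)
  have a2 : Continuous (fun p : ℝ × Eu N => Gfun f (w p.2 + c)) :=
    (Gfun_cont hf).comp ((hw.comp continuous_snd).add continuous_const)
  exact a1.sub (a2.sub continuous_const)

theorem WW_cont (hg : Continuous g) (hf : Continuous f) (c : ℝ) {w : Eu N → ℝ} {E : Eu N → Eu N} (hu : Continuous u) (hD : Continuous D)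
    (hw : Continuous w) (hE : Continuous E) :
    Continuous (fun p : ℝ × Eu N => WW g f c u D w E p.1 p.2) := by
  have cG := Gfun_cont hg
  have cF := Gfun_cont hf
  have ct : Continuous (fun p : ℝ × Eu N => p.1 • p.2) := continuous_fst.smul continuous_snd
  have cu : Continuous (fun p : ℝ × Eu N => u p.2) := hu.comp continuous_snd
  have cw : Continuous (fun p : ℝ × Eu N => w p.2) := hw.comp continuous_snd
  have cwt : Continuous (fun p : ℝ × Eu N => w (p.1 • p.2)) := hw.comp ct
  have cD : Continuous (fun p : ℝ × Eu N => D p.2) := hD.comp continuous_snd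
  have cE : Continuous (fun p : ℝ × Eu N => E p.2) := hE.comp continuous_snd
  have cEt0 : Continuous (fun p : ℝ × Eu N => E (p.1 • p.2)) := hE.comp ct
  have cEt : Continuous (fun p : ℝ × Eu N => p.1 • E (p.1 • p.2)) := continuous_fst.smul cEt0
  have cv : Continuous (fun p : ℝ × Eu N => u p.2 - w p.2 + w (p.1 • p.2)) := (cu.sub cw).add cwt
  have cV : Continuous (fun p : ℝ × Eu N => D p.2 - E p.2 + p.1 • E (p.1 • p.2)) := (cD.sub cE).add cEt
  have ck0 := kk_cont (c := c) hg hf hw hE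
  have ck : Continuous (fun p : ℝ × Eu N => kk g f c w E p.1 (p.1 • p.2)) := by
    have cp : Continuous (fun p : ℝ × Eu N => (p.1, p.1 • p.2)) := continuous_fst.prodMk ct
    exact ck0.comp cp
  have ck1' : Continuous (fun p : ℝ × Eu N => kk g f c w E 1 p.2) := by
    have cp : Continuous (fun p : ℝ × Eu N => ((1:ℝ), p.2)) := continuous_const.prodMk continuous_snd
    exact ck0.comp cp
  have b1 : Continuous (fun p : ℝ × Eu N => Gfun g ‖D p.2 - E p.2 + p.1 • E (p.1 • p.2)‖) := cG.comp cV.norm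
  have b2 : Continuous (fun p : ℝ × Eu N => Gfun f (u p.2 - w p.2 + w (p.1 • p.2))) := cF.comp cv
  have b3 : Continuous (fun p : ℝ × Eu N => Gfun g ‖D p.2‖) := cG.comp cD.norm
  have b4 : Continuous (fun p : ℝ × Eu N => Gfun f (u p.2)) := cF.comp cu
  exact ((b1.sub b2).sub (b3.sub b4)).sub (ck.sub ck1')

theorem Base.close_dil (hb : Base R ε g f u D) {w : Eu N → ℝ} {E : Eu N → Eu N} (hw : Continuous w) (hE : Continuous E) :
    ∀ᶠ t in 𝓝 (1:ℝ), ∀ x ∈ closedBall (0 : Eu N) R, |w (t • x) - w x| + ‖t • E (t • x) - E x‖ < ε := by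
  have ct : Continuous (fun p : ℝ × Eu N => p.1 • p.2) := continuous_fst.smul continuous_snd
  have cw : Continuous (fun p : ℝ × Eu N => w p.2) := hw.comp continuous_snd
  have cwt : Continuous (fun p : ℝ × Eu N => w (p.1 • p.2)) := hw.comp ct
  have cE : Continuous (fun p : ℝ × Eu N => E p.2) := hE.comp continuous_snd
  have cEt0 : Continuous (fun p : ℝ × Eu N => E (p.1 • p.2)) := hE.comp ct
  have cEt : Continuous (fun p : ℝ × Eu N => p.1 • E (p.1 • p.2)) := continuous_fst.smul cEt0
  have cCl : Continuous (fun p : ℝ × Eu N => |w (p.1 • p.2) - w p.2| + ‖p.1 • E (p.1 • p.2) - E p.2‖) :=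
    (cwt.sub cw).abs.add (cEt.sub cE).norm
  refine ev_small cCl ?_ hb.epos R
  intro x
  show |w ((1:ℝ) • x) - w x| + ‖(1:ℝ) • E ((1:ℝ) • x) - E x‖ = 0
  rw [one_smul, one_smul, sub_self, sub_self, abs_zero, norm_zero, add_zero]

set_option maxHeartbeats 400000 in
theorem Base.dil (hb : Base R ε g f u D) {r0 c : ℝ} {w : Eu N → ℝ} {E : Eu N → Eu N}
    (hi : Inn r0 c u D w E) (hr0 : 0 < r0) (hr : r0 < R) {η : ℝ} (hη : 0 < η) :
    ∀ᶠ t in 𝓝 (1:ℝ), 0 ≤ (∫ x, (kk g f c w E t (t • x) - kk g f c w E 1 x)) + η * ∫ x, jj (N := N) r0 t x := by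
  have cW := WW_cont (c := c) hb.gd.cont hb.fc hb.uc hb.dc hi.wc hi.ec
  have hW1 : ∀ x, WW g f c u D w E 1 x = 0 := by
    intro x
    unfold WW
    rw [one_smul, one_smul, sub_add_cancel, sub_add_cancel]; ring
  have htR : ∀ᶠ t in 𝓝 (1:ℝ), r0 / R < t :=
    lt_mem_nhds ((div_lt_one hb.Rpos).2 hr)
  filter_upwards [hb.v_nonneg hi hr0, ev_small cW hW1 hη R, hb.close_dil hi.wc hi.ec, htR] with t h1 h2 h3 h4
  have ht0 : 0 < t := (div_pos hr0 hb.Rpos).trans h4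
  have h4' : r0 < t * R := by rwa [div_lt_iff₀ hb.Rpos] at h4
  have hnt : ∀ x : Eu N, ‖t • x‖ = t * ‖x‖ := fun x => by rw [norm_smul, Real.norm_of_nonneg ht0.le]
  have hoffR : ∀ x : Eu N, R ≤ ‖x‖ → r0 ≤ ‖t • x‖ := by
    intro x hx
    rw [hnt]
    have := mul_le_mul_of_nonneg_left hx ht0.le
    linarith
  have hadm := hb.adm_dil hi hr h1 hoffR
  have hJ := hb.mini _ _ hadm (by
    intro x hx
    have := h3 x (ball_subset_closedBall hx)
    have e1 : u x - w x + w (t • x) - u x = w (t • x) - w x := by ring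
    have e2 : D x - E x + t • E (t • x) - D x = t • E (t • x) - E x := by abel
    rw [e1, e2]; exact this)
  unfold JJ at hJ
  have cG := Gfun_cont hb.gd.cont
  have cF := Gfun_cont hb.fc
  have cLu1 : Continuous (fun x : Eu N => Gfun g ‖D x‖ - Gfun f (u x)) :=
    (cG.comp hb.dc.norm).sub (cF.comp hb.uc)
  have c0 : Continuous (fun x : Eu N => E (t • x)) := hi.ec.comp (continuous_const_smul t)
  have c0' : Continuous (fun x : Eu N => t • E (t • x)) := c0.const_smul t
  have c1 : Continuous (fun x : Eu N => w (t • x)) := hi.wc.comp (continuous_const_smul t)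
  have c2 : Continuous (fun x : Eu N => D x - E x + t • E (t • x)) := (hb.dc.sub hi.ec).add c0'
  have c3 : Continuous (fun x : Eu N => u x - w x + w (t • x)) := (hb.uc.sub hi.wc).add c1
  have cLvt : Continuous (fun x : Eu N => Gfun g ‖D x - E x + t • E (t • x)‖ - Gfun f (u x - w x + w (t • x))) :=
    (cG.comp c2.norm).sub (cF.comp c3)
  have ckd : Continuous (fun x : Eu N => kk g f c w E t (t • x) - kk g f c w E 1 x) := by
    have cc := kk_cont (c := c) hb.gd.cont hb.fc hi.wc hi.ec
    have p1 : Continuous (fun x : Eu N => (t, t • x)) := continuous_const.prodMk (continuous_const_smul t)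
    have p2 : Continuous (fun x : Eu N => ((1:ℝ), x)) := continuous_const.prodMk continuous_id
    exact (cc.comp p1).sub (cc.comp p2)
  have iv := intOn_ball cLvt R
  have iu := intOn_ball cLu1 R
  have ik := intOn_ball ckd R
  have ij : IntegrableOn (jj (N := N) r0 t) (ball 0 R) := by
    refine Measure.integrableOn_of_bounded (M := 1) measure_ball_lt_top.ne (jj_meas r0 t).aestronglyMeasurable ?_
    refine Filter.Eventually.of_forall fun x => ?_
    unfold jj; split_ifs <;> simp
  have ij' : IntegrableOn (fun x => η * jj (N := N) r0 t x) (ball 0 R) := ij.const_mul η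
  have ikj : IntegrableOn (fun x => (kk g f c w E t (t • x) - kk g f c w E 1 x) + η * jj (N := N) r0 t x) (ball 0 R) := ik.add ij'
  have hpt : ∀ x ∈ ball (0 : Eu N) R, (Gfun g ‖D x - E x + t • E (t • x)‖ - Gfun f (u x - w x + w (t • x))) -
      (Gfun g ‖D x‖ - Gfun f (u x)) ≤ (kk g f c w E t (t • x) - kk g f c w E 1 x) + η * jj (N := N) r0 t x := by
    intro x hx
    by_cases hj : t * ‖x‖ < r0 ∧ r0 ≤ ‖x‖
    · have k1 : jj (N := N) r0 t x = 1 := if_pos hj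
      have k2 : WW g f c u D w E t x < η := h2 x (ball_subset_closedBall hx)
      unfold WW at k2
      rw [k1]; linarith
    · have k1 : jj (N := N) r0 t x = 0 := if_neg hj
      have k2 := WW_zero (g := g) (f := f) hi ht0 hj
      unfold WW at k2
      rw [k1]; linarith
  have heqI : (∫ x in ball (0 : Eu N) R, ((Gfun g ‖D x - E x + t • E (t • x)‖ - Gfun f (u x - w x + w (t • x))) -
      (Gfun g ‖D x‖ - Gfun f (u x)))) ≤ ∫ x in ball (0 : Eu N) R, ((kk g f c w E t (t • x) - kk g f c w E 1 x) + η * jj (N := N) r0 t x) :=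
    setIntegral_mono_on (iv.sub iu) ikj measurableSet_ball hpt
  rw [integral_sub iv iu, integral_add ik ij', integral_const_mul] at heqI
  have z1 : ∫ x in ball (0 : Eu N) R, (kk g f c w E t (t • x) - kk g f c w E 1 x) = ∫ x, (kk g f c w E t (t • x) - kk g f c w E 1 x) := by
    apply setIntegral_eq_integral_of_forall_compl_eq_zero
    intro x hx
    have hx' : R ≤ ‖x‖ := by simpa using hx
    unfold kk
    rw [hi.woff x (by linarith), hi.eoff x (by linarith), hi.woff _ (hoffR x hx'), hi.eoff _ (hoffR x hx')]
    simp
  have z2 : ∫ x in ball (0 : Eu N) R, jj (N := N) r0 t x = ∫ x, jj (N := N) r0 t x := by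
    apply setIntegral_eq_integral_of_forall_compl_eq_zero
    intro x hx
    have hx' : R ≤ ‖x‖ := by simpa using hx
    have := hoffR x hx'
    rw [hnt] at this
    exact if_neg (fun h => absurd h.1 (not_lt.2 this))
  rw [z1, z2] at heqI
  linarith

end st6
end

open Set Metric MeasureTheory Bornology
open scoped RealInnerProductSpace Classical Topology

noncomputable section

section st7
variable {N : ℕ} {R ε : ℝ} {g f : ℝ → ℝ} {u : Eu N → ℝ} {D : Eu N → Eu N}

def psx (g : ℝ → ℝ) (E : Eu N → Eu N) (t : ℝ) (x : Eu N) : ℝ :=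
  Gfun g (t * ‖E x‖) - Gfun g ‖E x‖ + (1 - t ^ N) * (‖E x‖ * g ‖E x‖ / N)

def pox (g f : ℝ → ℝ) (c : ℝ) (w : Eu N → ℝ) (E : Eu N → Eu N) (x : Eu N) : ℝ :=
  ‖E x‖ * g ‖E x‖ / N - kk g f c w E 1 x

theorem kk_split (c : ℝ) (w : Eu N → ℝ) (E : Eu N → Eu N) (t : ℝ) (x : Eu N) :
    kk g f c w E t x - t ^ N * kk g f c w E 1 x = psx g E t x - (1 - t ^ N) * pox g f c w E x := by
  unfold psx pox kk
  rw [one_mul]; ring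

theorem cs_of_off {F : Eu N → ℝ} {r0 : ℝ} (h : ∀ x, r0 ≤ ‖x‖ → F x = 0) : HasCompactSupport F := by
  apply HasCompactSupport.intro (isCompact_closedBall (0 : Eu N) r0)
  intro x hx
  rw [mem_closedBall_zero_iff, not_le] at hx
  exact h x hx.le

theorem psx_cont (hg : Continuous g) {E : Eu N → Eu N} (hE : Continuous E) (t : ℝ) : Continuous (psx g E t) := by
  have c1 : Continuous (fun x => ‖E x‖) := hE.norm
  have c2 : Continuous (fun x => Gfun g (t * ‖E x‖)) := (Gfun_cont hg).comp (continuous_const.mul c1)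
  have c3 : Continuous (fun x => Gfun g ‖E x‖) := (Gfun_cont hg).comp c1
  have c4 : Continuous (fun x => ‖E x‖ * g ‖E x‖ / N) := (c1.mul (hg.comp c1)).div_const _
  exact (c2.sub c3).add (continuous_const.mul c4)

theorem kk_cont1 (hg : Continuous g) (hf : Continuous f) (c : ℝ) {w : Eu N → ℝ} {E : Eu N → Eu N} (hw : Continuous w)
    (hE : Continuous E) (t : ℝ) : Continuous (kk g f c w E t) := by
  have c1 : Continuous (fun x => ‖E x‖) := hE.norm
  have c2 : Continuous (fun x => Gfun g (t * ‖E x‖)) := (Gfun_cont hg).comp (continuous_const.mul c1)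
  have c3 : Continuous (fun x => Gfun f (w x + c)) := (Gfun_cont hf).comp (hw.add continuous_const)
  exact c2.sub (c3.sub continuous_const)

theorem pox_cont (hg : Continuous g) (hf : Continuous f) (c : ℝ) {w : Eu N → ℝ} {E : Eu N → Eu N} (hw : Continuous w)
    (hE : Continuous E) : Continuous (pox g f c w E) := by
  have c1 : Continuous (fun x => ‖E x‖) := hE.norm
  have c4 : Continuous (fun x => ‖E x‖ * g ‖E x‖ / N) := (c1.mul (hg.comp c1)).div_const _
  exact c4.sub (kk_cont1 hg hf c hw hE 1)

theorem kk_off {r0 c : ℝ} {w : Eu N → ℝ} {E : Eu N → Eu N} (hi : Inn r0 c u D w E) (t : ℝ) (x : Eu N)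
    (hx : r0 ≤ ‖x‖) : kk g f c w E t x = 0 := by
  unfold kk
  rw [hi.woff x hx, hi.eoff x hx]; simp [Gfun_zero]

theorem psx_off {r0 c : ℝ} {w : Eu N → ℝ} {E : Eu N → Eu N} (hi : Inn r0 c u D w E) (t : ℝ) (x : Eu N)
    (hx : r0 ≤ ‖x‖) : psx g E t x = 0 := by
  unfold psx
  rw [hi.eoff x hx]; simp

theorem pox_off {r0 c : ℝ} {w : Eu N → ℝ} {E : Eu N → Eu N} (hi : Inn r0 c u D w E) (x : Eu N)
    (hx : r0 ≤ ‖x‖) : pox g f c w E x = 0 := by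
  unfold pox
  rw [kk_off hi 1 x hx, hi.eoff x hx]; simp

theorem Base.dil_id (hb : Base R ε g f u D) {r0 c : ℝ} {w : Eu N → ℝ} {E : Eu N → Eu N}
    (hi : Inn r0 c u D w E) {t : ℝ} (ht : 0 < t) :
    t ^ N * (∫ x, (kk g f c w E t (t • x) - kk g f c w E 1 x)) =
      (∫ x, psx g E t x) - (1 - t ^ N) * ∫ x, pox g f c w E x := by
  have ck := kk_cont1 hb.gd.cont hb.fc c hi.wc hi.ec
  have ik : ∀ s, Integrable (fun x => kk g f c w E s x) volume := fun s =>
    (ck s).integrable_of_hasCompactSupport (cs_of_off (kk_off hi s))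
  have ip : Integrable (fun x => psx g E t x) volume :=
    (psx_cont hb.gd.cont hi.ec t).integrable_of_hasCompactSupport (cs_of_off (psx_off hi t))
  have io : Integrable (fun x => pox g f c w E x) volume :=
    (pox_cont hb.gd.cont hb.fc c hi.wc hi.ec).integrable_of_hasCompactSupport (cs_of_off (pox_off hi))
  have it : Integrable (fun x => kk g f c w E t (t • x)) volume := (ik t).comp_smul ht.ne'
  rw [integral_sub it (ik 1)]
  have h1 : (∫ x, kk g f c w E t (t • x)) = (t ^ N)⁻¹ * ∫ x, kk g f c w E t x := by
    have := Measure.integral_comp_smul (volume : Measure (Eu N)) (kk g f c w E t) t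
    rw [this, finrank_euclideanSpace_fin, abs_of_pos (by positivity), smul_eq_mul]
  rw [h1, mul_sub, ← mul_assoc, mul_inv_cancel₀ (by positivity), one_mul, ← integral_const_mul, ← integral_const_mul,
    ← integral_sub (ik t) ((ik 1).const_mul _), ← integral_sub ip (io.const_mul _)]
  apply integral_congr_ae
  exact Filter.Eventually.of_forall (fun x => kk_split c w E t x)

theorem jj_int {r0 t : ℝ} (ht : 0 < t) (ht1 : t < 1) :
    t ^ N * ∫ x, jj (N := N) r0 t x = (1 - t ^ N) * (volume : Measure (Eu N)).real (ball 0 r0) := by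
  let i : Eu N → ℝ := (ball (0 : Eu N) r0).indicator (fun _ => 1)
  have ii : Integrable (fun x => i x) volume :=
    (integrable_indicator_iff measurableSet_ball).2 (integrableOn_const (by finiteness))
  have it : Integrable (fun x => i (t • x)) volume := ii.comp_smul ht.ne'
  have h0 : ∫ x, i x = (volume : Measure (Eu N)).real (ball 0 r0) := by
    show ∫ x, (ball (0 : Eu N) r0).indicator (fun _ => (1:ℝ)) x = _
    rw [integral_indicator measurableSet_ball]; simp
  have h1 : (∫ x, i (t • x)) = (t ^ N)⁻¹ * ∫ x, i x := by
    have := Measure.integral_comp_smul (volume : Measure (Eu N)) i t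
    rw [this, finrank_euclideanSpace_fin, abs_of_pos (by positivity), smul_eq_mul]
  have h2 : ∫ x, jj (N := N) r0 t x = ∫ x, (i (t • x) - i x) := by
    apply integral_congr_ae
    refine Filter.Eventually.of_forall (fun x => ?_)
    show jj r0 t x = (ball (0 : Eu N) r0).indicator (fun _ => 1) (t • x) - (ball (0 : Eu N) r0).indicator (fun _ => 1) x
    unfold jj
    have hle : t * ‖x‖ ≤ ‖x‖ := by nlinarith [norm_nonneg x]
    rw [indicator_apply, indicator_apply, mem_ball_zero_iff, mem_ball_zero_iff, norm_smul, Real.norm_of_nonneg ht.le]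
    by_cases ha : t * ‖x‖ < r0 <;> by_cases hb : ‖x‖ < r0
    · simp [ha, hb, not_le.2 hb]
    · simp [ha, hb, not_lt.1 hb]
    · exact absurd (hle.trans_lt hb) ha
    · simp [ha, hb]
  rw [h2, integral_sub it ii, h1, h0, mul_sub, ← mul_assoc, mul_inv_cancel₀ (by positivity)]
  ring

theorem Base.pox_nonpos (hb : Base R ε g f u D) (hN : 1 ≤ N) (hm : GM N g) {r0 c : ℝ} {w : Eu N → ℝ} {E : Eu N → Eu N}
    (hi : Inn r0 c u D w E) (hr0 : 0 < r0) (hr : r0 < R) : ∫ x, pox g f c w E x ≤ 0 := by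
  apply le_of_forall_pos_le_add
  intro δ hδ
  set V := (volume : Measure (Eu N)).real (ball 0 r0) with hV
  have hV0 : 0 ≤ V := measureReal_nonneg
  have hη : 0 < δ / (V + 1) := by positivity
  obtain ⟨t, ⟨h1, h2⟩, h3⟩ : ∃ t, (0 < t ∧ t < 1) ∧ 0 ≤ (∫ x, (kk g f c w E t (t • x) - kk g f c w E 1 x)) + δ / (V + 1) * ∫ x, jj (N := N) r0 t x := by
    have e1 := (hb.dil hi hr0 hr hη).filter_mono (nhdsWithin_le_nhds (s := Iio 1))
    have e2 : ∀ᶠ t in 𝓝[<] (1:ℝ), 0 < t ∧ t < 1 := by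
      filter_upwards [Ioo_mem_nhdsLT (zero_lt_one' ℝ)] with t ht using ht
    obtain ⟨t, ht⟩ := (e2.and e1).exists
    exact ⟨t, ht⟩
  have h4 := mul_nonneg (pow_pos h1 N).le h3
  rw [mul_add, hb.dil_id hi h1, mul_left_comm, jj_int h1 h2, ← hV] at h4
  have h5 : ∫ x, psx g E t x ≤ 0 := integral_nonpos (fun x => psi_le hb.gd hN hm (norm_nonneg _) h1)
  have h6 : 0 < 1 - t ^ N := by
    have := pow_lt_one₀ h1.le h2 (by omega : N ≠ 0)
    linarith
  have h7 : 0 ≤ (1 - t ^ N) * (-(∫ x, pox g f c w E x) + δ / (V + 1) * V) := by linarith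
  have h8 := nonneg_of_mul_nonneg_right h7 h6
  have h9 : δ / (V + 1) * V ≤ δ := by
    rw [div_mul_eq_mul_div, div_le_iff₀ (by positivity)]; nlinarith
  linarith

theorem Base.E_zero (hb : Base R ε g f u D) (hN : 1 ≤ N) (hm : GM N g) {r0 c : ℝ} {w : Eu N → ℝ} {E : Eu N → Eu N}
    (hi : Inn r0 c u D w E) (hr0 : 0 < r0) (hr : r0 < R) (x0 : Eu N) : E x0 = 0 := by
  by_contra hx0
  have hP := hb.pox_nonpos hN hm hi hr0 hr
  obtain ⟨t, h1, h3⟩ : ∃ t, 1 < t ∧ 0 ≤ (∫ x, (kk g f c w E t (t • x) - kk g f c w E 1 x)) + 1 * ∫ x, jj (N := N) r0 t x := by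
    have e1 := (hb.dil hi hr0 hr one_pos).filter_mono (nhdsWithin_le_nhds (s := Ioi 1))
    have e2 : ∀ᶠ t in 𝓝[>] (1:ℝ), 1 < t := self_mem_nhdsWithin
    obtain ⟨t, ht⟩ := (e2.and e1).exists
    exact ⟨t, ht⟩
  have ht0 : 0 < t := one_pos.trans h1
  have hj : ∫ x, jj (N := N) r0 t x = 0 := by
    rw [← integral_zero (Eu N) ℝ (μ := volume)]
    apply integral_congr_ae
    refine Filter.Eventually.of_forall (fun x => ?_)
    show jj r0 t x = 0
    unfold jj
    rw [if_neg]
    rintro ⟨ha, hb'⟩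
    nlinarith [norm_nonneg x]
  rw [hj, mul_zero, add_zero] at h3
  have h4 := mul_nonneg (pow_pos ht0 N).le h3
  rw [hb.dil_id hi ht0] at h4
  have h6 : 1 < t ^ N := one_lt_pow₀ h1 (by omega)
  have h5 : 0 < ∫ x, (-psx g E t x) := by
    have hc : Continuous (fun x => -psx g E t x) := (psx_cont hb.gd.cont hi.ec t).neg
    apply hc.integral_pos_of_hasCompactSupport_nonneg_nonzero (x := x0)
    · exact cs_of_off (r0 := r0) (fun x hx => by rw [psx_off hi t x hx, neg_zero])
    · intro x
      have := psi_le hb.gd hN hm (norm_nonneg (E x)) ht0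
      show 0 ≤ -psx g E t x
      unfold psx; linarith
    · have := psi_lt hb.gd hN hm (norm_pos_iff.2 hx0) h1
      unfold psx; linarith
  rw [integral_neg] at h5
  nlinarith

theorem Base.inner_const (hb : Base R ε g f u D) (hN : 1 ≤ N) (hm : GM N g) {r0 c : ℝ} (hr0 : 0 < r0) (hr : r0 < R)
    (hu : ∀ x, ‖x‖ = r0 → u x = c) (hD : ∀ x, ‖x‖ = r0 → D x = 0) (x : Eu N) (hx : ‖x‖ < r0) : D x = 0 := by
  have hi : Inn r0 c u D (uin r0 c u) (Din r0 D) :=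
    { wc := uin_cont hr0 hb.uc hu
      ec := Din_cont hr0 hb.dc hD
      grad := fun x => hb.uin_grad hr hu hD x
      woff := fun x hx => by unfold uin; rw [if_neg (not_lt.2 hx)]
      eoff := fun x hx => by unfold Din; rw [if_neg (not_lt.2 hx)]
      win := fun x hx => by unfold uin; rw [if_pos hx]; ring
      ein := fun x hx => by unfold Din; rw [if_pos hx]
      usph := hu
      dsph := hD }
  rw [hi.ein x hx]
  exact hb.E_zero hN hm hi hr0 hr x

end st7
end

open Set Metric MeasureTheory Bornology
open scoped RealInnerProductSpace Classical Topology

noncomputable section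

section st8

theorem oned_end {R : ℝ} (hR : 0 < R) {U U' : ℝ → ℝ} (hc : C1On U U' 0 R) (h0 : ∀ r ∈ Icc 0 R, 0 ≤ U r) (hUR : U R = 0)
    (hne : ∃ r ∈ Icc 0 R, U r ≠ 0) (hZ : ∀ s ∈ Ioo 0 R, U' s = 0 → ∀ r ∈ Ico 0 s, U' r = 0) :
    AntitoneOn U (Icc 0 R) ∧ ∃ R' ∈ Ico 0 R, (∀ r ∈ Ioo R' R, U' r < 0) ∧ ∀ r ∈ Icc 0 R', U r = U 0 := by
  obtain ⟨cU', dU⟩ := hc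
  have cU : ContinuousOn U (Icc 0 R) := fun r hr => (dU r hr).continuousWithinAt
  have dUi : ∀ r ∈ Ioo 0 R, HasDerivAt U (U' r) r := fun r hr =>
    (dU r (Ioo_subset_Icc_self hr)).hasDerivAt (Icc_mem_nhds hr.1 hr.2)
  let S : Set ℝ := insert 0 {r | r ∈ Ioo 0 R ∧ U' r = 0}
  have hS0 : (0:ℝ) ∈ S := mem_insert _ _
  have hSR : ∀ s ∈ S, s ≤ R := by
    rintro s (rfl | hs)
    · exact hR.le
    · exact hs.1.2.le
  have hSb : BddAbove S := ⟨R, hSR⟩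
  obtain ⟨R', hR'⟩ : ∃ R', R' = sSup S := ⟨_, rfl⟩
  have hR'0 : 0 ≤ R' := by rw [hR']; exact le_csSup hSb hS0
  have hR'R : R' ≤ R := by rw [hR']; exact csSup_le ⟨0, hS0⟩ hSR
  have hz : ∀ r ∈ Ico 0 R', U' r = 0 := by
    intro r hr
    have h1 : r < sSup S := hR' ▸ hr.2
    obtain ⟨s, hs, hrs⟩ := exists_lt_of_lt_csSup ⟨0, hS0⟩ h1
    rcases hs with rfl | hs
    · exact absurd hr.1 (not_le.2 hrs)
    · exact hZ s hs.1 hs.2 r ⟨hr.1, hrs⟩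
  have hconst : ∀ r ∈ Icc 0 R', U r = U 0 := by
    apply constant_of_has_deriv_right_zero (cU.mono (Icc_subset_Icc_right hR'R))
    intro r hr
    have h1 := dU r ⟨hr.1, hr.2.le.trans hR'R⟩
    rw [hz r hr] at h1
    have h2 : HasDerivWithinAt U 0 (Icc r R) r := h1.mono (Icc_subset_Icc_left hr.1)
    exact h2.mono_of_mem_nhdsWithin (Icc_mem_nhdsGE (hr.2.trans_le hR'R))
  have hlt : R' < R := by
    rcases hR'R.lt_or_eq with h | h
    · exact h
    exfalso
    obtain ⟨r, hr, hrn⟩ := hne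
    rw [h] at hconst
    rw [hconst r hr, ← hconst R ⟨hR.le, le_rfl⟩] at hrn
    exact hrn hUR
  have hsub : Icc R' R ⊆ Icc 0 R := Icc_subset_Icc_left hR'0
  have hsubo : Ioo R' R ⊆ Ioo 0 R := Ioo_subset_Ioo_left hR'0
  have hnz : ∀ r ∈ Ioo R' R, U' r ≠ 0 := by
    intro r hr hz
    have : r ≤ sSup S := le_csSup hSb (Or.inr ⟨hsubo hr, hz⟩)
    rw [← hR'] at this
    exact absurd hr.1 (not_lt.2 this)
  have hneg : ∀ r ∈ Ioo R' R, U' r < 0 := by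
    intro r hr
    by_contra hge
    have hpos : 0 < U' r := lt_of_le_of_ne (not_lt.1 hge) (Ne.symm (hnz r hr))
    have hall : ∀ s ∈ Ioo R' R, 0 < U' s := by
      intro s hs
      by_contra hs0
      have hsn : U' s ≤ 0 := not_lt.1 hs0
      have := isPreconnected_Ioo.intermediate_value hs hr (cU'.mono (Ioo_subset_Icc_self.trans hsub))
      obtain ⟨q, hq, hq0⟩ := this ⟨hsn, hpos.le⟩
      exact hnz q hq hq0
    have hsm : StrictMonoOn U (Icc R' R) := by
      apply strictMonoOn_of_deriv_pos (convex_Icc _ _) (cU.mono hsub)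
      intro s hs
      rw [interior_Icc] at hs
      rw [(dUi s (hsubo hs)).deriv]
      exact hall s hs
    have h1 := hsm ⟨le_rfl, hlt.le⟩ ⟨hlt.le, le_rfl⟩ hlt
    have h2 := h0 R' ⟨hR'0, hR'R⟩
    rw [hUR] at h1
    linarith
  refine ⟨?_, R', ⟨hR'0, hlt⟩, hneg, hconst⟩
  have a2 : AntitoneOn U (Icc R' R) := by
    apply StrictAntiOn.antitoneOn
    apply strictAntiOn_of_deriv_neg (convex_Icc _ _) (cU.mono hsub)
    intro s hs
    rw [interior_Icc] at hs
    rw [(dUi s (hsubo hs)).deriv]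
    exact hneg s hs
  have a1 : AntitoneOn U (Icc 0 R') := by
    intro a ha b hb _
    rw [hconst a ha, hconst b hb]
  have := a1.union_right a2 (isGreatest_Icc hR'0) (isLeast_Icc hlt.le)
  rwa [Icc_union_Icc_eq_Icc hR'0 hR'R] at this

variable {N : ℕ} {R ε : ℝ} {g f : ℝ → ℝ} {u : Eu N → ℝ} {D : Eu N → Eu N}

theorem Base.endgame (hb : Base R ε g f u D) (hN : 2 ≤ N) (hm : GM N g)
    (hw : ∀ x ∈ closedBall (0 : Eu N) R, HasFDerivWithinAt u (innerSL ℝ (D x)) (closedBall 0 R) x)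
    (hne : ∃ x ∈ closedBall (0 : Eu N) R, u x ≠ 0) :
    ∃ U U', RadialNonincreasing R u U U' ∧ ∃ R' ∈ Ico 0 R, (∀ r ∈ Ioo R' R, U' r < 0) ∧ ∀ r ∈ Icc 0 R', U r = U 0 := by
  obtain ⟨e, he⟩ : ∃ e : Eu N, ‖e‖ = 1 := ⟨EuclideanSpace.single ⟨0, by omega⟩ 1, by simp⟩
  have hrad : ∀ x : Eu N, ‖x‖ ≤ R → u x = u (‖x‖ • e) := fun x hx => hb.radial hN he hx
  let U : ℝ → ℝ := fun r => u (r • e)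
  let U' : ℝ → ℝ := fun r => ⟪D (r • e), e⟫
  have cl : Continuous (fun r : ℝ => r • e) := continuous_id.smul continuous_const
  have cDl : Continuous (fun r : ℝ => D (r • e)) := hb.dc.comp cl
  have cU' : Continuous U' := cDl.inner continuous_const
  have hnr : ∀ r : ℝ, 0 ≤ r → ‖r • e‖ = r := fun r hr => by rw [norm_smul, he, mul_one, Real.norm_of_nonneg hr]
  have dl : ∀ r : ℝ, HasDerivAt (fun r : ℝ => r • e) e r := fun r => by
    have := (hasDerivAt_id r).smul_const e
    rwa [one_smul] at this
  have hmaps : MapsTo (fun r : ℝ => r • e) (Icc 0 R) (closedBall (0 : Eu N) R) := by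
    intro r hr
    rw [mem_closedBall_zero_iff, hnr r hr.1]; exact hr.2
  have hC1 : C1On U U' 0 R := by
    refine ⟨cU'.continuousOn, fun r hr => ?_⟩
    have h0 := (hw (r • e) (hmaps hr)).comp_hasDerivWithinAt r (dl r).hasDerivWithinAt hmaps
    exact h0
  have hZ : ∀ s ∈ Ioo 0 R, U' s = 0 → ∀ r ∈ Ico 0 s, U' r = 0 := by
    intro s hs hs0 r hr
    have hds : HasDerivAt U 0 s := by
      rw [← hs0]
      exact (hC1.2 s (Ioo_subset_Icc_self hs)).hasDerivAt (Icc_mem_nhds hs.1 hs.2)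
    have hDs : ∀ x : Eu N, ‖x‖ = s → D x = 0 := by
      intro x hx
      have hx0 : x ≠ 0 := by
        rintro rfl
        rw [norm_zero] at hx
        exact hs.1.ne hx
      have h1 : DifferentiableAt ℝ (fun y : Eu N => ‖y‖) x := differentiableAt_id.norm ℝ hx0
      have h2 := h1.hasGradientAt
      have h3 : HasGradientAt (fun y : Eu N => U ‖y‖) ((0:ℝ) • gradient (fun y : Eu N => ‖y‖) x) x := by
        apply hgr_comp (φ := U) _ h2
        show HasDerivAt U 0 ‖x‖
        rw [hx]; exact hds
      rw [zero_smul] at h3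
      have hxR : x ∈ ball (0 : Eu N) R := by rw [mem_ball_zero_iff, hx]; exact hs.2
      have h4 : u =ᶠ[𝓝 x] (fun y : Eu N => U ‖y‖) := by
        filter_upwards [isOpen_ball.mem_nhds hxR] with y hy
        exact hrad y (mem_ball_zero_iff.1 hy).le
      exact (hb.adm.grad x hxR).unique (h3.congr_of_eventuallyEq h4)
    have hus : ∀ x : Eu N, ‖x‖ = s → u x = U s := by
      intro x hx
      rw [hrad x (hx.le.trans hs.2.le), hx]
    have := hb.inner_const (by omega) hm hs.1 hs.2 hus hDs (r • e) (by rw [hnr r hr.1]; exact hr.2)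
    show ⟪D (r • e), e⟫ = 0
    rw [this, inner_zero_left]
  have hUne : ∃ r ∈ Icc 0 R, U r ≠ 0 := by
    obtain ⟨x, hx, hxn⟩ := hne
    rw [mem_closedBall_zero_iff] at hx
    refine ⟨‖x‖, ⟨norm_nonneg _, hx⟩, ?_⟩
    rw [hrad x hx] at hxn
    exact hxn
  obtain ⟨ha, hR'⟩ := oned_end hb.Rpos hC1 (fun r _ => hb.nonneg _) (hb.zero _ (hnr R hb.Rpos.le).ge) hUne hZ
  exact ⟨U, U', ⟨hC1, ha, fun x hx => hrad x (mem_closedBall_zero_iff.1 hx)⟩, hR'⟩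

end st8
end

open Set Metric MeasureTheory Bornology
open scoped RealInnerProductSpace Classical Topology

noncomputable section

section st9
variable {N : ℕ}

theorem gmax_eq {g : ℝ → ℝ} {t : ℝ} (ht : 0 ≤ t) : Gfun (fun s => g (max s 0)) t = Gfun g t := by
  unfold Gfun
  apply intervalIntegral.integral_congr
  intro s hs
  rw [uIcc_of_le ht] at hs
  show g (max s 0) = g s
  rw [max_eq_left hs.1]

theorem cmax {g : ℝ → ℝ} (hg : ContinuousOn g (Ici 0)) : Continuous (fun s => g (max s 0)) := by
  have h : Continuous (fun s : ℝ => max s 0) := continuous_id.max continuous_const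
  exact hg.comp_continuous h (fun s => mem_Ici.2 (le_max_right s 0))

theorem gd_max {g : ℝ → ℝ} (hg : GCond g) : Gd (fun s => g (max s 0)) := by
  obtain ⟨h1, h2, h3, h4⟩ := hg
  refine ⟨cmax h1, ?_, ?_, ?_⟩
  · intro t ht
    show g (max t 0) = 0
    rw [max_eq_right ht, h3]
  · apply h2.congr
    intro t ht
    show g (max t 0) = g t
    rw [max_eq_left (le_of_lt ht)]
  · intro t ht
    have : (fun s => g (max s 0)) =ᶠ[𝓝 t] g := by
      filter_upwards [lt_mem_nhds ht] with s hs
      rw [max_eq_left hs.le]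
    rw [this.deriv_eq]
    exact h4 t ht

def prj (R : ℝ) (x : Eu N) : Eu N := (R / max R ‖x‖) • x

theorem prj_cont {R : ℝ} (hR : 0 < R) : Continuous (prj (N := N) R) := by
  have c1 : Continuous (fun x : Eu N => max R ‖x‖) := continuous_const.max continuous_norm
  have c2 : Continuous (fun x : Eu N => R / max R ‖x‖) :=
    continuous_const.div c1 (fun x => (lt_max_of_lt_left hR).ne')
  exact c2.smul continuous_id

theorem prj_in {R : ℝ} (hR : 0 < R) {x : Eu N} (hx : ‖x‖ ≤ R) : prj R x = x := by
  unfold prj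
  rw [max_eq_left hx, div_self hR.ne', one_smul]

theorem prj_out {R : ℝ} (hR : 0 < R) {x : Eu N} (hx : R ≤ ‖x‖) : ‖prj R x‖ = R := by
  unfold prj
  have h0 : 0 < ‖x‖ := hR.trans_le hx
  rw [max_eq_right hx, norm_smul, Real.norm_of_nonneg (by positivity), div_mul_cancel₀ _ h0.ne']

theorem prj_mem {R : ℝ} (hR : 0 < R) (x : Eu N) : prj R x ∈ closedBall (0 : Eu N) R := by
  rw [mem_closedBall_zero_iff]
  rcases le_total ‖x‖ R with h | h
  · rw [prj_in hR h]; exact h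
  · exact (prj_out hR h).le

theorem setup {R : ℝ} (hR : 0 < R) {g f : ℝ → ℝ} (hg : GCond g) (hf : ContinuousOn f (Ici 0))
    {u : Eu N → ℝ} (hu : IsWeakSolPAut R g f u) (hmin : IsLocalMinJ g f (ball 0 R) u) :
    ∃ ε v D, Base R ε (fun s => g (max s 0)) (fun s => f (max s 0)) v D ∧
      (∀ x ∈ closedBall (0 : Eu N) R, u x = v x) ∧
      (∀ x ∈ closedBall (0 : Eu N) R, HasFDerivWithinAt v (innerSL ℝ (D x)) (closedBall 0 R) x) := by
  obtain ⟨uc1, unn, -, uz, -⟩ := hu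
  obtain ⟨-, ε, hε, hm⟩ := hmin
  have hud : UniqueDiffOn ℝ (closedBall (0 : Eu N) R) := by
    apply uniqueDiffOn_convex (convex_closedBall _ _)
    rw [interior_closedBall _ hR.ne']
    exact ⟨0, mem_ball_self hR⟩
  let d : Eu N → Eu N := fun x => (InnerProductSpace.toDual ℝ (Eu N)).symm (fderivWithin ℝ u (closedBall 0 R) x)
  have hdc : ContinuousOn d (closedBall 0 R) := by
    have h1 : ContinuousOn (fderivWithin ℝ u (closedBall 0 R)) (closedBall (0 : Eu N) R) :=
      uc1.continuousOn_fderivWithin hud le_rfl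
    exact (InnerProductSpace.toDual ℝ (Eu N)).symm.continuous.comp_continuousOn h1
  let v : Eu N → ℝ := fun x => u (prj R x)
  let D : Eu N → Eu N := fun x => d (prj R x)
  have vc : Continuous v := uc1.continuousOn.comp_continuous (prj_cont hR) (prj_mem hR)
  have Dc : Continuous D := hdc.comp_continuous (prj_cont hR) (prj_mem hR)
  have huv : ∀ x ∈ closedBall (0 : Eu N) R, v x = u x := by
    intro x hx
    show u (prj R x) = u x
    rw [prj_in hR (mem_closedBall_zero_iff.1 hx)]
  have hdD : ∀ x ∈ closedBall (0 : Eu N) R, D x = d x := by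
    intro x hx
    show d (prj R x) = d x
    rw [prj_in hR (mem_closedBall_zero_iff.1 hx)]
  have hfd : ∀ x ∈ closedBall (0 : Eu N) R, HasFDerivWithinAt v (innerSL ℝ (D x)) (closedBall 0 R) x := by
    intro x hx
    have h1 : HasFDerivWithinAt u (fderivWithin ℝ u (closedBall 0 R) x) (closedBall 0 R) x :=
      (uc1.differentiableOn one_ne_zero x hx).hasFDerivWithinAt
    have h2 : innerSL ℝ (D x) = fderivWithin ℝ u (closedBall 0 R) x := by
      rw [hdD x hx]
      exact (InnerProductSpace.toDual ℝ (Eu N)).apply_symm_apply _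
    rw [h2]
    exact h1.congr huv (huv x hx)
  have hgr : ∀ x ∈ ball (0 : Eu N) R, HasGradientAt v (D x) x := by
    intro x hx
    rw [hgr_fd]
    exact (hfd x (ball_subset_closedBall hx)).hasFDerivAt
      (Filter.mem_of_superset (isOpen_ball.mem_nhds hx) ball_subset_closedBall)
  have hgru : ∀ x ∈ ball (0 : Eu N) R, HasGradientAt u (D x) x := by
    intro x hx
    apply (hgr x hx).congr_of_eventuallyEq
    filter_upwards [isOpen_ball.mem_nhds hx] with y hy
    exact (huv y (ball_subset_closedBall hy)).symm
  have hJ : ∀ z Z, (∀ x ∈ ball (0 : Eu N) R, 0 ≤ z x) → (∀ x ∈ ball (0 : Eu N) R, HasGradientAt z (Z x) x) →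
      Jfun g f (ball 0 R) z = JJ R (fun s => g (max s 0)) (fun s => f (max s 0)) z Z := by
    intro z Z hz hZ
    unfold Jfun JJ
    apply setIntegral_congr_fun measurableSet_ball
    intro x hx
    show Gfun g ‖gradient z x‖ - Gfun f (z x) = _ - _
    rw [gmax_eq (norm_nonneg _), gmax_eq (hz x hx), (hZ x hx).gradient]
  have hadm : Adm R v D :=
    { c1 := uc1.congr huv
      zero := fun x hx => by rw [huv x (sphere_subset_closedBall hx)]; exact uz x hx
      nonneg := fun x _ => unn _ (prj_mem hR x)
      grad := hgr }
  have hJu : JJ R (fun s => g (max s 0)) (fun s => f (max s 0)) v D = Jfun g f (ball 0 R) u := by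
    rw [hJ u D (fun x hx => unn x (ball_subset_closedBall hx)) hgru]
    unfold JJ
    apply setIntegral_congr_fun measurableSet_ball
    intro x hx
    show _ - _ = _ - _
    rw [huv x (ball_subset_closedBall hx)]
  refine ⟨ε, v, D, ?_, fun x hx => (huv x hx).symm, hfd⟩
  refine ⟨hR, hε, gd_max hg, cmax hf, vc, Dc, hadm, fun x => unn _ (prj_mem hR x), ?_, ?_⟩
  · intro x hx
    exact uz _ (by rw [mem_sphere_zero_iff_norm]; exact prj_out hR hx)
  · intro z Z hz hclose
    rw [hJu, ← hJ z Z hz.nonneg hz.grad]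
    apply hm z
    · refine ⟨?_, ?_⟩
      · rw [closure_ball _ hR.ne']; exact hz.c1
      · rw [frontier_ball _ hR.ne']; exact hz.zero
    · intro x hx
      rw [(hz.grad x hx).gradient, (hgru x hx).gradient, ← huv x (ball_subset_closedBall hx)]
      exact hclose x hx

theorem main_aux (hN : 1 ≤ N) (R : ℝ) (hR : 0 < R) (g f : ℝ → ℝ) (hg : GCond g) (hf : ContinuousOn f (Ici 0))
    (hmon : StrictAntiOn (fun t : ℝ => g t * t ^ (1 - (N:ℝ))) (Ioi 0))
    (u : Eu N → ℝ) (hu : IsWeakSolPAut R g f u) (hmin : IsLocalMinJ g f (ball 0 R) u) :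
    ∃ U U', RadialNonincreasing R u U U' ∧ ∃ R' ∈ Ico 0 R, (∀ r ∈ Ioo R' R, U' r < 0) ∧ ∀ r ∈ Icc 0 R', U r = U 0 := by
  obtain ⟨ε, v, D, hb, huv, hfd⟩ := setup hR hg hf hu hmin
  have hm : GM N (fun s => g (max s 0)) := by
    apply GM_of hN
    apply hmon.congr
    intro t ht
    show g t * _ = g (max t 0) * _
    rw [max_eq_left (le_of_lt ht)]
  have hN2 : 2 ≤ N := by
    by_contra hlt
    have h1 : N = 1 := by omega
    have h2 := hm 1 one_pos 2 one_lt_two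
    rw [h1, Nat.sub_self, pow_zero, one_mul, mul_one] at h2
    have h3 := hb.gd.smono (mem_Ici.2 (zero_le_one : (0:ℝ) ≤ 1)) (mem_Ici.2 (zero_le_two : (0:ℝ) ≤ 2)) one_lt_two
    exact lt_asymm h2 h3
  have hne : ∃ x ∈ closedBall (0 : Eu N) R, v x ≠ 0 := by
    obtain ⟨x, hx, hxn⟩ := hu.2.2.1
    exact ⟨x, hx, by rw [← huv x hx]; exact hxn⟩
  obtain ⟨U, U', ⟨h1, h2, h3⟩, h4⟩ := hb.endgame hN2 hm hfd hne
  exact ⟨U, U', ⟨h1, h2, fun x hx => (huv x hx).trans (h3 x hx)⟩, h4⟩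

end st9
end

end Aux

/-- Theorem 4.5: if `t ↦ g(t)·t^{1-N}` is strictly decreasing, then a weak solution of (P)
(autonomous `f`) which is a local minimizer of `J` in `X` is radially symmetric, radially
non-increasing, strictly decreasing in `(R',R)` and constant in `[0,R']`. -/
theorem local_minimizer_radial_of_gmonotone
    {N : ℕ} (hN : 1 ≤ N) (R : ℝ) (hR : 0 < R) (g f : ℝ → ℝ)
    (hg : GCond g) (hf : ContinuousOn f (Ici 0))
    (hmon : StrictAntiOn (fun t : ℝ => g t * t ^ (1 - (N:ℝ))) (Ioi 0))
    (u : EuclideanSpace ℝ (Fin N) → ℝ) (hu : IsWeakSolPAut R g f u)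
    (hmin : IsLocalMinJ g f (ball (0:EuclideanSpace ℝ (Fin N)) R) u) :
    ∃ U U' : ℝ → ℝ, RadialNonincreasing R u U U' ∧
      ∃ R' ∈ Ico (0:ℝ) R, (∀ r ∈ Ioo R' R, U' r < 0) ∧ ∀ r ∈ Icc (0:ℝ) R', U r = U 0 := by
  exact main_aux hN R hR g f hg hf hmon u hu hmin
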